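/- arXiv:2401.08533 — 3 statements merged into one kernel-verified Lean document; each statement's English description precedes it below -/
import Mathlib

section
/- Assume 0 < κ < a and that ξ lies in the open interval (τ(a − √(a²−κ²)), τ(a + √(a²−κ²))). Then there exist constants C > 0 and w > 0, depending only on L, a, κ, τ and ξ, such that every smooth solution (u,θ) of the thermoelastic string with delayed heat conduction satisfies E(t) ≤ C·e^{−wt}·E(0) for all t ≥ 0. -/
open MeasureTheory intervalIntegral

/-- Partial derivative in the space variable of `f : ℝ → ℝ → ℝ` (first argument). -/
noncomputable def pdX (f : ℝ → ℝ → ℝ) (x t : ℝ) : ℝ := deriv (fun y => f y t) x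

/-- Partial derivative in the time variable of `f : ℝ → ℝ → ℝ` (second argument). -/
noncomputable def pdT (f : ℝ → ℝ → ℝ) (x t : ℝ) : ℝ := deriv (fun s => f x s) t

/-- A smooth solution of the thermoelastic string with delayed heat conduction. -/
structure IsSmoothSolDelayedHeatString (L τ a κ : ℝ) (u θ : ℝ → ℝ → ℝ) : Prop where
  smooth_u : ContDiff ℝ (⊤ : ℕ∞) (fun p : ℝ × ℝ => u p.1 p.2)
  smooth_θ : ContDiff ℝ (⊤ : ℕ∞) (fun p : ℝ × ℝ => θ p.1 p.2)
  pde_u : ∀ x ∈ Set.Ioo (0 : ℝ) L, ∀ t > (0 : ℝ),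
    pdT (pdT u) x t - pdX (pdX u) x t + pdX θ x t = 0
  pde_θ : ∀ x ∈ Set.Ioo (0 : ℝ) L, ∀ t > (0 : ℝ),
    pdT θ x t - κ * pdX (pdX θ) x (t - τ) - a * pdX (pdX θ) x t + pdX (pdT u) x t = 0
  bc_u : ∀ t : ℝ, 0 ≤ t → u 0 t = 0 ∧ u L t = 0
  bc_θ : ∀ t : ℝ, -τ ≤ t → θ 0 t = 0 ∧ θ L t = 0

/-- The energy of the thermoelastic string with delayed heat conduction. -/
noncomputable def energyDHString (L τ ξ : ℝ) (u θ : ℝ → ℝ → ℝ) (t : ℝ) : ℝ :=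
  (1 / 2) * ((∫ x in (0 : ℝ)..L, ((pdT u x t) ^ 2 + (pdX u x t) ^ 2 + (θ x t) ^ 2))
    + ξ * ∫ x in (0 : ℝ)..L, ∫ ρ in (0 : ℝ)..(1 : ℝ), (pdX θ x (t - τ * ρ)) ^ 2)


namespace DHS

/-- Joint smoothness of a function of two real variables. -/
def Sm (f : ℝ → ℝ → ℝ) : Prop := ContDiff ℝ (⊤ : ℕ∞) (fun p : ℝ × ℝ => f p.1 p.2)

lemma Sm.hasX_aux {f : ℝ → ℝ → ℝ} (hf : Sm f) (x t : ℝ) :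
    HasDerivAt (fun y => f y t) (fderiv ℝ (fun p : ℝ × ℝ => f p.1 p.2) (x, t) (1, 0)) x := by
  have h1 : HasFDerivAt (fun p : ℝ × ℝ => f p.1 p.2)
      (fderiv ℝ (fun p : ℝ × ℝ => f p.1 p.2) (x, t)) (x, t) :=
    ((hf.differentiable (by simp)) (x, t)).hasFDerivAt
  have h2 : HasDerivAt (fun y : ℝ => (y, t)) ((1 : ℝ), (0 : ℝ)) x :=
    (hasDerivAt_id x).prodMk (hasDerivAt_const x t)
  exact h1.comp_hasDerivAt x h2

lemma Sm.hasT_aux {f : ℝ → ℝ → ℝ} (hf : Sm f) (x t : ℝ) :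
    HasDerivAt (fun s => f x s) (fderiv ℝ (fun p : ℝ × ℝ => f p.1 p.2) (x, t) (0, 1)) t := by
  have h1 : HasFDerivAt (fun p : ℝ × ℝ => f p.1 p.2)
      (fderiv ℝ (fun p : ℝ × ℝ => f p.1 p.2) (x, t)) (x, t) :=
    ((hf.differentiable (by simp)) (x, t)).hasFDerivAt
  have h2 : HasDerivAt (fun y : ℝ => (x, y)) ((0 : ℝ), (1 : ℝ)) t :=
    (hasDerivAt_const t x).prodMk (hasDerivAt_id t)
  exact h1.comp_hasDerivAt t h2

lemma Sm.pdX_eq {f : ℝ → ℝ → ℝ} (hf : Sm f) (x t : ℝ) :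
    pdX f x t = fderiv ℝ (fun p : ℝ × ℝ => f p.1 p.2) (x, t) (1, 0) := (hf.hasX_aux x t).deriv

lemma Sm.pdT_eq {f : ℝ → ℝ → ℝ} (hf : Sm f) (x t : ℝ) :
    pdT f x t = fderiv ℝ (fun p : ℝ × ℝ => f p.1 p.2) (x, t) (0, 1) := (hf.hasT_aux x t).deriv

lemma Sm.hasX {f : ℝ → ℝ → ℝ} (hf : Sm f) (x t : ℝ) :
    HasDerivAt (fun y => f y t) (pdX f x t) x := by
  rw [hf.pdX_eq]; exact hf.hasX_aux x t

lemma Sm.hasT {f : ℝ → ℝ → ℝ} (hf : Sm f) (x t : ℝ) :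
    HasDerivAt (fun s => f x s) (pdT f x t) t := by
  rw [hf.pdT_eq]; exact hf.hasT_aux x t

lemma Sm.fd {f : ℝ → ℝ → ℝ} (hf : Sm f) :
    ContDiff ℝ (⊤ : ℕ∞) (fderiv ℝ (fun p : ℝ × ℝ => f p.1 p.2)) :=
  ContDiff.fderiv_right hf (by simp)

lemma Sm.pdX {f : ℝ → ℝ → ℝ} (hf : Sm f) : Sm (pdX f) := by
  have : (fun p : ℝ × ℝ => _root_.pdX f p.1 p.2)
      = fun p => fderiv ℝ (fun p : ℝ × ℝ => f p.1 p.2) p (1, 0) := by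
    funext p; exact hf.pdX_eq p.1 p.2
  unfold Sm; rw [this]
  exact hf.fd.clm_apply contDiff_const

lemma Sm.pdT {f : ℝ → ℝ → ℝ} (hf : Sm f) : Sm (pdT f) := by
  have : (fun p : ℝ × ℝ => _root_.pdT f p.1 p.2)
      = fun p => fderiv ℝ (fun p : ℝ × ℝ => f p.1 p.2) p (0, 1) := by
    funext p; exact hf.pdT_eq p.1 p.2
  unfold Sm; rw [this]
  exact hf.fd.clm_apply contDiff_const

lemma Sm.cont {f : ℝ → ℝ → ℝ} (hf : Sm f) : Continuous (fun p : ℝ × ℝ => f p.1 p.2) :=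
  ContDiff.continuous hf

lemma Sm.contx {f : ℝ → ℝ → ℝ} (hf : Sm f) (t : ℝ) : Continuous (fun x => f x t) :=
  hf.cont.comp (by fun_prop : Continuous fun x : ℝ => (x, t))

lemma Sm.contt {f : ℝ → ℝ → ℝ} (hf : Sm f) (x : ℝ) : Continuous (fun t => f x t) :=
  hf.cont.comp (by fun_prop : Continuous fun t : ℝ => (x, t))

lemma Sm.comm {f : ℝ → ℝ → ℝ} (hf : Sm f) (x t : ℝ) :
    _root_.pdT (_root_.pdX f) x t = _root_.pdX (_root_.pdT f) x t := by
  rw [hf.pdX.pdT_eq, hf.pdT.pdX_eq]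
  have e1 : (fun p : ℝ × ℝ => _root_.pdX f p.1 p.2)
      = fun p => fderiv ℝ (fun p : ℝ × ℝ => f p.1 p.2) p (1, 0) := by
    funext p; exact hf.pdX_eq p.1 p.2
  have e2 : (fun p : ℝ × ℝ => _root_.pdT f p.1 p.2)
      = fun p => fderiv ℝ (fun p : ℝ × ℝ => f p.1 p.2) p (0, 1) := by
    funext p; exact hf.pdT_eq p.1 p.2
  rw [e1, e2]
  have hd : DifferentiableAt ℝ (fderiv ℝ (fun p : ℝ × ℝ => f p.1 p.2)) (x, t) :=
    (hf.fd.differentiable (by simp)) _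
  have h1 : ∀ w : ℝ × ℝ, fderiv ℝ (fun p => fderiv ℝ (fun p : ℝ × ℝ => f p.1 p.2) p w) (x, t)
      = (fderiv ℝ (fderiv ℝ (fun p : ℝ × ℝ => f p.1 p.2)) (x, t)).flip w := by
    intro w
    have := hd.hasFDerivAt.clm_apply (hasFDerivAt_const w (x, t))
    rw [this.fderiv]
    ext <;> simp
  rw [h1, h1]
  have hs : IsSymmSndFDerivAt ℝ (fun p : ℝ × ℝ => f p.1 p.2) (x, t) :=
    (ContDiff.contDiffAt hf).isSymmSndFDerivAt (by
      simp only [minSmoothness_of_isRCLikeNormedField]; 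
      exact WithTop.coe_le_coe.2 (le_top : (2 : ℕ∞) ≤ ⊤))
  simpa using hs (0, 1) (1, 0)

/-- Differentiation under the integral sign. -/
lemma deriv_int {f f' : ℝ → ℝ → ℝ} (hf : ∀ t, Continuous (fun x => f x t))
    (hf' : Continuous (fun p : ℝ × ℝ => f' p.1 p.2))
    (h : ∀ x t, HasDerivAt (fun s => f x s) (f' x t) t) (a b t : ℝ) :
    HasDerivAt (fun s => ∫ x in a..b, f x s) (∫ x in a..b, f' x t) t := by
  have hK : IsCompact (Set.uIcc a b ×ˢ Metric.closedBall t 1) :=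
    isCompact_uIcc.prod (isCompact_closedBall t 1)
  obtain ⟨C, hC⟩ := hK.exists_bound_of_continuousOn hf'.continuousOn
  refine (intervalIntegral.hasDerivAt_integral_of_dominated_loc_of_deriv_le
    (μ := volume) (s := Metric.ball t 1) (bound := fun _ => C) (F := fun s x => f x s)
    (F' := fun s x => f' x s) (Metric.ball_mem_nhds t one_pos) ?_ ?_ ?_ ?_ ?_ ?_).2
  · exact Filter.Eventually.of_forall fun s => (hf s).aestronglyMeasurable
  · exact (hf t).intervalIntegrable _ _
  · exact (hf'.comp (by fun_prop : Continuous fun x : ℝ => (x, t))).aestronglyMeasurable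
  · refine Filter.Eventually.of_forall fun x hx s hs => ?_
    exact hC (x, s) ⟨Set.uIoc_subset_uIcc hx, Metric.ball_subset_closedBall hs⟩
  · exact intervalIntegrable_const
  · exact Filter.Eventually.of_forall fun x _ s _ => h x s

/-- Fundamental theorem of calculus in the form we use. -/
lemma ftc {F F' : ℝ → ℝ} (h : ∀ x, HasDerivAt F (F' x) x) (hc : Continuous F') (a b : ℝ) :
    ∫ x in a..b, F' x = F b - F a :=
  intervalIntegral.integral_eq_sub_of_hasDerivAt (fun x _ => h x) (hc.intervalIntegrable _ _)

/-- Two continuous functions which agree on the open interval agree on the closed one. -/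
lemma eq_Icc {f g : ℝ → ℝ} {L : ℝ} (hL : 0 < L) (hf : Continuous f) (hg : Continuous g)
    (h : ∀ x ∈ Set.Ioo (0 : ℝ) L, f x = g x) : ∀ x ∈ Set.Icc (0 : ℝ) L, f x = g x := by
  have h1 : Set.EqOn f g (closure (Set.Ioo (0 : ℝ) L)) := Set.EqOn.closure h hf hg
  rw [closure_Ioo hL.ne] at h1
  exact h1

/-- Monotonicity for integrals of continuous functions. -/
lemma int_mono {f g : ℝ → ℝ} {L : ℝ} (hL : 0 < L) (hf : Continuous f) (hg : Continuous g)
    (h : ∀ x ∈ Set.Icc (0 : ℝ) L, f x ≤ g x) : ∫ x in (0:ℝ)..L, f x ≤ ∫ x in (0:ℝ)..L, g x :=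
  intervalIntegral.integral_mono_on hL.le (hf.intervalIntegrable _ _) (hg.intervalIntegrable _ _) h

lemma int_nonneg {f : ℝ → ℝ} {L : ℝ} (hL : 0 < L)
    (h : ∀ x ∈ Set.Icc (0 : ℝ) L, 0 ≤ f x) : 0 ≤ ∫ x in (0:ℝ)..L, f x :=
  intervalIntegral.integral_nonneg hL.le h

lemma int_congr {f g : ℝ → ℝ} {L : ℝ} (hL : 0 < L)
    (h : ∀ x ∈ Set.Icc (0 : ℝ) L, f x = g x) : ∫ x in (0:ℝ)..L, f x = ∫ x in (0:ℝ)..L, g x :=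
  intervalIntegral.integral_congr (fun x hx => h x (by rwa [Set.uIcc_of_le hL.le] at hx))

lemma int_add {f g : ℝ → ℝ} {L : ℝ} (hf : Continuous f) (hg : Continuous g) :
    ∫ x in (0:ℝ)..L, (f x + g x) = (∫ x in (0:ℝ)..L, f x) + ∫ x in (0:ℝ)..L, g x :=
  intervalIntegral.integral_add (hf.intervalIntegrable _ _) (hg.intervalIntegrable _ _)

lemma int_sub {f g : ℝ → ℝ} {L : ℝ} (hf : Continuous f) (hg : Continuous g) :
    ∫ x in (0:ℝ)..L, (f x - g x) = (∫ x in (0:ℝ)..L, f x) - ∫ x in (0:ℝ)..L, g x :=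
  intervalIntegral.integral_sub (hf.intervalIntegrable _ _) (hg.intervalIntegrable _ _)

/-- Cauchy-Schwarz. -/
lemma cs {f g : ℝ → ℝ} {L : ℝ} (hL : 0 < L) (hf : Continuous f) (hg : Continuous g) :
    (∫ x in (0:ℝ)..L, f x * g x) ^ 2
      ≤ (∫ x in (0:ℝ)..L, f x ^ 2) * ∫ x in (0:ℝ)..L, g x ^ 2 := by
  have key : ∀ r : ℝ, 0 ≤ (∫ x in (0:ℝ)..L, f x ^ 2) * (r * r)
      + (2 * ∫ x in (0:ℝ)..L, f x * g x) * r + ∫ x in (0:ℝ)..L, g x ^ 2 := by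
    intro r
    have h0 : 0 ≤ ∫ x in (0:ℝ)..L, (r * f x + g x) ^ 2 := int_nonneg hL fun x _ => sq_nonneg _
    have h1 : ∫ x in (0:ℝ)..L, (r * f x + g x) ^ 2
        = ∫ x in (0:ℝ)..L, ((r * r) * f x ^ 2 + (2 * r) * (f x * g x) + g x ^ 2) := by
      congr 1; funext x; ring
    rw [h1, int_add (by fun_prop) (by fun_prop), int_add (by fun_prop) (by fun_prop),
      intervalIntegral.integral_const_mul, intervalIntegral.integral_const_mul] at h0
    linarith
  have := discrim_le_zero key
  unfold discrim at this
  nlinarith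

/-- Cauchy-Schwarz on an initial subinterval. -/
lemma cs_one {f : ℝ → ℝ} {L : ℝ} (hf : Continuous f) {x : ℝ} (hx : x ∈ Set.Icc (0 : ℝ) L) :
    (∫ y in (0:ℝ)..x, f y) ^ 2 ≤ L * ∫ y in (0:ℝ)..L, f y ^ 2 := by
  have hmono : ∫ y in (0:ℝ)..x, f y ^ 2 ≤ ∫ y in (0:ℝ)..L, f y ^ 2 := by
    apply intervalIntegral.integral_mono_interval le_rfl hx.1 hx.2
    · exact Filter.Eventually.of_forall fun y => sq_nonneg _
    · exact (by fun_prop : Continuous fun y => f y ^ 2).intervalIntegrable _ _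
  have hL : 0 ≤ L := hx.1.trans hx.2
  rcases eq_or_lt_of_le hx.1 with h0 | h0
  · subst h0
    have : 0 ≤ ∫ y in (0:ℝ)..L, f y ^ 2 :=
      intervalIntegral.integral_nonneg hL fun y _ => sq_nonneg _
    simpa using mul_nonneg hL this
  · have h1 := cs h0 (continuous_const (y := (1:ℝ))) hf
    simp only [one_mul, one_pow, intervalIntegral.integral_const, smul_eq_mul, mul_one,
      sub_zero] at h1
    have h2 : 0 ≤ ∫ y in (0:ℝ)..x, f y ^ 2 :=
      intervalIntegral.integral_nonneg h0.le fun y _ => sq_nonneg _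
    calc _ ≤ _ := h1
      _ ≤ _ := mul_le_mul hx.2 hmono h2 hL

/-- Poincare inequality. -/
lemma poincare {f f' : ℝ → ℝ} {L : ℝ} (hL : 0 < L) (h : ∀ x, HasDerivAt f (f' x) x)
    (hc : Continuous f') (h0 : f 0 = 0) :
    ∫ x in (0:ℝ)..L, f x ^ 2 ≤ L ^ 2 * ∫ x in (0:ℝ)..L, f' x ^ 2 := by
  have hfc : Continuous f := continuous_iff_continuousAt.2 fun x => (h x).continuousAt
  have : ∀ x ∈ Set.Icc (0:ℝ) L, f x ^ 2 ≤ L * ∫ x in (0:ℝ)..L, f' x ^ 2 := by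
    intro x hx
    have := cs_one hc hx
    rwa [ftc h hc, h0, sub_zero] at this
  have h2 := int_mono hL (by fun_prop) continuous_const this
  rw [intervalIntegral.integral_const, smul_eq_mul] at h2
  calc _ ≤ _ := h2
    _ = _ := by ring

/-- Integration by parts in the form we use. -/
lemma int_parts {f g F F' : ℝ → ℝ} {L : ℝ} (hL : 0 < L) (hg : Continuous g)
    (hF : ∀ x, HasDerivAt F (F' x) x) (hF' : Continuous F')
    (h : ∀ x ∈ Set.Icc (0 : ℝ) L, f x = g x + F' x) :
    ∫ x in (0:ℝ)..L, f x = (∫ x in (0:ℝ)..L, g x) + (F L - F 0) := by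
  rw [← ftc hF hF', ← int_add hg hF']
  exact int_congr hL h

/-- First part of the energy. -/
noncomputable def fE (L : ℝ) (u θ : ℝ → ℝ → ℝ) (t : ℝ) : ℝ :=
  ∫ x in (0 : ℝ)..L, ((pdT u x t) ^ 2 + (pdX u x t) ^ 2 + (θ x t) ^ 2)

/-- The thermal dissipation. -/
noncomputable def fG (L : ℝ) (θ : ℝ → ℝ → ℝ) (t : ℝ) : ℝ :=
  ∫ x in (0 : ℝ)..L, (pdX θ x t) ^ 2

/-- The history term. -/
noncomputable def fD (L τ : ℝ) (θ : ℝ → ℝ → ℝ) (t : ℝ) : ℝ :=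
  ∫ ρ in (0 : ℝ)..1, fG L θ (t - τ * ρ)

/-- The weighted history term. -/
noncomputable def fZ (L τ : ℝ) (θ : ℝ → ℝ → ℝ) (t : ℝ) : ℝ :=
  ∫ ρ in (0 : ℝ)..1, (2 - ρ) * fG L θ (t - τ * ρ)

/-- The multiplier `u`. -/
noncomputable def fU (L : ℝ) (u : ℝ → ℝ → ℝ) (t : ℝ) : ℝ :=
  ∫ x in (0 : ℝ)..L, u x t * pdT u x t

/-- The multiplier `(x - L/2) u_x`. -/
noncomputable def fQ (L : ℝ) (u : ℝ → ℝ → ℝ) (t : ℝ) : ℝ :=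
  ∫ x in (0 : ℝ)..L, (L / 2 - x) * (pdT u x t * pdX u x t)

/-- Mean velocity. -/
noncomputable def fc (L : ℝ) (u : ℝ → ℝ → ℝ) (t : ℝ) : ℝ :=
  (1 / L) * ∫ x in (0 : ℝ)..L, pdT u x t

/-- A primitive of the velocity minus its mean. -/
noncomputable def fV (L : ℝ) (u : ℝ → ℝ → ℝ) (x t : ℝ) : ℝ :=
  (∫ y in (0 : ℝ)..x, pdT u y t) - x * fc L u t

/-- The main functional. -/
noncomputable def fM (L : ℝ) (u θ : ℝ → ℝ → ℝ) (t : ℝ) : ℝ :=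
  -∫ x in (0 : ℝ)..L, θ x t * fV L u x t

/-- Test function, its derivative, its second derivative. -/
noncomputable def φ0 (L x : ℝ) : ℝ := (x * (L - x)) ^ 2 - L ^ 2 / 5 * (x * (L - x))
noncomputable def φ1 (L x : ℝ) : ℝ := (2 * (x * (L - x)) - L ^ 2 / 5) * (L - 2 * x)
noncomputable def φ2 (L x : ℝ) : ℝ := 2 * (L - 2 * x) ^ 2 - 2 * (2 * (x * (L - x)) - L ^ 2 / 5)

noncomputable def fR (L : ℝ) (u : ℝ → ℝ → ℝ) (t : ℝ) : ℝ :=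
  ∫ x in (0 : ℝ)..L, pdT u x t * φ0 L x

noncomputable def fS (L : ℝ) (u : ℝ → ℝ → ℝ) (t : ℝ) : ℝ :=
  ∫ x in (0 : ℝ)..L, u x t * φ2 L x

lemma hasDeriv_φ0 (L x : ℝ) : HasDerivAt (φ0 L) (φ1 L x) x := by
  have h : HasDerivAt (fun x : ℝ => x * (L - x)) (1 * (L - x) + x * (-1)) x :=
    (hasDerivAt_id x).mul ((hasDerivAt_id x).const_sub L)
  have := (h.pow 2).sub (h.const_mul (L ^ 2 / 5))
  refine this.congr_deriv ?_
  simp [φ1]; ring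

lemma hasDeriv_φ1 (L x : ℝ) : HasDerivAt (φ1 L) (φ2 L x) x := by
  have h : HasDerivAt (fun x : ℝ => x * (L - x)) (1 * (L - x) + x * (-1)) x :=
    (hasDerivAt_id x).mul ((hasDerivAt_id x).const_sub L)
  have h2 := ((h.const_mul 2).sub_const (L ^ 2 / 5)).mul
    (((hasDerivAt_id x).const_mul 2).const_sub L)
  refine h2.congr_deriv ?_
  simp [φ2]; ring

lemma cont_φ0 (L : ℝ) : Continuous (φ0 L) := by unfold φ0; fun_prop
lemma cont_φ1 (L : ℝ) : Continuous (φ1 L) := by unfold φ1; fun_prop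
lemma cont_φ2 (L : ℝ) : Continuous (φ2 L) := by unfold φ2; fun_prop

lemma int_φ2 (L : ℝ) : ∫ x in (0 : ℝ)..L, φ2 L x = 2 * L ^ 3 / 5 := by
  rw [ftc (hasDeriv_φ1 L) (cont_φ2 L)]; simp [φ1]; ring

lemma int_φ0 (L : ℝ) : ∫ x in (0 : ℝ)..L, φ0 L x = 0 := by
  have h : ∀ x, HasDerivAt (fun x : ℝ => L ^ 2 * (x ^ 3 / 3) - 2 * L * (x ^ 4 / 4) + x ^ 5 / 5
      - L ^ 2 / 5 * (L * (x ^ 2 / 2) - x ^ 3 / 3)) (φ0 L x) x := by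
    intro x
    have h2 := ((hasDerivAt_pow 2 x).div_const 2)
    have h3 := ((hasDerivAt_pow 3 x).div_const 3)
    have h4 := ((hasDerivAt_pow 4 x).div_const 4)
    have h5 := ((hasDerivAt_pow 5 x).div_const 5)
    have := (((h3.const_mul (L ^ 2)).sub (h4.const_mul (2 * L))).add h5).sub
      (((h2.const_mul L).sub h3).const_mul (L ^ 2 / 5))
    refine this.congr_deriv ?_
    simp [φ0]; ring
  rw [ftc h (cont_φ0 L)]; ring

section
variable {L τ a κ : ℝ} {u θ : ℝ → ℝ → ℝ}

lemma sU (h : IsSmoothSolDelayedHeatString L τ a κ u θ) : Sm u := h.smooth_u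
lemma sθ (h : IsSmoothSolDelayedHeatString L τ a κ u θ) : Sm θ := h.smooth_θ

lemma v_bd (h : IsSmoothSolDelayedHeatString L τ a κ u θ) {t : ℝ} (ht : 0 < t) :
    pdT u 0 t = 0 ∧ pdT u L t = 0 := by
  constructor
  · have : (fun s => u 0 s) =ᶠ[nhds t] fun _ => 0 := by
      filter_upwards [lt_mem_nhds ht] with s hs using (h.bc_u s hs.le).1
    unfold pdT; rw [this.deriv_eq]; simp
  · have : (fun s => u L s) =ᶠ[nhds t] fun _ => 0 := by
      filter_upwards [lt_mem_nhds ht] with s hs using (h.bc_u s hs.le).2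
    unfold pdT; rw [this.deriv_eq]; simp

lemma pde1 (hL : 0 < L) (h : IsSmoothSolDelayedHeatString L τ a κ u θ) {t : ℝ} (ht : 0 < t) :
    ∀ x ∈ Set.Icc (0:ℝ) L, pdT (pdT u) x t = pdX (pdX u) x t - pdX θ x t := by
  apply eq_Icc hL ((sU h).pdT.pdT.contx t)
  · have := (sU h).pdX.pdX.contx t
    have := (sθ h).pdX.contx t
    fun_prop
  intro x hx
  linarith [h.pde_u x hx t ht]

lemma pde2 (hL : 0 < L) (h : IsSmoothSolDelayedHeatString L τ a κ u θ) {t : ℝ} (ht : 0 < t) :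
    ∀ x ∈ Set.Icc (0:ℝ) L, pdT θ x t =
      κ * pdX (pdX θ) x (t - τ) + a * pdX (pdX θ) x t - pdX (pdT u) x t := by
  apply eq_Icc hL ((sθ h).pdT.contx t)
  · have := (sθ h).pdX.pdX.contx t
    have := (sθ h).pdX.pdX.contx (t - τ)
    have := (sU h).pdT.pdX.contx t
    fun_prop
  intro x hx
  linarith [h.pde_θ x hx t ht]

lemma Sm.mul {f g : ℝ → ℝ → ℝ} (hf : Sm f) (hg : Sm g) : Sm (fun x t => f x t * g x t) :=
  ContDiff.mul hf hg

lemma dE (hL : 0 < L) (h : IsSmoothSolDelayedHeatString L τ a κ u θ) {t : ℝ} (ht : 0 < t)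
    (ht' : -τ ≤ t) :
    HasDerivAt (fE L u θ) (-2 * ∫ x in (0:ℝ)..L,
      pdX θ x t * (κ * pdX θ x (t - τ) + a * pdX θ x t)) t := by
  have hu := sU h
  have hθ := sθ h
  have c1 := hu.pdT.cont
  have c2 := hu.pdX.cont
  have c3 := hθ.cont
  have c4 := hu.pdT.pdT.cont
  have c5 := hu.pdX.pdT.cont
  have c6 := hθ.pdT.cont
  have d1 := hu.pdT.contx t
  have d2 := hu.pdX.contx t
  have d3 := hθ.contx t
  have d4 := hθ.pdX.contx t
  have d5 := hθ.pdX.contx (t - τ)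
  have d6 := hu.pdT.pdX.contx t
  have d7 := hu.pdX.pdX.contx t
  have d8 := hθ.pdX.pdX.contx t
  have d9 := hθ.pdX.pdX.contx (t - τ)
  have key := deriv_int (f := fun x t => (pdT u x t) ^ 2 + (pdX u x t) ^ 2 + (θ x t) ^ 2)
    (f' := fun x t => 2 * pdT u x t * pdT (pdT u) x t + 2 * pdX u x t * pdT (pdX u) x t
      + 2 * θ x t * pdT θ x t)
    (fun t => by
      have := hu.pdT.contx t
      have := hu.pdX.contx t
      have := hθ.contx t
      fun_prop) (by fun_prop)
    (fun x t => by
      have := (((hu.pdT.hasT x t).pow 2).add ((hu.pdX.hasT x t).pow 2)).add ((hθ.hasT x t).pow 2)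
      refine this.congr_deriv ?_
      simp) 0 L t
  refine key.congr_deriv ?_
  have F := int_parts (F := fun x => 2 * (pdT u x t * pdX u x t - pdT u x t * θ x t
      + θ x t * (κ * pdX θ x (t - τ) + a * pdX θ x t)))
    (g := fun x => -2 * (pdX θ x t * (κ * pdX θ x (t - τ) + a * pdX θ x t)))
    (f := fun x => 2 * pdT u x t * pdT (pdT u) x t + 2 * pdX u x t * pdT (pdX u) x t
      + 2 * θ x t * pdT θ x t) hL (by fun_prop)
    (fun x => (((((hu.pdT.hasX x t).mul (hu.pdX.hasX x t)).sub
      ((hu.pdT.hasX x t).mul (hθ.hasX x t))).add ((hθ.hasX x t).mul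
      (((hθ.pdX.hasX x (t - τ)).const_mul κ).add ((hθ.pdX.hasX x t).const_mul a)))).const_mul 2))
    (by fun_prop) (fun x hx => by
      rw [pde1 hL h ht x hx, pde2 hL h ht x hx, hu.comm x t]
      simp only [Pi.add_apply]
      ring)
  have b1 := v_bd h ht
  have b2 := h.bc_θ t ht'
  simp only [b1.1, b1.2, b2.1, b2.2] at F
  rw [F, intervalIntegral.integral_const_mul]
  ring

lemma dU (hL : 0 < L) (h : IsSmoothSolDelayedHeatString L τ a κ u θ) {t : ℝ} (ht : 0 < t) :
    HasDerivAt (fU L u) (∫ x in (0:ℝ)..L,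
      ((pdT u x t) ^ 2 - (pdX u x t) ^ 2 + pdX u x t * θ x t)) t := by
  have hu := sU h
  have hθ := sθ h
  have c0 := hu.cont
  have c1 := hu.pdT.cont
  have c4 := hu.pdT.pdT.cont
  have d0 := hu.contx t
  have d1 := hu.pdT.contx t
  have d2 := hu.pdX.contx t
  have d3 := hθ.contx t
  have d4 := hθ.pdX.contx t
  have d7 := hu.pdX.pdX.contx t
  have key := deriv_int (f := fun x t => u x t * pdT u x t)
    (f' := fun x t => pdT u x t * pdT u x t + u x t * pdT (pdT u) x t)
    (fun t => by
      have := hu.pdT.contx t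
      have := hu.contx t
      fun_prop) (by fun_prop)
    (fun x t => (hu.hasT x t).mul (hu.pdT.hasT x t)) 0 L t
  refine key.congr_deriv ?_
  have F := int_parts (F := fun x => u x t * (pdX u x t - θ x t))
    (g := fun x => (pdT u x t) ^ 2 - (pdX u x t) ^ 2 + pdX u x t * θ x t)
    (f := fun x => pdT u x t * pdT u x t + u x t * pdT (pdT u) x t) hL (by fun_prop)
    (fun x => (hu.hasX x t).mul ((hu.pdX.hasX x t).sub (hθ.hasX x t)))
    (by fun_prop) (fun x hx => by
      rw [pde1 hL h ht x hx]
      ring)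
  have b1 := h.bc_u t ht.le
  simp only [b1.1, b1.2] at F
  rw [F]
  ring

lemma dQ (hL : 0 < L) (h : IsSmoothSolDelayedHeatString L τ a κ u θ) {t : ℝ} (ht : 0 < t) :
    HasDerivAt (fQ L u) ((∫ x in (0:ℝ)..L,
      ((1 / 2) * ((pdT u x t) ^ 2 + (pdX u x t) ^ 2) - (L / 2 - x) * (pdX θ x t * pdX u x t)))
      - L / 4 * ((pdX u 0 t) ^ 2 + (pdX u L t) ^ 2)) t := by
  have hu := sU h
  have hθ := sθ h
  have c1 := hu.pdT.cont
  have c2 := hu.pdX.cont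
  have c4 := hu.pdT.pdT.cont
  have c5 := hu.pdX.pdT.cont
  have d1 := hu.pdT.contx t
  have d2 := hu.pdX.contx t
  have d4 := hθ.pdX.contx t
  have d6 := hu.pdT.pdX.contx t
  have d7 := hu.pdX.pdX.contx t
  have key := deriv_int (f := fun x t => (L / 2 - x) * (pdT u x t * pdX u x t))
    (f' := fun x t => (L / 2 - x) * (pdT (pdT u) x t * pdX u x t + pdT u x t * pdT (pdX u) x t))
    (fun t => by
      have := hu.pdT.contx t
      have := hu.pdX.contx t
      fun_prop) (by fun_prop)
    (fun x t => ((hu.pdT.hasT x t).mul (hu.pdX.hasT x t)).const_mul _) 0 L t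
  refine key.congr_deriv ?_
  have F := int_parts
    (F := fun x => (1 / 2) * ((L / 2 - x) * (pdX u x t * pdX u x t + pdT u x t * pdT u x t)))
    (g := fun x => (1 / 2) * ((pdT u x t) ^ 2 + (pdX u x t) ^ 2)
      - (L / 2 - x) * (pdX θ x t * pdX u x t))
    (f := fun x => (L / 2 - x) * (pdT (pdT u) x t * pdX u x t + pdT u x t * pdT (pdX u) x t))
    hL (by fun_prop)
    (fun x => (((hasDerivAt_id x).const_sub (L / 2)).mul
      (((hu.pdX.hasX x t).mul (hu.pdX.hasX x t)).add
        ((hu.pdT.hasX x t).mul (hu.pdT.hasX x t)))).const_mul (1 / 2))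
    (by simp only [Pi.add_apply, Pi.mul_apply, id]; fun_prop) (fun x hx => by
      rw [pde1 hL h ht x hx, hu.comm x t]
      simp only [Pi.add_apply, Pi.mul_apply, id]
      ring)
  have b1 := v_bd h ht
  simp only [b1.1, b1.2] at F
  rw [F]
  ring

lemma dc (hL : 0 < L) (h : IsSmoothSolDelayedHeatString L τ a κ u θ) {t : ℝ} (ht : 0 < t)
    (ht' : -τ ≤ t) :
    HasDerivAt (fc L u) ((1 / L) * (pdX u L t - pdX u 0 t)) t := by
  have hu := sU h
  have hθ := sθ h
  have d4 := hθ.pdX.contx t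
  have d7 := hu.pdX.pdX.contx t
  have key := deriv_int (f := pdT u) (f' := pdT (pdT u)) (fun t => hu.pdT.contx t)
    hu.pdT.pdT.cont (fun x t => hu.pdT.hasT x t) 0 L t
  refine (key.const_mul (1 / L)).congr_deriv ?_
  have F := int_parts (F := fun x => pdX u x t - θ x t) (g := fun _ => 0)
    (f := fun x => pdT (pdT u) x t) hL (by fun_prop)
    (fun x => (hu.pdX.hasX x t).sub (hθ.hasX x t)) (by fun_prop)
    (fun x hx => by rw [pde1 hL h ht x hx]; ring)
  have b2 := h.bc_θ t ht'
  simp only [b2.1, b2.2] at F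
  rw [F]; simp

lemma dR (hL : 0 < L) (h : IsSmoothSolDelayedHeatString L τ a κ u θ) {t : ℝ} (ht : 0 < t) :
    HasDerivAt (fR L u) (fS L u t + ∫ x in (0:ℝ)..L, θ x t * φ1 L x) t := by
  have hu := sU h
  have hθ := sθ h
  have c1 := cont_φ0 L
  have c2 := cont_φ1 L
  have c3 := cont_φ2 L
  have c4 := hu.pdT.pdT.cont
  have d0 := hu.contx t
  have d2 := hu.pdX.contx t
  have d3 := hθ.contx t
  have d4 := hθ.pdX.contx t
  have d7 := hu.pdX.pdX.contx t
  have key := deriv_int (f := fun x t => pdT u x t * φ0 L x)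
    (f' := fun x t => pdT (pdT u) x t * φ0 L x) (fun t => by
      have := hu.pdT.contx t
      fun_prop)
    (by fun_prop) (fun x t => (hu.pdT.hasT x t).mul_const _) 0 L t
  refine key.congr_deriv ?_
  have F := int_parts (F := fun x => (pdX u x t - θ x t) * φ0 L x - u x t * φ1 L x)
    (g := fun x => u x t * φ2 L x + θ x t * φ1 L x)
    (f := fun x => pdT (pdT u) x t * φ0 L x) hL (by fun_prop)
    (fun x => (((hu.pdX.hasX x t).sub (hθ.hasX x t)).mul (hasDeriv_φ0 L x)).sub
      ((hu.hasX x t).mul (hasDeriv_φ1 L x))) (by simp only [Pi.sub_apply]; fun_prop)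
    (fun x hx => by rw [pde1 hL h ht x hx]; simp only [Pi.sub_apply]; ring)
  have b2 := h.bc_u t ht.le
  simp only [b2.1, b2.2] at F
  rw [F, int_add (by fun_prop) (by fun_prop)]
  simp [fS, φ0]

lemma dS (h : IsSmoothSolDelayedHeatString L τ a κ u θ) (t : ℝ) :
    HasDerivAt (fS L u) (∫ x in (0:ℝ)..L, pdT u x t * φ2 L x) t := by
  have hu := sU h
  have c3 := cont_φ2 L
  have c4 := hu.pdT.cont
  exact deriv_int (f := fun x t => u x t * φ2 L x)
    (f' := fun x t => pdT u x t * φ2 L x) (fun t => by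
      have := hu.contx t
      fun_prop)
    (by fun_prop) (fun x t => (hu.hasT x t).mul_const _) 0 L t

lemma hasX_fV (hu : Sm u) (x t : ℝ) :
    HasDerivAt (fun x => fV L u x t) (pdT u x t - fc L u t) x := by
  have c := hu.pdT.contx t
  have := (intervalIntegral.integral_hasDerivAt_right (c.intervalIntegrable 0 x)
    (c.stronglyMeasurableAtFilter _ _) c.continuousAt).sub ((hasDerivAt_id x).mul_const (fc L u t))
  refine this.congr_deriv ?_
  simp

lemma cont_prim {f : ℝ → ℝ → ℝ} (hf : Continuous (fun p : ℝ × ℝ => f p.1 p.2)) :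
    Continuous (fun p : ℝ × ℝ => ∫ y in (0:ℝ)..p.1, f y p.2) := by
  apply intervalIntegral.continuous_parametric_intervalIntegral_of_continuous
    (f := fun (p : ℝ × ℝ) y => f y p.2) (s := fun p => p.1)
  · exact hf.comp (by fun_prop : Continuous fun q : (ℝ × ℝ) × ℝ => (q.2, q.1.2))
  · fun_prop

lemma hasT_fV (hu : Sm u) (x t : ℝ) :
    HasDerivAt (fun t => fV L u x t) ((∫ y in (0:ℝ)..x, pdT (pdT u) y t)
      - x * ((1 / L) * ∫ y in (0:ℝ)..L, pdT (pdT u) y t)) t := by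
  have key := fun x => deriv_int (f := pdT u) (f' := pdT (pdT u)) (fun t => hu.pdT.contx t)
    hu.pdT.pdT.cont (fun x t => hu.pdT.hasT x t) 0 x t
  exact (key x).sub (((key L).const_mul (1 / L)).const_mul x)

lemma dM (hL : 0 < L) (h : IsSmoothSolDelayedHeatString L τ a κ u θ) {t : ℝ} (ht : 0 < t)
    (ht' : -τ ≤ t) :
    HasDerivAt (fM L u θ) (∫ x in (0:ℝ)..L,
      ((κ * pdX θ x (t - τ) + a * pdX θ x t - pdT u x t) * (pdT u x t - fc L u t)
      - θ x t * (pdX u x t - pdX u 0 t - θ x t - x * ((1 / L) * (pdX u L t - pdX u 0 t))))) t := by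
  have hu := sU h
  have hθ := sθ h
  have c3 := hθ.cont
  have c6 := hθ.pdT.cont
  have d1 := hu.pdT.contx t
  have d2 := hu.pdX.contx t
  have d3 := hθ.contx t
  have d4 := hθ.pdX.contx t
  have d5 := hθ.pdX.contx (t - τ)
  have d6 := hu.pdT.pdX.contx t
  have d7 := hu.pdX.pdX.contx t
  have d8 := hθ.pdX.pdX.contx t
  have d9 := hθ.pdX.pdX.contx (t - τ)
  have cV : ∀ t, Continuous (fun x => fV L u x t) := fun t =>
    continuous_iff_continuousAt.2 fun x => (hasX_fV hu x t).continuousAt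
  have cVt := cV t
  have cv1 := cont_prim hu.pdT.cont
  have cv2 := cont_prim hu.pdT.pdT.cont
  have cc1 : Continuous fun p : ℝ × ℝ => ∫ y in (0:ℝ)..L, pdT u y p.2 :=
    cv1.comp (by fun_prop : Continuous fun p : ℝ × ℝ => (L, p.2))
  have cc2 : Continuous fun p : ℝ × ℝ => ∫ y in (0:ℝ)..L, pdT (pdT u) y p.2 :=
    cv2.comp (by fun_prop : Continuous fun p : ℝ × ℝ => (L, p.2))
  have cfV : Continuous fun p : ℝ × ℝ => fV L u p.1 p.2 := by
    unfold fV fc; fun_prop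
  have key := deriv_int (f := fun x t => θ x t * fV L u x t)
    (f' := fun x t => pdT θ x t * fV L u x t + θ x t * ((∫ y in (0:ℝ)..x, pdT (pdT u) y t)
      - x * ((1 / L) * ∫ y in (0:ℝ)..L, pdT (pdT u) y t)))
    (fun t => by
      have := cV t
      have := hθ.contx t
      fun_prop) (by fun_prop)
    (fun x t => (hθ.hasT x t).mul (hasT_fV hu x t)) 0 L t
  refine key.neg.congr_deriv ?_
  have b2 := h.bc_θ t ht'
  have prim : ∀ x ∈ Set.Icc (0:ℝ) L, ∫ y in (0:ℝ)..x, pdT (pdT u) y t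
      = pdX u x t - pdX u 0 t - θ x t := by
    intro x hx
    have e1 : ∫ y in (0:ℝ)..x, pdT (pdT u) y t
        = ∫ y in (0:ℝ)..x, (pdX (pdX u) y t - pdX θ y t) := by
      apply intervalIntegral.integral_congr
      intro y hy
      rw [Set.uIcc_of_le hx.1] at hy
      exact pde1 hL h ht y ⟨hy.1, hy.2.trans hx.2⟩
    rw [e1, ftc (F := fun x => pdX u x t - θ x t)
      (fun x => (hu.pdX.hasX x t).sub (hθ.hasX x t)) (by fun_prop), b2.1]
    ring
  have V0 : fV L u 0 t = 0 := by simp [fV]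
  have V1 : fV L u L t = 0 := by
    simp only [fV, fc]; field_simp; ring
  have F := int_parts
    (F := fun x => (κ * pdX θ x (t - τ) + a * pdX θ x t - pdT u x t) * fV L u x t)
    (g := fun x => -((κ * pdX θ x (t - τ) + a * pdX θ x t - pdT u x t) * (pdT u x t - fc L u t)
      - θ x t * (pdX u x t - pdX u 0 t - θ x t - x * ((1 / L) * (pdX u L t - pdX u 0 t)))))
    (f := fun x => pdT θ x t * fV L u x t + θ x t * ((∫ y in (0:ℝ)..x, pdT (pdT u) y t)
      - x * ((1 / L) * ∫ y in (0:ℝ)..L, pdT (pdT u) y t))) hL (by fun_prop)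
    (fun x => ((((hθ.pdX.hasX x (t - τ)).const_mul κ).add
      ((hθ.pdX.hasX x t).const_mul a)).sub (hu.pdT.hasX x t)).mul (hasX_fV hu x t))
    (by simp only [Pi.sub_apply, Pi.add_apply]; fun_prop)
    (fun x hx => by
      rw [prim x hx, prim L ⟨hL.le, le_rfl⟩, pde2 hL h ht x hx, b2.2]
      simp only [Pi.add_apply, Pi.sub_apply]
      ring)
  rw [V0, V1, intervalIntegral.integral_neg] at F
  rw [F]
  ring

lemma fG_cont (hθ : Sm θ) : Continuous (fG L θ) := by
  have c := hθ.pdX.cont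
  have := cont_prim (f := fun x t => (pdX θ x t) ^ 2) (by fun_prop)
  exact this.comp (by fun_prop : Continuous fun t : ℝ => (L, t))

lemma dG (hθ : Sm θ) (t : ℝ) :
    HasDerivAt (fG L θ) (∫ x in (0:ℝ)..L, 2 * pdX θ x t * pdT (pdX θ) x t) t := by
  have c := hθ.pdX.cont
  have c' := hθ.pdX.pdT.cont
  exact deriv_int (f := fun x t => (pdX θ x t) ^ 2)
    (f' := fun x t => 2 * pdX θ x t * pdT (pdX θ) x t)
    (fun t => by
      have := hθ.pdX.contx t
      fun_prop) (by fun_prop)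
    (fun x t => by
      refine ((hθ.pdX.hasT x t).pow 2).congr_deriv ?_
      simp) 0 L t

lemma dHist (hτ : 0 < τ) (hθ : Sm θ) (α β t : ℝ) :
    HasDerivAt (fun t => ∫ ρ in (0 : ℝ)..1, (α - β * ρ) * fG L θ (t - τ * ρ))
      ((α * fG L θ t - (α - β) * fG L θ (t - τ) - β * fD L τ θ t) / τ) t := by
  have cG := fG_cont (L := L) hθ
  set G1 : ℝ → ℝ := fun t => ∫ x in (0:ℝ)..L, 2 * pdX θ x t * pdT (pdX θ) x t with hG1
  have cG1 : Continuous G1 := by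
    have c := hθ.pdX.cont
    have c' := hθ.pdX.pdT.cont
    have := cont_prim (f := fun x t => 2 * pdX θ x t * pdT (pdX θ) x t) (by fun_prop)
    exact this.comp (by fun_prop : Continuous fun t : ℝ => (L, t))
  have key := deriv_int (f := fun ρ t => (α - β * ρ) * fG L θ (t - τ * ρ))
    (f' := fun ρ t => (α - β * ρ) * G1 (t - τ * ρ)) (fun t => by fun_prop) (by fun_prop)
    (fun ρ t => by
      have := ((dG (L := L) hθ (t - τ * ρ)).comp t
        ((hasDerivAt_id t).sub_const (τ * ρ))).const_mul (α - β * ρ)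
      refine this.congr_deriv ?_
      simp [hG1]) 0 1 t
  refine key.congr_deriv ?_
  have F := int_parts (F := fun ρ => (-1 / τ) * ((α - β * ρ) * fG L θ (t - τ * ρ)))
    (g := fun ρ => (-β / τ) * fG L θ (t - τ * ρ))
    (f := fun ρ => (α - β * ρ) * G1 (t - τ * ρ)) one_pos (by fun_prop)
    (fun ρ => (((((hasDerivAt_id ρ).const_mul β).const_sub α).mul
      ((dG (L := L) hθ (t - τ * ρ)).comp ρ
        (((hasDerivAt_id ρ).const_mul τ).const_sub t))).const_mul (-1 / τ)))
    (by
      change Continuous fun ρ => (-1 / τ) * (-(β * 1) * fG L θ (t - τ * ρ)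
        + (α - β * ρ) * (G1 (t - τ * ρ) * -(τ * 1)))
      fun_prop)
    (fun x hx => by
      change _ = _ + (-1 / τ) * (-(β * 1) * fG L θ (t - τ * x)
        + (α - β * x) * (G1 (t - τ * x) * -(τ * 1)))
      field_simp
      ring)
  rw [F, intervalIntegral.integral_const_mul]
  simp only [fD]
  field_simp
  simp
  ring

lemma dD (hτ : 0 < τ) (hθ : Sm θ) (t : ℝ) :
    HasDerivAt (fD L τ θ) ((fG L θ t - fG L θ (t - τ)) / τ) t := by
  have := dHist (L := L) hτ hθ 1 0 t
  simp only [zero_mul, sub_zero, one_mul] at this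
  exact this

lemma dZ (hτ : 0 < τ) (hθ : Sm θ) (t : ℝ) :
    HasDerivAt (fZ L τ θ) ((2 * fG L θ t - fG L θ (t - τ) - fD L τ θ t) / τ) t := by
  have := dHist (L := L) hτ hθ 2 1 t
  norm_num at this
  exact this

lemma energy_eq (hθ : Sm θ) (ξ t : ℝ) :
    energyDHString L τ ξ u θ t = (1 / 2) * (fE L u θ t + ξ * fD L τ θ t) := by
  unfold energyDHString fE fD fG
  rw [MeasureTheory.intervalIntegral_intervalIntegral_swap]
  have c := hθ.pdX.cont
  have c2 : Continuous (fun p : ℝ × ℝ => pdX θ p.1 (t - τ * p.2) ^ 2) :=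
    (c.comp (by fun_prop : Continuous fun p : ℝ × ℝ => (p.1, t - τ * p.2))).pow 2
  exact (c2.continuousOn.integrableOn_compact (isCompact_uIcc.prod isCompact_uIcc)).mono_set
    (Set.prod_mono Set.uIoc_subset_uIcc Set.uIoc_subset_uIcc)

end

noncomputable def qA (L : ℝ) (u : ℝ → ℝ → ℝ) (t : ℝ) : ℝ := ∫ x in (0 : ℝ)..L, (pdT u x t) ^ 2
noncomputable def qB (L : ℝ) (u : ℝ → ℝ → ℝ) (t : ℝ) : ℝ := ∫ x in (0 : ℝ)..L, (pdX u x t) ^ 2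
noncomputable def qP (L : ℝ) (θ : ℝ → ℝ → ℝ) (t : ℝ) : ℝ := ∫ x in (0 : ℝ)..L, (θ x t) ^ 2
noncomputable def qV (L : ℝ) (u : ℝ → ℝ → ℝ) (t : ℝ) : ℝ :=
  ∫ x in (0 : ℝ)..L, (pdT u x t - fc L u t) ^ 2
noncomputable def qb (L : ℝ) (u : ℝ → ℝ → ℝ) (t : ℝ) : ℝ := (pdX u 0 t) ^ 2 + (pdX u L t) ^ 2

section
variable {L τ a κ : ℝ} {u θ : ℝ → ℝ → ℝ}

lemma qA_nonneg (hL : 0 < L) (t : ℝ) : 0 ≤ qA L u t := int_nonneg hL fun x _ => sq_nonneg _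
lemma qB_nonneg (hL : 0 < L) (t : ℝ) : 0 ≤ qB L u t := int_nonneg hL fun x _ => sq_nonneg _
lemma qP_nonneg (hL : 0 < L) (t : ℝ) : 0 ≤ qP L θ t := int_nonneg hL fun x _ => sq_nonneg _
lemma qV_nonneg (hL : 0 < L) (t : ℝ) : 0 ≤ qV L u t := int_nonneg hL fun x _ => sq_nonneg _
lemma qb_nonneg (t : ℝ) : 0 ≤ qb L u t := by unfold qb; positivity
lemma fG_nonneg (hL : 0 < L) (t : ℝ) : 0 ≤ fG L θ t := int_nonneg hL fun x _ => sq_nonneg _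
lemma fD_nonneg (hL : 0 < L) (t : ℝ) : 0 ≤ fD L τ θ t :=
  int_nonneg one_pos fun x _ => fG_nonneg hL _

lemma fE_eq (hu : Sm u) (hθ : Sm θ) (t : ℝ) : fE L u θ t = qA L u t + qB L u t + qP L θ t := by
  have d1 := hu.pdT.contx t
  have d2 := hu.pdX.contx t
  have d3 := hθ.contx t
  unfold fE qA qB qP
  rw [int_add (by fun_prop) (by fun_prop), int_add (by fun_prop) (by fun_prop)]

lemma int_dev (hL : 0 < L) (hu : Sm u) (t : ℝ) :
    ∫ x in (0 : ℝ)..L, (pdT u x t - fc L u t) = 0 := by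
  have d1 := hu.pdT.contx t
  rw [int_sub (by fun_prop) (by fun_prop), intervalIntegral.integral_const, smul_eq_mul]
  unfold fc; field_simp; ring

lemma qA_eq (hL : 0 < L) (hu : Sm u) (t : ℝ) : qA L u t = qV L u t + L * (fc L u t) ^ 2 := by
  have d1 := hu.pdT.contx t
  have h0 := int_dev hL hu t
  have : qA L u t = ∫ x in (0 : ℝ)..L, ((pdT u x t - fc L u t) ^ 2
      + (2 * fc L u t * (pdT u x t - fc L u t) + (fc L u t) ^ 2)) := by
    unfold qA; congr 1; funext x; ring
  rw [this, int_add (by fun_prop) (by fun_prop), int_add (by fun_prop) (by fun_prop),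
    intervalIntegral.integral_const_mul, h0, intervalIntegral.integral_const, smul_eq_mul]
  unfold qV; ring

lemma qP_le (hL : 0 < L) (h : IsSmoothSolDelayedHeatString L τ a κ u θ) {t : ℝ} (ht : -τ ≤ t) :
    qP L θ t ≤ L ^ 2 * fG L θ t :=
  poincare hL (fun x => (sθ h).hasX x t) ((sθ h).pdX.contx t) (h.bc_θ t ht).1

lemma u_le (hL : 0 < L) (h : IsSmoothSolDelayedHeatString L τ a κ u θ) {t : ℝ} (ht : 0 ≤ t) :
    ∫ x in (0 : ℝ)..L, (u x t) ^ 2 ≤ L ^ 2 * qB L u t :=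
  poincare hL (fun x => (sU h).hasX x t) ((sU h).pdX.contx t) (h.bc_u t ht).1

lemma estE (hL : 0 < L) (hθ : Sm θ) {ξ c0 t : ℝ}
    (hq : ∀ g k : ℝ, c0 * (g ^ 2 + k ^ 2) ≤
      (a - ξ / (2 * τ)) * g ^ 2 + κ * (g * k) + ξ / (2 * τ) * k ^ 2) :
    (1 / 2) * ((-2 * ∫ x in (0:ℝ)..L, pdX θ x t * (κ * pdX θ x (t - τ) + a * pdX θ x t))
      + ξ * ((fG L θ t - fG L θ (t - τ)) / τ)) ≤ -(c0 * (fG L θ t + fG L θ (t - τ))) := by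
  have d4 := hθ.pdX.contx t
  have d5 := hθ.pdX.contx (t - τ)
  have h1 := int_mono hL (f := fun x => c0 * ((pdX θ x t) ^ 2 + (pdX θ x (t - τ)) ^ 2))
    (g := fun x => pdX θ x t * (κ * pdX θ x (t - τ) + a * pdX θ x t)
      + (-(ξ / (2 * τ)) * (pdX θ x t) ^ 2 + (ξ / (2 * τ)) * (pdX θ x (t - τ)) ^ 2))
    (by fun_prop) (by fun_prop)
    (fun x _ => by
      have := hq (pdX θ x t) (pdX θ x (t - τ))
      linarith)
  rw [intervalIntegral.integral_const_mul, int_add (by fun_prop) (by fun_prop),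
    int_add (by fun_prop) (by fun_prop), int_add (by fun_prop) (by fun_prop),
    intervalIntegral.integral_const_mul, intervalIntegral.integral_const_mul] at h1
  change c0 * (fG L θ t + fG L θ (t - τ)) ≤ _ + (-(ξ / (2 * τ)) * fG L θ t
    + ξ / (2 * τ) * fG L θ (t - τ)) at h1
  have e : ξ * ((fG L θ t - fG L θ (t - τ)) / τ) = 2 * ((ξ / (2 * τ)) * fG L θ t
    - ξ / (2 * τ) * fG L θ (t - τ)) := by ring
  rw [e]; linarith

lemma estU (hL : 0 < L) (hu : Sm u) (hθ : Sm θ) (t : ℝ) :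
    ∫ x in (0:ℝ)..L, ((pdT u x t) ^ 2 - (pdX u x t) ^ 2 + pdX u x t * θ x t)
      ≤ qA L u t - qB L u t / 2 + qP L θ t / 2 := by
  have d1 := hu.pdT.contx t
  have d2 := hu.pdX.contx t
  have d3 := hθ.contx t
  have h1 := int_mono hL (f := fun x => (pdT u x t) ^ 2 - (pdX u x t) ^ 2 + pdX u x t * θ x t)
    (g := fun x => (pdT u x t) ^ 2 + ((-1 / 2) * (pdX u x t) ^ 2 + (1 / 2) * (θ x t) ^ 2))
    (by fun_prop) (by fun_prop)
    (fun x _ => by nlinarith [sq_nonneg (pdX u x t - θ x t)])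
  rw [int_add (f := fun x => (pdT u x t) ^ 2) (by fun_prop) (by fun_prop),
    int_add (f := fun x => (-1 / 2) * (pdX u x t) ^ 2) (by fun_prop) (by fun_prop),
    intervalIntegral.integral_const_mul, intervalIntegral.integral_const_mul] at h1
  unfold qA qB qP
  linarith

lemma estQ (hL : 0 < L) (hu : Sm u) (hθ : Sm θ) (t : ℝ) :
    (∫ x in (0:ℝ)..L, ((1 / 2) * ((pdT u x t) ^ 2 + (pdX u x t) ^ 2)
      - (L / 2 - x) * (pdX θ x t * pdX u x t)))
      - L / 4 * ((pdX u 0 t) ^ 2 + (pdX u L t) ^ 2)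
      ≤ qA L u t / 2 + qB L u t - L / 4 * qb L u t + L ^ 2 / 8 * fG L θ t := by
  have d1 := hu.pdT.contx t
  have d2 := hu.pdX.contx t
  have d4 := hθ.pdX.contx t
  have h1 := int_mono hL (f := fun x => (1 / 2) * ((pdT u x t) ^ 2 + (pdX u x t) ^ 2)
      - (L / 2 - x) * (pdX θ x t * pdX u x t))
    (g := fun x => (1 / 2) * (pdT u x t) ^ 2 + ((pdX u x t) ^ 2 + (L ^ 2 / 8) * (pdX θ x t) ^ 2))
    (by fun_prop) (by fun_prop)
    (fun x hx => by
      have h2 : (L / 2 - x) ^ 2 ≤ L ^ 2 / 4 := by nlinarith [hx.1, hx.2]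
      have h3 := mul_le_mul_of_nonneg_right h2 (sq_nonneg (pdX θ x t))
      nlinarith [sq_nonneg (pdX u x t + (L / 2 - x) * pdX θ x t)])
  rw [int_add (f := fun x => (1 / 2) * (pdT u x t) ^ 2) (by fun_prop) (by fun_prop),
    int_add (f := fun x => (pdX u x t) ^ 2) (by fun_prop) (by fun_prop),
    intervalIntegral.integral_const_mul, intervalIntegral.integral_const_mul] at h1
  unfold qA qB qb fG
  linarith

lemma estM (hL : 0 < L) (hu : Sm u) (hθ : Sm θ) (t : ℝ) {δ : ℝ} (hδ : 0 < δ) :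
    ∫ x in (0:ℝ)..L,
      ((κ * pdX θ x (t - τ) + a * pdX θ x t - pdT u x t) * (pdT u x t - fc L u t)
      - θ x t * (pdX u x t - pdX u 0 t - θ x t - x * ((1 / L) * (pdX u L t - pdX u 0 t))))
      ≤ -(qV L u t / 2) + κ ^ 2 * fG L θ (t - τ) + a ^ 2 * fG L θ t
        + 3 * δ * (qB L u t + qP L θ t + L * qb L u t) + 1 / (4 * δ) * qP L θ t := by
  have d1 := hu.pdT.contx t
  have d2 := hu.pdX.contx t
  have d3 := hθ.contx t
  have d4 := hθ.pdX.contx t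
  have d5 := hθ.pdX.contx (t - τ)
  set c := fc L u t with hc
  set b := qb L u t with hb
  have h1 := int_mono hL (f := fun x =>
      (κ * pdX θ x (t - τ) + a * pdX θ x t - pdT u x t) * (pdT u x t - c)
      - θ x t * (pdX u x t - pdX u 0 t - θ x t - x * ((1 / L) * (pdX u L t - pdX u 0 t))))
    (g := fun x => (-1 / 2) * (pdT u x t - c) ^ 2 + ((-c) * (pdT u x t - c)
      + (κ ^ 2 * (pdX θ x (t - τ)) ^ 2 + (a ^ 2 * (pdX θ x t) ^ 2 + ((3 * δ) * (pdX u x t) ^ 2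
        + ((3 * δ + 1 / (4 * δ)) * (θ x t) ^ 2 + 3 * δ * b))))))
    (by fun_prop) (by fun_prop)
    (fun x hx => by
      have hy0 : 0 ≤ x / L := div_nonneg hx.1 hL.le
      have hy1 : x / L ≤ 1 := (div_le_one hL).2 hx.2
      have e1 : x * ((1 / L) * (pdX u L t - pdX u 0 t))
        = x / L * (pdX u L t - pdX u 0 t) := by ring
      rw [e1]
      set y := x / L
      set p := pdX u 0 t
      set q := pdX u L t
      set e := pdX u x t
      set v := pdT u x t - c with hv
      set w := θ x t
      set m := (1 - y) * p + y * q with hm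
      have hm2 : m ^ 2 ≤ b := by
        have : m ^ 2 ≤ (1 - y) * p ^ 2 + y * q ^ 2 := by
          have : (1 - y) * p ^ 2 + y * q ^ 2 - m ^ 2 = (y * (1 - y)) * (p - q) ^ 2 := by
            rw [hm]; ring
          have : 0 ≤ (y * (1 - y)) * (p - q) ^ 2 :=
            mul_nonneg (mul_nonneg hy0 (by linarith)) (sq_nonneg _)
          linarith
        have h3 : (1 - y) * p ^ 2 ≤ p ^ 2 := by nlinarith [sq_nonneg p]
        have h4 : y * q ^ 2 ≤ q ^ 2 := by nlinarith [sq_nonneg q]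
        have : b = p ^ 2 + q ^ 2 := rfl
        linarith
      have e2 : e - p - w - y * (q - p) = e - w - m := by rw [hm]; ring
      rw [e2]
      have e3 : pdT u x t = v + c := by rw [hv]; ring
      rw [e3]
      set g := pdX θ x t
      set k := pdX θ x (t - τ)
      have i1 : (e - w - m) ^ 2 ≤ 3 * (e ^ 2 + w ^ 2 + b) := by
        nlinarith [sq_nonneg (e + w), sq_nonneg (e + m), sq_nonneg (w - m)]
      have i2 : -(w * (e - w - m)) ≤ δ * (e - w - m) ^ 2 + 1 / (4 * δ) * w ^ 2 := by
        have : δ * (e - w - m) ^ 2 + 1 / (4 * δ) * w ^ 2 + w * (e - w - m)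
          = δ * ((e - w - m) + w / (2 * δ)) ^ 2 := by field_simp; ring
        have : 0 ≤ δ * ((e - w - m) + w / (2 * δ)) ^ 2 := by positivity
        linarith
      have i3 := mul_le_mul_of_nonneg_left i1 hδ.le
      have i4 : (κ * k + a * g) * v ≤ v ^ 2 / 2 + κ ^ 2 * k ^ 2 + a ^ 2 * g ^ 2 := by
        nlinarith [sq_nonneg (κ * k + a * g - v), sq_nonneg (κ * k - a * g)]
      nlinarith)
  rw [int_add (f := fun x => (-1 / 2) * (pdT u x t - c) ^ 2) (by fun_prop) (by fun_prop),
    int_add (f := fun x => (-c) * (pdT u x t - c)) (by fun_prop) (by fun_prop),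
    int_add (f := fun x => κ ^ 2 * (pdX θ x (t - τ)) ^ 2) (by fun_prop) (by fun_prop),
    int_add (f := fun x => a ^ 2 * (pdX θ x t) ^ 2) (by fun_prop) (by fun_prop),
    int_add (f := fun x => (3 * δ) * (pdX u x t) ^ 2) (by fun_prop) (by fun_prop),
    int_add (f := fun x => (3 * δ + 1 / (4 * δ)) * (θ x t) ^ 2) (by fun_prop) (by fun_prop),
    intervalIntegral.integral_const_mul, intervalIntegral.integral_const_mul,
    intervalIntegral.integral_const_mul, intervalIntegral.integral_const_mul,
    intervalIntegral.integral_const_mul, intervalIntegral.integral_const_mul,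
    intervalIntegral.integral_const, int_dev hL hu t, smul_eq_mul] at h1
  change _ ≤ (-1 / 2) * qV L u t + (_ + (κ ^ 2 * fG L θ (t - τ) + (a ^ 2 * fG L θ t
    + ((3 * δ) * qB L u t + ((3 * δ + 1 / (4 * δ)) * qP L θ t + _))))) at h1
  refine h1.trans (le_of_eq ?_)
  ring

/-- squares of test integrals -/
lemma estR (hL : 0 < L) (hu : Sm u) (t : ℝ) :
    (fR L u t) ^ 2 ≤ (∫ x in (0:ℝ)..L, φ0 L x ^ 2) * qV L u t := by
  have d1 := hu.pdT.contx t
  have c1 := cont_φ0 L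
  have h1 := cs hL (f := φ0 L) (g := fun x => pdT u x t - fc L u t) (by fun_prop) (by fun_prop)
  have e : fR L u t = ∫ x in (0:ℝ)..L, φ0 L x * (pdT u x t - fc L u t) := by
    have : ∫ x in (0:ℝ)..L, φ0 L x * (pdT u x t - fc L u t)
        = ∫ x in (0:ℝ)..L, (pdT u x t * φ0 L x - fc L u t * φ0 L x) := by
      congr 1; funext x; ring
    rw [this, int_sub (by fun_prop) (by fun_prop), intervalIntegral.integral_const_mul, int_φ0]
    simp [fR]
  rw [e]; exact h1

lemma estr2 (hL : 0 < L) (hu : Sm u) (t : ℝ) :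
    ∃ r, (∫ x in (0:ℝ)..L, pdT u x t * φ2 L x) = r + fc L u t * (2 * L ^ 3 / 5) ∧
      r ^ 2 ≤ (∫ x in (0:ℝ)..L, φ2 L x ^ 2) * qV L u t := by
  have d1 := hu.pdT.contx t
  have c1 := cont_φ2 L
  have h1 := cs hL (f := φ2 L) (g := fun x => pdT u x t - fc L u t) (by fun_prop) (by fun_prop)
  refine ⟨_, ?_, h1⟩
  have : ∫ x in (0:ℝ)..L, φ2 L x * (pdT u x t - fc L u t)
      = ∫ x in (0:ℝ)..L, (pdT u x t * φ2 L x - fc L u t * φ2 L x) := by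
    congr 1; funext x; ring
  rw [this, int_sub (by fun_prop) (by fun_prop), intervalIntegral.integral_const_mul, int_φ2]
  ring

lemma estj (hL : 0 < L) (hθ : Sm θ) (t : ℝ) :
    (∫ x in (0:ℝ)..L, θ x t * φ1 L x) ^ 2 ≤ (∫ x in (0:ℝ)..L, φ1 L x ^ 2) * qP L θ t := by
  have h1 := cs hL (hθ.contx t) (cont_φ1 L)
  rw [mul_comm (∫ x in (0:ℝ)..L, φ1 L x ^ 2)]
  exact h1

lemma estS (hL : 0 < L) (h : IsSmoothSolDelayedHeatString L τ a κ u θ) {t : ℝ} (ht : 0 ≤ t) :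
    (fS L u t) ^ 2 ≤ (∫ x in (0:ℝ)..L, φ2 L x ^ 2) * (L ^ 2 * qB L u t) := by
  have h1 := cs hL ((sU h).contx t) (cont_φ2 L)
  have h2 := u_le hL h ht
  have h3 : 0 ≤ ∫ x in (0:ℝ)..L, φ2 L x ^ 2 := int_nonneg hL fun x _ => sq_nonneg _
  calc _ ≤ _ := h1
    _ ≤ _ := by rw [mul_comm]; exact mul_le_mul_of_nonneg_left h2 h3

lemma bdU (hL : 0 < L) (h : IsSmoothSolDelayedHeatString L τ a κ u θ) {t : ℝ} (ht : 0 ≤ t) :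
    (fU L u t) ^ 2 ≤ (L ^ 2 * qB L u t) * qA L u t := by
  have h1 := cs hL ((sU h).contx t) ((sU h).pdT.contx t)
  exact h1.trans (mul_le_mul_of_nonneg_right (u_le hL h ht) (qA_nonneg hL t))

lemma bdQ (hL : 0 < L) (hu : Sm u) (t : ℝ) :
    (fQ L u t) ^ 2 ≤ (L ^ 2 * qA L u t) * qB L u t := by
  have d1 := hu.pdT.contx t
  have d2 := hu.pdX.contx t
  have h1 := cs hL (f := fun x => (L / 2 - x) * pdT u x t) (g := fun x => pdX u x t)
    (by fun_prop) (by fun_prop)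
  have e : fQ L u t = ∫ x in (0:ℝ)..L, (L / 2 - x) * pdT u x t * pdX u x t := by
    unfold fQ; congr 1; funext x; ring
  rw [e]
  refine h1.trans (mul_le_mul_of_nonneg_right ?_ (qB_nonneg hL t))
  unfold qA
  rw [← intervalIntegral.integral_const_mul]
  apply int_mono hL (by fun_prop) (by fun_prop)
  intro x hx
  have h2 : (L / 2 - x) ^ 2 ≤ L ^ 2 := by nlinarith [hx.1, hx.2]
  have h3 := mul_le_mul_of_nonneg_right h2 (sq_nonneg (pdT u x t))
  calc _ = (L / 2 - x) ^ 2 * pdT u x t ^ 2 := by ring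
    _ ≤ _ := h3

lemma bdM (hL : 0 < L) (hu : Sm u) (hθ : Sm θ) (t : ℝ) :
    (fM L u θ t) ^ 2 ≤ qP L θ t * (L ^ 2 * qV L u t) := by
  have d1 := hu.pdT.contx t
  have cV : Continuous (fun x => fV L u x t) :=
    continuous_iff_continuousAt.2 fun x => (hasX_fV hu x t).continuousAt
  have h1 := cs hL (hθ.contx t) cV
  have h2 := poincare hL (fun x => hasX_fV (L := L) hu x t) (by fun_prop) (by simp [fV])
  unfold fM
  rw [neg_sq]
  exact h1.trans (mul_le_mul_of_nonneg_left h2 (qP_nonneg hL t))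

lemma bdZ (hL : 0 < L) (hθ : Sm θ) (t : ℝ) :
    0 ≤ fZ L τ θ t ∧ fZ L τ θ t ≤ 2 * fD L τ θ t := by
  have cG := fG_cont (L := L) hθ
  constructor
  · exact int_nonneg one_pos fun ρ hρ => mul_nonneg (by linarith [hρ.2]) (fG_nonneg hL _)
  · unfold fZ fD
    rw [← intervalIntegral.integral_const_mul]
    apply int_mono one_pos (by fun_prop) (by fun_prop)
    intro ρ hρ
    exact mul_le_mul_of_nonneg_right (by linarith [hρ.1]) (fG_nonneg hL _)

lemma cont_int {f : ℝ → ℝ → ℝ} (hf : Continuous (fun p : ℝ × ℝ => f p.1 p.2)) :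
    Continuous (fun t => ∫ y in (0:ℝ)..L, f y t) :=
  (cont_prim hf).comp (by fun_prop : Continuous fun t : ℝ => (L, t))

lemma cont_fE (hu : Sm u) (hθ : Sm θ) : Continuous (fE L u θ) := by
  have c1 := hu.pdT.cont
  have c2 := hu.pdX.cont
  have c3 := hθ.cont
  exact cont_int (f := fun x t => (pdT u x t) ^ 2 + (pdX u x t) ^ 2 + (θ x t) ^ 2) (by fun_prop)

lemma cont_fU (hu : Sm u) : Continuous (fU L u) := by
  have c1 := hu.pdT.cont
  have c2 := hu.cont
  exact cont_int (f := fun x t => u x t * pdT u x t) (by fun_prop)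

lemma cont_fQ (hu : Sm u) : Continuous (fQ L u) := by
  have c1 := hu.pdT.cont
  have c2 := hu.pdX.cont
  exact cont_int (f := fun x t => (L / 2 - x) * (pdT u x t * pdX u x t)) (by fun_prop)

lemma cont_fc (hu : Sm u) : Continuous (fc L u) := by
  have c1 := hu.pdT.cont
  exact continuous_const.mul (cont_int (f := pdT u) (by fun_prop))

lemma cont_fR (hu : Sm u) : Continuous (fR L u) := by
  have c1 := hu.pdT.cont
  have c2 := cont_φ0 L
  exact cont_int (f := fun x t => pdT u x t * φ0 L x) (by fun_prop)

lemma cont_fS (hu : Sm u) : Continuous (fS L u) := by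
  have c1 := hu.cont
  have c2 := cont_φ2 L
  exact cont_int (f := fun x t => u x t * φ2 L x) (by fun_prop)

lemma cont_fM (hu : Sm u) (hθ : Sm θ) : Continuous (fM L u θ) := by
  have c3 := hθ.cont
  have cv1 := cont_prim hu.pdT.cont
  have cc := cont_fc (L := L) hu
  have cfV : Continuous fun p : ℝ × ℝ => fV L u p.1 p.2 := by
    unfold fV; fun_prop
  exact (cont_int (f := fun x t => θ x t * fV L u x t) (by fun_prop)).neg

end

lemma alg {L k τ c0 CU CQ m CZ CV CG : ℝ} (hL : 0 < L) (hk : 0 < k) (hτ : 0 < τ) (hc0 : 0 < c0)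
    (hCU : 0 ≤ CU) (hCQ : 0 ≤ CQ) (hm : 0 < m) (hCZ : 0 ≤ CZ) (hCV : 0 ≤ CV) (hCG : 0 ≤ CG)
    (CW CT CM : ℝ → ℝ) (hCW : ∀ δ > 0, 0 ≤ CW δ) (hCT : ∀ δ > 0, 0 ≤ CT δ)
    (hCM : ∀ δ > 0, 0 ≤ CM δ) :
    ∃ l1 > (0:ℝ), ∃ l2 > (0:ℝ), ∃ l3 > (0:ℝ), ∃ N0 > (0:ℝ), ∃ η > (0:ℝ), ∀ N ≥ N0,
      ∀ A B G H D b c2 S2 V dE dZ dU dQ dW dT dM : ℝ,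
      0 ≤ B → 0 ≤ G → 0 ≤ H → 0 ≤ D → 0 ≤ b → 0 ≤ c2 → 0 ≤ S2 → 0 ≤ V → A = V + L * c2 →
      dU ≤ A - B / 2 + CU * G →
      dQ ≤ A / 2 + B - L / 4 * b + CQ * G →
      (∀ δ > 0, dW ≤ -(k / 2 * c2) + CV * V + δ * b + CW δ * S2) →
      (∀ δ > 0, dT ≤ -(S2 / 2) + δ * c2 + CT δ * V + CG * G) →
      (∀ δ > 0, dM ≤ -(V / 2) + δ * m * (B + b) + CM δ * (G + H)) →
      dZ ≤ CZ * G - D / τ →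
      dE ≤ -(c0 * (G + H)) →
      N * dE + dZ + dU + dQ / 8 + l1 * dW + l2 * dT + l3 * dM ≤ -(η * (A + B + G + D)) := by
  set l1 := 4 * L / k with hl1
  have pl1 : 0 < l1 := by positivity
  set δ1 := L / (64 * l1) with hδ1
  have pδ1 : 0 < δ1 := by positivity
  have w1 := hCW δ1 pδ1
  set l2 := 2 * (l1 * CW δ1) + 1 with hl2
  have pl2 : 0 < l2 := by positivity
  set δ2 := L / (4 * l2) with hδ2
  have pδ2 : 0 < δ2 := by positivity
  have w2 := hCT δ2 pδ2
  set l3 := 2 * (17 / 16 + l1 * CV + l2 * CT δ2) + 2 with hl3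
  have pl3 : 0 < l3 := by positivity
  set d := min (1 / 8) (L / 64) with hd
  have pd : 0 < d := by positivity
  have d1 : d ≤ 1 / 8 := min_le_left _ _
  have d2 : d ≤ L / 64 := min_le_right _ _
  set δ3 := d / (l3 * m) with hδ3
  have pδ3 : 0 < δ3 := by positivity
  have w3 := hCM δ3 pδ3
  set N0 := (CU + CQ / 8 + l2 * CG + l3 * CM δ3 + CZ + 1) / c0 with hN0
  have pN0 : 0 < N0 := by positivity
  have eN0 : N0 * c0 = CU + CQ / 8 + l2 * CG + l3 * CM δ3 + CZ + 1 := by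
    rw [hN0]; field_simp
  set η := min (1 / 4) (1 / τ) with hη
  have pη : 0 < η := by positivity
  have η1 : η ≤ 1 / 4 := min_le_left _ _
  have η2 : η ≤ 1 / τ := min_le_right _ _
  refine ⟨l1, pl1, l2, pl2, l3, pl3, N0, pN0, η, pη, ?_⟩
  intro N hN A B G H D b c2 S2 V dE dZ dU dQ dW dT dM hB hG hH hD hb hc2 hS2 hV hA hU hQ hW hT hM
    hZ hE
  have W := mul_le_mul_of_nonneg_left (hW δ1 pδ1) pl1.le
  have T := mul_le_mul_of_nonneg_left (hT δ2 pδ2) pl2.le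
  have M := mul_le_mul_of_nonneg_left (hM δ3 pδ3) pl3.le
  have eW : l1 * (-(k / 2 * c2) + CV * V + δ1 * b + CW δ1 * S2)
      = -(2 * (L * c2)) + (l1 * CV) * V + L / 64 * b + (l1 * CW δ1) * S2 := by
    have e1 : l1 * k = 4 * L := by rw [hl1]; field_simp
    have e2 : l1 * δ1 = L / 64 := by rw [hδ1]; field_simp
    linear_combination (-(c2 / 2)) * e1 + b * e2
  have eT : l2 * (-(S2 / 2) + δ2 * c2 + CT δ2 * V + CG * G)
      = -((l1 * CW δ1) * S2) - S2 / 2 + (L * c2) / 4 + (l2 * CT δ2) * V + (l2 * CG) * G := by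
    have e2 : l2 * δ2 = L / 4 := by rw [hδ2]; field_simp
    linear_combination c2 * e2 - (S2 / 2) * hl2
  have eM : l3 * (-(V / 2) + δ3 * m * (B + b) + CM δ3 * (G + H))
      = -(17 / 16 * V + (l1 * CV) * V + (l2 * CT δ2) * V) - V + d * B + d * b
        + (l3 * CM δ3) * (G + H) := by
    have e2 : l3 * δ3 * m = d := by rw [hδ3]; field_simp
    linear_combination (B + b) * e2 - (V / 2) * hl3
  have hNE : N * dE ≤ -((N0 * c0) * (G + H)) := by
    have h1 := mul_le_mul_of_nonneg_left hE (pN0.le.trans hN)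
    have h2 : N0 * (c0 * (G + H)) ≤ N * (c0 * (G + H)) :=
      mul_le_mul_of_nonneg_right hN (by positivity)
    linarith
  have eGH : (N0 * c0) * (G + H) = CU * G + CQ / 8 * G + (l2 * CG) * G + (l3 * CM δ3) * (G + H)
      + CZ * G + G + (CU + CQ / 8 + l2 * CG + CZ + 1) * H := by rw [eN0]; ring
  have nH : 0 ≤ (CU + CQ / 8 + l2 * CG + CZ + 1) * H := by positivity
  have hdB : d * B ≤ 1 / 8 * B := mul_le_mul_of_nonneg_right d1 hB
  have hdb : d * b ≤ L / 64 * b := mul_le_mul_of_nonneg_right d2 hb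
  have nLc : 0 ≤ L * c2 := by positivity
  have hA0 : 0 ≤ A := by rw [hA]; positivity
  have i1 : η * (A + B + G) ≤ 1 / 4 * (A + B + G) :=
    mul_le_mul_of_nonneg_right η1 (by positivity)
  have i2 : η * D ≤ D / τ := by
    have := mul_le_mul_of_nonneg_right η2 hD
    rwa [one_div, inv_mul_eq_div] at this
  rw [eW] at W
  rw [eT] at T
  rw [eM] at M
  linarith

lemma gronwall {F : ℝ → ℝ} {w : ℝ} (hc : Continuous F)
    (h : ∀ t > 0, ∃ d, HasDerivAt F d t ∧ d ≤ -(w * F t)) :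
    ∀ t ≥ 0, F t ≤ Real.exp (-w * t) * F 0 := by
  have hd : ∀ t > 0, ∃ d, HasDerivAt (fun t => Real.exp (w * t) * F t) d t ∧ d ≤ 0 := by
    intro t ht
    obtain ⟨d, h1, h2⟩ := h t ht
    have he : HasDerivAt (fun t => Real.exp (w * t)) (Real.exp (w * t) * (w * 1)) t :=
      ((hasDerivAt_id t).const_mul w).exp
    refine ⟨_, he.mul h1, ?_⟩
    have := (Real.exp_pos (w * t)).le
    nlinarith
  have anti : AntitoneOn (fun t => Real.exp (w * t) * F t) (Set.Ici 0) := by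
    apply antitoneOn_of_deriv_nonpos (convex_Ici 0)
    · exact (by fun_prop : Continuous fun t => Real.exp (w * t) * F t).continuousOn
    · intro t ht
      rw [interior_Ici] at ht
      obtain ⟨d, h1, _⟩ := hd t ht
      exact h1.differentiableAt.differentiableWithinAt
    · intro t ht
      rw [interior_Ici] at ht
      obtain ⟨d, h1, h2⟩ := hd t ht
      rw [h1.deriv]; exact h2
  intro t ht
  have := anti (Set.mem_Ici.2 le_rfl) (Set.mem_Ici.2 ht) ht
  simp only [mul_zero, Real.exp_zero, one_mul] at this
  have h2 := mul_le_mul_of_nonneg_left this (Real.exp_pos (-w * t)).le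
  rw [← mul_assoc, ← Real.exp_add] at h2
  simpa using h2

lemma quad {τ a κ ξ : ℝ} (hτ : 0 < τ) (hκ : 0 < κ) (hκa : κ < a)
    (hξ₁ : τ * (a - Real.sqrt (a ^ 2 - κ ^ 2)) < ξ)
    (hξ₂ : ξ < τ * (a + Real.sqrt (a ^ 2 - κ ^ 2))) :
    0 < ξ ∧ ∃ c0 > 0, ∀ g k : ℝ, c0 * (g ^ 2 + k ^ 2) ≤
      (a - ξ / (2 * τ)) * g ^ 2 + κ * (g * k) + ξ / (2 * τ) * k ^ 2 := by
  set s := Real.sqrt (a ^ 2 - κ ^ 2) with hs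
  have hs2 : s ^ 2 = a ^ 2 - κ ^ 2 := Real.sq_sqrt (by nlinarith)
  have hs0 : 0 ≤ s := Real.sqrt_nonneg _
  have hsa : s < a := by nlinarith
  have hξ : 0 < ξ := lt_trans (mul_pos hτ (by linarith)) hξ₁
  refine ⟨hξ, ?_⟩
  have e1 : ξ / (2 * τ) = (ξ / τ) / 2 := by field_simp
  have h1 : a - s < ξ / τ := by rw [lt_div_iff₀ hτ]; linarith
  have h2 : ξ / τ < a + s := by rw [div_lt_iff₀ hτ]; linarith
  rw [e1]
  set y := ξ / τ
  set r := y / 2 with hr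
  set p := a - r with hp
  have pr : 0 < r := by rw [hr]; linarith
  have pp : 0 < p := by rw [hp, hr]; linarith
  have hdisc : κ ^ 2 < 4 * p * r := by
    have : 0 < (y - (a - s)) * (a + s - y) := mul_pos (by linarith) (by linarith)
    have e : 4 * p * r = y * (2 * a - y) := by rw [hp, hr]; ring
    rw [e]; nlinarith
  set c0 := (4 * p * r - κ ^ 2) / (4 * (p + r)) with hc0
  have pc0 : 0 < c0 := div_pos (by linarith) (by positivity)
  have ec0 : 4 * c0 * (p + r) = 4 * p * r - κ ^ 2 := by rw [hc0]; field_simp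
  have hcp : 0 < p - c0 := by
    by_contra hcon
    push Not at hcon
    nlinarith [mul_pos hκ hκ, mul_pos pp pp, mul_pos pp pr]
  have hd2 : κ ^ 2 ≤ 4 * (p - c0) * (r - c0) := by nlinarith [sq_nonneg c0]
  refine ⟨c0, pc0, fun g k => ?_⟩
  have h3 : 0 ≤ 4 * (p - c0) * ((p - c0) * g ^ 2 + κ * (g * k) + (r - c0) * k ^ 2) := by
    have : 4 * (p - c0) * ((p - c0) * g ^ 2 + κ * (g * k) + (r - c0) * k ^ 2)
      = (2 * (p - c0) * g + κ * k) ^ 2 + (4 * (p - c0) * (r - c0) - κ ^ 2) * k ^ 2 := by ring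
    rw [this]
    have := mul_nonneg (sub_nonneg.2 hd2) (sq_nonneg k)
    positivity
  have h4 := nonneg_of_mul_nonneg_right h3 (by linarith)
  linarith

lemma abs_le_of_sq {x c A B Y : ℝ} (hc : 0 ≤ c) (hA : 0 ≤ A) (hB : 0 ≤ B) (hAY : A ≤ Y)
    (hBY : B ≤ Y) (h : x ^ 2 ≤ c ^ 2 * A * B) : |x| ≤ c * Y := by
  apply abs_le_of_sq_le_sq _ (mul_nonneg hc (hA.trans hAY))
  have : A * B ≤ Y * Y := mul_le_mul hAY hBY hB (hA.trans hAY)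
  have := mul_le_mul_of_nonneg_left this (sq_nonneg c)
  nlinarith

lemma young_aux {x y δ : ℝ} (hδ : 0 < δ) : x * y ≤ δ * x ^ 2 + 1 / (4 * δ) * y ^ 2 := by
  have : δ * x ^ 2 + 1 / (4 * δ) * y ^ 2 - x * y = δ * (x - y / (2 * δ)) ^ 2 := by
    field_simp; ring
  have : 0 ≤ δ * (x - y / (2 * δ)) ^ 2 := by positivity
  linarith

lemma abs_mul_le_aux {x y p q : ℝ} (hx : x ^ 2 ≤ p) (hy : y ^ 2 ≤ q) : |x * y| ≤ p + q := by
  rw [abs_le]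
  constructor <;> nlinarith [sq_nonneg (x + y), sq_nonneg (x - y)]

lemma abs_const_mul_le {x c B : ℝ} (hc : 0 < c) (h : |x| ≤ B) : |c * x| ≤ c * B := by
  rw [abs_mul, abs_of_pos hc]
  exact mul_le_mul_of_nonneg_left h hc.le

lemma neg_mul_le_half {x y : ℝ} : -(x * y) ≤ y ^ 2 / 2 + x ^ 2 / 2 := by
  nlinarith [sq_nonneg (x + y)]

lemma sq_neg_sub_le {x y : ℝ} : (-(x - y)) ^ 2 ≤ 2 * (x ^ 2 + y ^ 2) := by
  nlinarith [sq_nonneg (x + y)]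

end DHS

open DHS

set_option maxHeartbeats 4000000

/-- Exponential stability of the thermoelastic string with delayed heat conduction
for `0 < κ < a` and `ξ` in the interior of `J_{a,κ,τ}`. -/
theorem exponential_stability_DHstring
    (L τ a κ ξ : ℝ) (hL : 0 < L) (hτ : 0 < τ) (hκ : 0 < κ) (hκa : κ < a)
    (hξ₁ : τ * (a - Real.sqrt (a ^ 2 - κ ^ 2)) < ξ)
    (hξ₂ : ξ < τ * (a + Real.sqrt (a ^ 2 - κ ^ 2))) :
    ∃ C > (0 : ℝ), ∃ w > (0 : ℝ), ∀ u θ : ℝ → ℝ → ℝ,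
      IsSmoothSolDelayedHeatString L τ a κ u θ →
      ∀ t ≥ (0 : ℝ),
        energyDHString L τ ξ u θ t ≤ C * Real.exp (-w * t) * energyDHString L τ ξ u θ 0 := by
  obtain ⟨hξ, c0, hc0, hq⟩ := quad hτ hκ hκa hξ₁ hξ₂
  set k : ℝ := 2 * L ^ 3 / 5 with hk
  have pk : 0 < k := by positivity
  set K0 : ℝ := ∫ x in (0:ℝ)..L, φ0 L x ^ 2 with hK0
  set K1 : ℝ := ∫ x in (0:ℝ)..L, φ1 L x ^ 2 with hK1
  set K2 : ℝ := ∫ x in (0:ℝ)..L, φ2 L x ^ 2 with hK2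
  have pK0 : 0 ≤ K0 := int_nonneg hL fun x _ => sq_nonneg _
  have pK1 : 0 ≤ K1 := int_nonneg hL fun x _ => sq_nonneg _
  have pK2 : 0 ≤ K2 := int_nonneg hL fun x _ => sq_nonneg _
  obtain ⟨l1, pl1, l2, pl2, l3, pl3, N0, pN0, η, pη, halg⟩ := alg (L := L) (k := k) (τ := τ)
    (c0 := c0) (CU := L ^ 2 / 2) (CQ := L ^ 2 / 8) (m := 3 * (1 + L)) (CZ := 2 / τ)
    (CV := K2 / (2 * k)) (CG := K1 * L ^ 2 / 2) hL pk hτ hc0 (by positivity) (by positivity)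
    (by positivity) (by positivity) (by positivity) (by positivity)
    (fun δ => 1 / (4 * δ) * (2 / L ^ 2)) (fun δ => (K0 + K2) / 2 + 1 / (4 * δ) * (k ^ 2 * K0))
    (fun δ => κ ^ 2 + a ^ 2 + 3 * δ * L ^ 2 + 1 / (4 * δ) * L ^ 2)
    (fun δ hδ => by positivity) (fun δ hδ => by positivity) (fun δ hδ => by positivity)
  set K := 2 + L + L + l1 * (1 / L + K2 * L ^ 2) + l2 * (K0 + K2 * L ^ 2) + l3 * L with hK
  have pK : 0 < K := by positivity
  set μ := 2 * (1 + 1 / ξ) with hμ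
  have pμ : 0 < μ := by positivity
  set N := N0 + K * μ + 1 with hN
  have pN : 0 < N := by positivity
  have hNN : N ≥ N0 := by
    have : 0 < K * μ := by positivity
    rw [hN]; linarith
  set C1 := N + K * μ with hC1
  have pC1 : 0 < C1 := by positivity
  set w := η / ((1 + L ^ 2) * (1 + ξ) * C1) with hw
  have pw : 0 < w := by positivity
  refine ⟨C1, pC1, w, pw, fun u θ h => ?_⟩
  have hu := sU h
  have hθ := sθ h
  set E : ℝ → ℝ := fun t => (1 / 2) * (fE L u θ t + ξ * fD L τ θ t) with hE
  set Y : ℝ → ℝ := fun t => qA L u t + qB L u t + qP L θ t + fD L τ θ t with hY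
  set X : ℝ → ℝ := fun t => fZ L τ θ t + fU L u t + fQ L u t / 8 + l1 * (-(fc L u t * fS L u t))
    + l2 * (-(fR L u t * fS L u t)) + l3 * fM L u θ t with hX
  set F : ℝ → ℝ := fun t => N * E t + X t with hF
  have nY : ∀ t, 0 ≤ Y t := fun t => by
    have := qA_nonneg (u := u) hL t
    have := qB_nonneg (u := u) hL t
    have := qP_nonneg (θ := θ) hL t
    have := fD_nonneg (τ := τ) (θ := θ) hL t
    simp only [hY]; positivity
  have hXY : ∀ t ≥ 0, |X t| ≤ K * Y t := by
    intro t ht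
    have nA := qA_nonneg (u := u) hL t
    have nB := qB_nonneg (u := u) hL t
    have nP := qP_nonneg (θ := θ) hL t
    have nV := qV_nonneg (u := u) hL t
    have nD := fD_nonneg (τ := τ) (θ := θ) hL t
    have eA := qA_eq hL hu t
    have hYt : Y t = qA L u t + qB L u t + qP L θ t + fD L τ θ t := rfl
    have nc : 0 ≤ L * fc L u t ^ 2 := by positivity
    have hZ := bdZ (τ := τ) hL hθ t
    have aU : |fU L u t| ≤ L * Y t := abs_le_of_sq hL.le nB nA (by linarith) (by linarith)
      (bdU hL h ht)
    have aQ : |fQ L u t| ≤ L * Y t := abs_le_of_sq hL.le nA nB (by linarith) (by linarith)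
      (bdQ hL hu t)
    have aM : |fM L u θ t| ≤ L * Y t := abs_le_of_sq hL.le nV nP (by linarith) (by linarith)
      ((bdM hL hu hθ t).trans (le_of_eq (by ring)))
    have hS := estS hL h ht
    have hS' : fS L u t ^ 2 ≤ K2 * L ^ 2 * Y t := by
      have : K2 * L ^ 2 * qB L u t ≤ K2 * L ^ 2 * Y t :=
        mul_le_mul_of_nonneg_left (by linarith) (by positivity)
      calc _ ≤ _ := hS
        _ = K2 * L ^ 2 * qB L u t := by rw [hK2]; ring
        _ ≤ _ := this
    have hR' : fR L u t ^ 2 ≤ K0 * Y t :=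
      (estR hL hu t).trans (mul_le_mul_of_nonneg_left (by linarith) pK0)
    have hc' : fc L u t ^ 2 ≤ 1 / L * Y t := by
      have : L * fc L u t ^ 2 ≤ Y t := by linarith
      rw [one_div, inv_mul_eq_div, le_div_iff₀ hL]; linarith
    have acS : |fc L u t * fS L u t| ≤ (1 / L + K2 * L ^ 2) * Y t :=
      (abs_mul_le_aux hc' hS').trans (le_of_eq (by ring))
    have aRS : |fR L u t * fS L u t| ≤ (K0 + K2 * L ^ 2) * Y t :=
      (abs_mul_le_aux hR' hS').trans (le_of_eq (by ring))
    have m1 := abs_le.1 (abs_const_mul_le pl1 acS)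
    have m2 := abs_le.1 (abs_const_mul_le pl2 aRS)
    have m3 := abs_le.1 (abs_const_mul_le pl3 aM)
    have aU' := abs_le.1 aU
    have aQ' := abs_le.1 aQ
    have nLY : 0 ≤ L * Y t := mul_nonneg hL.le (nY t)
    have eK : K * Y t = 2 * Y t + L * Y t + L * Y t + l1 * ((1 / L + K2 * L ^ 2) * Y t)
      + l2 * ((K0 + K2 * L ^ 2) * Y t) + l3 * (L * Y t) := by rw [hK]; ring
    rw [eK]
    have nYt := nY t
    clear_value K Y
    simp only [hX]
    rw [abs_le]
    clear hS hS' hR' hc' acS aRS aU aQ aM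
    constructor
    · linarith [m1.2, m2.2, m3.1, aU'.1, aQ'.1]
    · linarith [m1.1, m2.1, m3.2, aU'.2, aQ'.2]
  have hYE : ∀ t, Y t ≤ μ * E t := by
    intro t
    have nA := qA_nonneg (u := u) hL t
    have nB := qB_nonneg (u := u) hL t
    have nP := qP_nonneg (θ := θ) hL t
    have nD := fD_nonneg (τ := τ) (θ := θ) hL t
    have e1 : μ * E t = (qA L u t + qB L u t + qP L θ t) * (1 + 1 / ξ)
        + ξ * fD L τ θ t + fD L τ θ t := by
      simp only [hE, hμ, fE_eq hu hθ]; field_simp; ring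
    rw [e1]
    simp only [hY]
    have i1 : 0 ≤ (qA L u t + qB L u t + qP L θ t) * (1 / ξ) := by positivity
    have i2 : 0 ≤ ξ * fD L τ θ t := by positivity
    linarith
  have hEY : ∀ t, E t ≤ (1 + ξ) * Y t := by
    intro t
    have nA := qA_nonneg (u := u) hL t
    have nB := qB_nonneg (u := u) hL t
    have nP := qP_nonneg (θ := θ) hL t
    have nD := fD_nonneg (τ := τ) (θ := θ) hL t
    simp only [hE, hY, fE_eq hu hθ]
    have i1 : 0 ≤ ξ * (qA L u t + qB L u t + qP L θ t) := by positivity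
    have i2 : 0 ≤ ξ * fD L τ θ t := by positivity
    linarith
  have hFE : ∀ t ≥ 0, E t ≤ F t ∧ F t ≤ C1 * E t := by
    intro t ht
    have h1 := abs_le.1 (hXY t ht)
    have h2 := mul_le_mul_of_nonneg_left (hYE t) pK.le
    have nE : 0 ≤ E t := by
      have := (nY t).trans (hYE t)
      exact nonneg_of_mul_nonneg_right this pμ
    have h3 : 0 ≤ N0 * E t := by positivity
    simp only [hF]
    constructor
    · have e : N * E t = N0 * E t + K * (μ * E t) + E t := by rw [hN]; ring
      rw [e]; linarith
    · have e : C1 * E t = N * E t + K * (μ * E t) := by rw [hC1]; ring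
      rw [e]; linarith
  have cD : Continuous (fD L τ θ) := continuous_iff_continuousAt.2 fun t =>
    (dD (L := L) hτ hθ t).continuousAt
  have cZ : Continuous (fZ L τ θ) := continuous_iff_continuousAt.2 fun t =>
    (dZ (L := L) hτ hθ t).continuousAt
  have cF : Continuous F := by
    have := cont_fE (L := L) hu hθ
    have := cont_fU (L := L) hu
    have := cont_fQ (L := L) hu
    have := cont_fc (L := L) hu
    have := cont_fR (L := L) hu
    have := cont_fS (L := L) hu
    have := cont_fM (L := L) hu hθ
    simp only [hF, hX, hE]
    fun_prop
  have hG := gronwall (w := w) cF (fun t ht => by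
    have ht' : -τ ≤ t := by linarith
    have D1 := ((dE hL h ht ht').add ((dD (L := L) hτ hθ t).const_mul ξ)).const_mul (1 / 2)
    have D2 := dZ (L := L) hτ hθ t
    have D3 := dU hL h ht
    have D4 := dQ hL h ht
    have D5 := ((dc hL h ht ht').mul (dS h t)).neg
    have D6 := ((dR hL h ht).mul (dS h t)).neg
    have D7 := dM hL h ht ht'
    obtain ⟨r, hr, hr2⟩ := estr2 hL hu t
    rw [hr] at D5 D6
    have DF := (D1.const_mul N).add (((((D2.add D3).add (D4.div_const 8)).add
      (D5.const_mul l1)).add (D6.const_mul l2)).add (D7.const_mul l3))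
    refine ⟨_, DF, ?_⟩
    have nA := qA_nonneg (u := u) hL t
    have nB := qB_nonneg (u := u) hL t
    have nP := qP_nonneg (θ := θ) hL t
    have nV := qV_nonneg (u := u) hL t
    have nG := fG_nonneg (θ := θ) hL t
    have nH := fG_nonneg (θ := θ) hL (t - τ)
    have nD := fD_nonneg (τ := τ) (θ := θ) hL t
    have nb := qb_nonneg (L := L) (u := u) t
    have eA := qA_eq hL hu t
    have hP := qP_le hL h ht'
    have hR := estR hL hu t
    have hj := estj hL hθ t
    have gU := (estU hL hu hθ t).trans
      (show _ ≤ qA L u t - qB L u t / 2 + L ^ 2 / 2 * fG L θ t by linarith)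
    have gQ := estQ hL hu hθ t
    have gW : ∀ δ > 0,
        -(1 / L * (pdX u L t - pdX u 0 t) * fS L u t + fc L u t * (r + fc L u t * k)) ≤
        -(k / 2 * fc L u t ^ 2) + K2 / (2 * k) * qV L u t + δ * qb L u t
          + 1 / (4 * δ) * (2 / L ^ 2) * fS L u t ^ 2 := by
      intro δ hδ
      have y1 := young_aux (x := -(pdX u L t - pdX u 0 t)) (y := 1 / L * fS L u t)
        (δ := δ / 2) (by positivity)
      have y2 := young_aux (x := -fc L u t) (y := r) (δ := k / 2) (by positivity)
      have y3 : (-(pdX u L t - pdX u 0 t)) ^ 2 ≤ 2 * qb L u t := by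
        unfold qb; exact sq_neg_sub_le.trans (le_of_eq (by ring))
      have y4 := mul_le_mul_of_nonneg_left y3 (by positivity : 0 ≤ δ / 2)
      have y5 := mul_le_mul_of_nonneg_left hr2 (by positivity : 0 ≤ 1 / (4 * (k / 2)))
      have e1 : 1 / (4 * (k / 2)) * (K2 * qV L u t) = K2 / (2 * k) * qV L u t := by
        field_simp; ring_nf
      have e2 : 1 / (4 * (δ / 2)) * (1 / L * fS L u t) ^ 2
          = 1 / (4 * δ) * (2 / L ^ 2) * fS L u t ^ 2 := by
        field_simp
      rw [e1] at y5
      rw [e2] at y1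
      linarith
    have gT : ∀ δ > 0, -((fS L u t + ∫ x in (0:ℝ)..L, θ x t * φ1 L x) * fS L u t
        + fR L u t * (r + fc L u t * k)) ≤
        -(fS L u t ^ 2 / 2) + δ * fc L u t ^ 2
          + ((K0 + K2) / 2 + 1 / (4 * δ) * (k ^ 2 * K0)) * qV L u t
          + K1 * L ^ 2 / 2 * fG L θ t := by
      intro δ hδ
      generalize (∫ x in (0:ℝ)..L, θ x t * φ1 L x) = j at hj ⊢
      have y1 : -(j * fS L u t) ≤ fS L u t ^ 2 / 2 + j ^ 2 / 2 := neg_mul_le_half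
      have y2 : -(fR L u t * r) ≤ fR L u t ^ 2 / 2 + r ^ 2 / 2 := (neg_mul_le_half).trans (le_of_eq (by ring))
      have y3 := young_aux (x := -fc L u t) (y := k * fR L u t) hδ
      have y4 := mul_le_mul_of_nonneg_left hR (by positivity : 0 ≤ 1 / (4 * δ) * k ^ 2)
      have y5 := mul_le_mul_of_nonneg_left hP pK1
      have hj' : j ^ 2 ≤ K1 * qP L θ t := hj
      have hR' : fR L u t ^ 2 ≤ K0 * qV L u t := hR
      have hr' : r ^ 2 ≤ K2 * qV L u t := hr2
      have y4' : 1 / (4 * δ) * k ^ 2 * fR L u t ^ 2 ≤ 1 / (4 * δ) * k ^ 2 * (K0 * qV L u t) := y4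
      linarith
    have gM : ∀ δ > 0, (∫ (x : ℝ) in 0..L,
        (κ * pdX θ x (t - τ) + a * pdX θ x t - pdT u x t) * (pdT u x t - fc L u t) -
        θ x t * (pdX u x t - pdX u 0 t - θ x t - x * (1 / L * (pdX u L t - pdX u 0 t)))) ≤
        -(qV L u t / 2) + δ * (3 * (1 + L)) * (qB L u t + qb L u t)
          + (κ ^ 2 + a ^ 2 + 3 * δ * L ^ 2 + 1 / (4 * δ) * L ^ 2)
            * (fG L θ t + fG L θ (t - τ)) := by
      intro δ hδ
      have y1 := estM (κ := κ) (a := a) (τ := τ) hL hu hθ t hδ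
      refine y1.trans ?_
      have z1 := mul_le_mul_of_nonneg_left hP
        (by positivity : 0 ≤ 3 * δ + 1 / (4 * δ))
      have z2 : 0 ≤ (3 * δ * L ^ 2 + 1 / (4 * δ) * L ^ 2) * fG L θ (t - τ) := by positivity
      have z3 : 0 ≤ κ ^ 2 * fG L θ t := by positivity
      have z4 : 0 ≤ a ^ 2 * fG L θ (t - τ) := by positivity
      have z5 : 0 ≤ δ * L * qB L u t := by positivity
      have z6 : 0 ≤ δ * qb L u t := by positivity
      linarith
    have gZ : (2 * fG L θ t - fG L θ (t - τ) - fD L τ θ t) / τ ≤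
        2 / τ * fG L θ t - fD L τ θ t / τ := by
      have : 0 ≤ fG L θ (t - τ) / τ := by positivity
      have e : (2 * fG L θ t - fG L θ (t - τ) - fD L τ θ t) / τ
        = 2 / τ * fG L θ t - fG L θ (t - τ) / τ - fD L τ θ t / τ := by ring
      linarith
    have key := halg N hNN (qA L u t) (qB L u t) (fG L θ t) (fG L θ (t - τ)) (fD L τ θ t)
      (qb L u t) (fc L u t ^ 2) (fS L u t ^ 2) (qV L u t) _ _ _ _ _ _ _
      nB nG nH nD nb (sq_nonneg _) (sq_nonneg _) nV eA gU gQ gW gT gM gZ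
      (estE (a := a) (κ := κ) (τ := τ) hL hθ hq)
    have hwF : w * F t ≤ η * (qA L u t + qB L u t + fG L θ t + fD L τ θ t) := by
      have s1 : F t ≤ C1 * ((1 + ξ) * Y t) :=
        (hFE t ht.le).2.trans (mul_le_mul_of_nonneg_left (hEY t) pC1.le)
      have s2 : Y t ≤ (1 + L ^ 2) * (qA L u t + qB L u t + fG L θ t + fD L τ θ t) := by
        have : 0 ≤ L ^ 2 * (qA L u t + qB L u t + fD L τ θ t) := by positivity
        simp only [hY]; linarith
      have s3 : F t ≤ C1 * ((1 + ξ) * ((1 + L ^ 2) *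
          (qA L u t + qB L u t + fG L θ t + fD L τ θ t))) :=
        s1.trans (mul_le_mul_of_nonneg_left
          (mul_le_mul_of_nonneg_left s2 (by positivity)) pC1.le)
      calc w * F t ≤ w * _ := mul_le_mul_of_nonneg_left s3 pw.le
        _ = _ := by rw [hw]; field_simp
    refine le_trans (le_of_eq ?_) (key.trans (neg_le_neg hwF))
    ring)
  intro t ht
  rw [energy_eq hθ, energy_eq hθ]
  change E t ≤ C1 * Real.exp (-w * t) * E 0
  calc E t ≤ F t := (hFE t ht).1
    _ ≤ Real.exp (-w * t) * F 0 := hG t ht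
    _ ≤ Real.exp (-w * t) * (C1 * E 0) :=
      mul_le_mul_of_nonneg_left (hFE 0 le_rfl).2 (Real.exp_pos _).le
    _ = _ := by ring
end

section
/- Assume 0 < κ ≤ a and ξ ∈ J_{a,κ,τ}. Then for every smooth solution (u,θ) of the thermoelastic beam with delayed heat conduction and coupling through θ_xx, the energy t ↦ E(t) is nonincreasing on [0,∞). -/
open MeasureTheory intervalIntegral

/-- A smooth solution of the thermoelastic beam with delayed heat conduction and
coupling through `θ_xx`:
`u_tt + u_xxxx − θ_xx = 0`, `θ_t − κ·θ_xx(·,·−τ) − a·θ_xx + u_txx = 0` on `(0,L)×(0,∞)`,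
with hinged boundary conditions for `u` and Dirichlet conditions for `θ`. -/
structure IsSmoothSolDHBeamXX (L τ a κ : ℝ) (u θ : ℝ → ℝ → ℝ) : Prop where
  smooth_u : ContDiff ℝ (⊤ : ℕ∞) (fun p : ℝ × ℝ => u p.1 p.2)
  smooth_θ : ContDiff ℝ (⊤ : ℕ∞) (fun p : ℝ × ℝ => θ p.1 p.2)
  pde_u : ∀ x ∈ Set.Ioo (0 : ℝ) L, ∀ t > (0 : ℝ),
    pdT (pdT u) x t + pdX (pdX (pdX (pdX u))) x t - pdX (pdX θ) x t = 0
  pde_θ : ∀ x ∈ Set.Ioo (0 : ℝ) L, ∀ t > (0 : ℝ),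
    pdT θ x t - κ * pdX (pdX θ) x (t - τ) - a * pdX (pdX θ) x t
      + pdX (pdX (pdT u)) x t = 0
  bc_u : ∀ t : ℝ, 0 ≤ t →
    u 0 t = 0 ∧ u L t = 0 ∧ pdX (pdX u) 0 t = 0 ∧ pdX (pdX u) L t = 0
  bc_θ : ∀ t : ℝ, -τ ≤ t → θ 0 t = 0 ∧ θ L t = 0

/-- The energy of the thermoelastic beam with delayed heat conduction. -/
noncomputable def energyDHBeam (L τ ξ : ℝ) (u θ : ℝ → ℝ → ℝ) (t : ℝ) : ℝ :=
  (1 / 2) * ((∫ x in (0 : ℝ)..L, ((pdT u x t) ^ 2 + (pdX (pdX u) x t) ^ 2 + (θ x t) ^ 2))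
    + ξ * ∫ x in (0 : ℝ)..L, ∫ ρ in (0 : ℝ)..(1 : ℝ), (pdX θ x (t - τ * ρ)) ^ 2)

def Sm (f : ℝ → ℝ → ℝ) : Prop := ContDiff ℝ (⊤ : ℕ∞) (fun p : ℝ × ℝ => f p.1 p.2)

theorem Sm.hasX {f : ℝ → ℝ → ℝ} (h : Sm f) (x t : ℝ) :
    HasDerivAt (fun y => f y t) (fderiv ℝ (fun p : ℝ × ℝ => f p.1 p.2) (x, t) (1, 0)) x := by
  have h1 : HasFDerivAt (fun p : ℝ × ℝ => f p.1 p.2) _ (x, t) :=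
    (ContDiff.differentiable h (by simp) (x, t)).hasFDerivAt
  have h2 : HasDerivAt (fun y : ℝ => (y, t)) ((1 : ℝ), (0 : ℝ)) x :=
    (hasDerivAt_id x).prodMk (hasDerivAt_const x t)
  exact h1.comp_hasDerivAt x h2

theorem Sm.hasT {f : ℝ → ℝ → ℝ} (h : Sm f) (x t : ℝ) :
    HasDerivAt (fun s => f x s) (fderiv ℝ (fun p : ℝ × ℝ => f p.1 p.2) (x, t) (0, 1)) t := by
  have h1 : HasFDerivAt (fun p : ℝ × ℝ => f p.1 p.2) _ (x, t) :=
    (ContDiff.differentiable h (by simp) (x, t)).hasFDerivAt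
  have h2 : HasDerivAt (fun y : ℝ => (x, y)) ((0 : ℝ), (1 : ℝ)) t :=
    (hasDerivAt_const t x).prodMk (hasDerivAt_id t)
  exact h1.comp_hasDerivAt t h2

theorem Sm.pdX_eq {f : ℝ → ℝ → ℝ} (h : Sm f) (x t : ℝ) :
    pdX f x t = fderiv ℝ (fun p : ℝ × ℝ => f p.1 p.2) (x, t) (1, 0) := (h.hasX x t).deriv

theorem Sm.pdT_eq {f : ℝ → ℝ → ℝ} (h : Sm f) (x t : ℝ) :
    pdT f x t = fderiv ℝ (fun p : ℝ × ℝ => f p.1 p.2) (x, t) (0, 1) := (h.hasT x t).deriv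

theorem Sm.dX {f : ℝ → ℝ → ℝ} (h : Sm f) (x t : ℝ) :
    HasDerivAt (fun y => f y t) (pdX f x t) x := by
  rw [h.pdX_eq]; exact h.hasX x t

theorem Sm.dT {f : ℝ → ℝ → ℝ} (h : Sm f) (x t : ℝ) :
    HasDerivAt (fun s => f x s) (pdT f x t) t := by
  rw [h.pdT_eq]; exact h.hasT x t

theorem Sm.fd {f : ℝ → ℝ → ℝ} (h : Sm f) :
    ContDiff ℝ (⊤ : ℕ∞) (fderiv ℝ (fun p : ℝ × ℝ => f p.1 p.2)) :=
  ContDiff.fderiv_right h (by simp)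

theorem Sm.X {f : ℝ → ℝ → ℝ} (h : Sm f) : Sm (pdX f) := by
  have : (fun p : ℝ × ℝ => pdX f p.1 p.2) =
      fun p => fderiv ℝ (fun p : ℝ × ℝ => f p.1 p.2) p (1, 0) := by
    ext p; exact h.pdX_eq p.1 p.2
  unfold Sm
  rw [this]
  exact h.fd.clm_apply contDiff_const

theorem Sm.T {f : ℝ → ℝ → ℝ} (h : Sm f) : Sm (pdT f) := by
  have : (fun p : ℝ × ℝ => pdT f p.1 p.2) =
      fun p => fderiv ℝ (fun p : ℝ × ℝ => f p.1 p.2) p (0, 1) := by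
    ext p; exact h.pdT_eq p.1 p.2
  unfold Sm
  rw [this]
  exact h.fd.clm_apply contDiff_const

theorem Sm.cont {f : ℝ → ℝ → ℝ} (h : Sm f) : Continuous (fun p : ℝ × ℝ => f p.1 p.2) :=
  ContDiff.continuous h

theorem Sm.comp {f : ℝ → ℝ → ℝ} (h : Sm f) {α : Type*} [TopologicalSpace α] {g k : α → ℝ}
    (hg : Continuous g) (hk : Continuous k) : Continuous (fun y => f (g y) (k y)) :=
  h.cont.comp (hg.prodMk hk)

theorem Sm.comm {f : ℝ → ℝ → ℝ} (h : Sm f) : pdT (pdX f) = pdX (pdT f) := by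
  funext x t
  have e1 : (fun p : ℝ × ℝ => pdX f p.1 p.2) =
      fun p => fderiv ℝ (fun p : ℝ × ℝ => f p.1 p.2) p (1, 0) := by
    ext p; exact h.pdX_eq p.1 p.2
  have e2 : (fun p : ℝ × ℝ => pdT f p.1 p.2) =
      fun p => fderiv ℝ (fun p : ℝ × ℝ => f p.1 p.2) p (0, 1) := by
    ext p; exact h.pdT_eq p.1 p.2
  have hd : DifferentiableAt ℝ (fderiv ℝ (fun p : ℝ × ℝ => f p.1 p.2)) (x, t) :=
    h.fd.differentiable (by simp) _
  rw [h.X.pdT_eq, h.T.pdX_eq, e1, e2, fderiv_clm_apply hd (differentiableAt_const _),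
    fderiv_clm_apply hd (differentiableAt_const _)]
  have hs : IsSymmSndFDerivAt ℝ (fun p : ℝ × ℝ => f p.1 p.2) (x, t) :=
    (ContDiff.contDiffAt h).isSymmSndFDerivAt
      (by simpa using (by exact_mod_cast le_top : ((2 : ℕ∞) : WithTop ℕ∞) ≤ ((⊤ : ℕ∞) : WithTop ℕ∞)))
  simpa using hs (0, 1) (1, 0)

theorem hasDerivAt_param (F F' : ℝ → ℝ → ℝ) (L : ℝ)
    (hF : ∀ t, Continuous (fun x => F x t))
    (hF' : Continuous (fun p : ℝ × ℝ => F' p.1 p.2))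
    (hd : ∀ x t, HasDerivAt (fun s => F x s) (F' x t) t) (t : ℝ) :
    HasDerivAt (fun s => ∫ x in (0 : ℝ)..L, F x s) (∫ x in (0 : ℝ)..L, F' x t) t := by
  obtain ⟨C, hC⟩ := (isCompact_uIcc (a := (0 : ℝ)) (b := L)).prod
    (isCompact_closedBall t 1) |>.exists_bound_of_continuousOn hF'.continuousOn
  refine (intervalIntegral.hasDerivAt_integral_of_dominated_loc_of_deriv_le
    (F := fun s x => F x s) (F' := fun s x => F' x s)
    (bound := fun _ => C) (Metric.ball_mem_nhds t one_pos) ?_ ?_ ?_ ?_ ?_ ?_).2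
  · exact Filter.Eventually.of_forall fun s => (hF s).aestronglyMeasurable
  · exact (hF t).intervalIntegrable _ _
  · exact (hF'.comp (by fun_prop : Continuous fun x : ℝ => (x, t))).aestronglyMeasurable
  · refine Filter.Eventually.of_forall fun x hx s hs => ?_
    exact hC (x, s) ⟨Set.uIoc_subset_uIcc hx, Metric.ball_subset_closedBall hs⟩
  · exact intervalIntegrable_const
  · exact Filter.Eventually.of_forall fun x _ s _ => hd x s

theorem quad_ineq (τ a κ ξ : ℝ) (hτ : 0 < τ) (hκ : 0 < κ) (hκa : κ ≤ a)
    (hξ₁ : τ * (a - Real.sqrt (a ^ 2 - κ ^ 2)) ≤ ξ)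
    (hξ₂ : ξ ≤ τ * (a + Real.sqrt (a ^ 2 - κ ^ 2))) (p q : ℝ) :
    -κ * p * q - a * p ^ 2 + ξ / (2 * τ) * (p ^ 2 - q ^ 2) ≤ 0 := by
  set r := Real.sqrt (a ^ 2 - κ ^ 2) with hr
  have hr2 : r ^ 2 = a ^ 2 - κ ^ 2 := Real.sq_sqrt (by nlinarith)
  have hr0 : 0 ≤ r := Real.sqrt_nonneg _
  have hra : r < a := by nlinarith
  obtain ⟨s, rfl⟩ : ∃ s, ξ = τ * s := ⟨ξ / τ, by field_simp⟩
  have h1 := le_of_mul_le_mul_left hξ₁ hτ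
  have h2 := le_of_mul_le_mul_left hξ₂ hτ
  have e : τ * s / (2 * τ) = s / 2 := by field_simp
  rw [e]
  have hs : 0 < s := by linarith
  have hk : κ ^ 2 ≤ s * (2 * a - s) := by nlinarith
  have : 0 ≤ s * (2 * κ * p * q + 2 * a * p ^ 2 - s * (p ^ 2 - q ^ 2)) := by
    nlinarith [sq_nonneg (s * q + κ * p), mul_nonneg (sub_nonneg.2 hk) (sq_nonneg p)]
  have := nonneg_of_mul_nonneg_right this hs
  linarith

theorem delay_eq (g : ℝ → ℝ) (hg : Continuous g) (τ : ℝ) (hτ : 0 < τ) (t : ℝ) :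
    HasDerivAt (fun s => ∫ ρ in (0 : ℝ)..1, g (s - τ * ρ)) (1 / τ * (g t - g (t - τ))) t := by
  have e : (fun s => ∫ ρ in (0 : ℝ)..1, g (s - τ * ρ)) =
      fun s => 1 / τ * ((∫ y in (0 : ℝ)..s, g y) - ∫ y in (0 : ℝ)..(s - τ), g y) := by
    funext s
    rw [intervalIntegral.integral_comp_sub_mul g hτ.ne', 
      intervalIntegral.integral_interval_sub_left (hg.intervalIntegrable _ _)
        (hg.intervalIntegrable _ _)]
    simp
  rw [e]
  have h1 : ∀ s, HasDerivAt (fun s => ∫ y in (0 : ℝ)..s, g y) (g s) s := fun s =>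
    hg.integral_hasStrictDerivAt 0 s |>.hasDerivAt
  exact ((h1 t).sub ((h1 (t - τ)).comp_sub_const t τ)).const_mul _

theorem energy_nonincreasing_DHbeamXX
    (L τ a κ ξ : ℝ) (hL : 0 < L) (hτ : 0 < τ) (hκ : 0 < κ) (hκa : κ ≤ a)
    (hξ₁ : τ * (a - Real.sqrt (a ^ 2 - κ ^ 2)) ≤ ξ)
    (hξ₂ : ξ ≤ τ * (a + Real.sqrt (a ^ 2 - κ ^ 2)))
    (u θ : ℝ → ℝ → ℝ) (hsol : IsSmoothSolDHBeamXX L τ a κ u θ) :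
    AntitoneOn (energyDHBeam L τ ξ u θ) (Set.Ici (0 : ℝ)) := by
  have hu : Sm u := hsol.smooth_u
  have hθ : Sm θ := hsol.smooth_θ
  have hcomm : pdT (pdX (pdX u)) = pdX (pdX (pdT u)) := by rw [hu.X.comm, hu.comm]
  have c1 := hu.T
  have c2 := hu.X.X
  have c3 := hu.T.T
  have c4 := hu.T.X.X
  have c5 := hθ.T
  have c6 := hθ.X
  -- derivative of the energy
  have hE : ∀ t, HasDerivAt (energyDHBeam L τ ξ u θ)
      (∫ x in (0 : ℝ)..L, (pdT u x t * pdT (pdT u) x t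
        + pdX (pdX u) x t * pdX (pdX (pdT u)) x t + θ x t * pdT θ x t
        + ξ / (2 * τ) * (pdX θ x t ^ 2 - pdX θ x (t - τ) ^ 2))) t := by
    intro t
    have hA := hasDerivAt_param
      (fun x t => (pdT u x t) ^ 2 + (pdX (pdX u) x t) ^ 2 + (θ x t) ^ 2)
      (fun x t => 2 * (pdT u x t * pdT (pdT u) x t)
        + 2 * (pdX (pdX u) x t * pdX (pdX (pdT u)) x t) + 2 * (θ x t * pdT θ x t)) L
      (fun t => (((c1.comp continuous_id continuous_const).pow 2).add
        ((c2.comp continuous_id continuous_const).pow 2)).add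
        ((hθ.comp continuous_id continuous_const).pow 2))
      (by
        have := c1.cont; have := c2.cont; have := c3.cont; have := c4.cont
        have := c5.cont; have := hθ.cont
        fun_prop)
      (fun x t => by
        have h2 := c2.dT x t
        rw [hcomm] at h2
        refine ((((c1.dT x t).pow 2).add (h2.pow 2)).add ((hθ.dT x t).pow 2)).congr_deriv ?_
        norm_num
        ring) t
    have hB := hasDerivAt_param
      (fun x t => ∫ ρ in (0 : ℝ)..(1 : ℝ), (pdX θ x (t - τ * ρ)) ^ 2)
      (fun x t => 1 / τ * (pdX θ x t ^ 2 - pdX θ x (t - τ) ^ 2)) L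
      (fun t => intervalIntegral.continuous_parametric_intervalIntegral_of_continuous'
        (f := fun x ρ => (pdX θ x (t - τ * ρ)) ^ 2)
        (by
          have h := c6.comp (α := ℝ × ℝ) (g := fun p => p.1) (k := fun p => t - τ * p.2)
            (by fun_prop) (by fun_prop)
          exact h.pow 2) 0 1)
      (by
        have h1 := c6.cont
        have h2 := c6.comp (α := ℝ × ℝ) (g := fun p => p.1) (k := fun p => p.2 - τ)
          (by fun_prop) (by fun_prop)
        fun_prop)
      (fun x t => delay_eq (fun s => pdX θ x s ^ 2)
        ((c6.comp continuous_const continuous_id).pow 2) τ hτ t) t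
    have := (hA.add (hB.const_mul ξ)).const_mul (1 / 2 : ℝ)
    refine this.congr_deriv ?_
    rw [← intervalIntegral.integral_const_mul, ← intervalIntegral.integral_add,
      ← intervalIntegral.integral_const_mul]
    · congr 1
      funext x
      field_simp
    · apply Continuous.intervalIntegrable
      have h1 := c1.comp (continuous_id (X := ℝ)) (continuous_const (y := t))
      have h2 := c2.comp (continuous_id (X := ℝ)) (continuous_const (y := t))
      have h3 := c3.comp (continuous_id (X := ℝ)) (continuous_const (y := t))
      have h4 := c4.comp (continuous_id (X := ℝ)) (continuous_const (y := t))
      have h5 := c5.comp (continuous_id (X := ℝ)) (continuous_const (y := t))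
      have h6 := hθ.comp (continuous_id (X := ℝ)) (continuous_const (y := t))
      simp only [id] at *
      fun_prop
    · apply Continuous.intervalIntegrable
      have h1 := c6.comp (continuous_id (X := ℝ)) (continuous_const (y := t))
      have h2 := c6.comp (continuous_id (X := ℝ)) (continuous_const (y := t - τ))
      simp only [id] at *
      fun_prop
  refine antitoneOn_of_deriv_nonpos (convex_Ici 0)
    (fun t _ => (hE t).continuousAt.continuousWithinAt)
    (fun t _ => (hE t).differentiableAt.differentiableWithinAt) ?_
  intro t ht
  rw [interior_Ici] at ht
  have ht : 0 < t := ht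
  rw [(hE t).deriv]
  -- boundary flux
  let B : ℝ → ℝ := fun x => -(pdT u x t * pdX (pdX (pdX u)) x t)
    + pdX (pdT u) x t * pdX (pdX u) x t + pdT u x t * pdX θ x t - pdX (pdT u) x t * θ x t
    + θ x t * (κ * pdX θ x (t - τ) + a * pdX θ x t)
  let B' : ℝ → ℝ := fun x => -(pdT u x t * pdX (pdX (pdX (pdX u))) x t)
    + pdX (pdX (pdT u)) x t * pdX (pdX u) x t + pdT u x t * pdX (pdX θ) x t
    - pdX (pdX (pdT u)) x t * θ x t
    + pdX θ x t * (κ * pdX θ x (t - τ) + a * pdX θ x t)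
    + θ x t * (κ * pdX (pdX θ) x (t - τ) + a * pdX (pdX θ) x t)
  have hB : ∀ x, HasDerivAt B (B' x) x := by
    intro x
    have := (((((c1.dX x t).mul (c2.X.dX x t)).neg.add ((c1.X.dX x t).mul (c2.dX x t))).add
      ((c1.dX x t).mul (c6.dX x t))).sub ((c1.X.dX x t).mul (hθ.dX x t))).add
      ((hθ.dX x t).mul (((c6.dX x (t - τ)).const_mul κ).add ((c6.dX x t).const_mul a)))
    refine this.congr_deriv ?_
    simp only [B', Pi.add_apply]
    ring
  have hu0 : ∀ y, (∀ s, 0 ≤ s → u y s = 0) → pdT u y t = 0 := by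
    intro y hy
    have : (fun s => u y s) =ᶠ[nhds t] fun _ => 0 := by
      filter_upwards [lt_mem_nhds ht] with s hs using hy s hs.le
    unfold pdT
    rw [this.deriv_eq]
    simp
  have b0 := hu0 0 (fun s hs => (hsol.bc_u s hs).1)
  have bL := hu0 L (fun s hs => (hsol.bc_u s hs).2.1)
  have bc := hsol.bc_u t ht.le
  have bθ := hsol.bc_θ t (by linarith)
  have s1 := c1.comp (continuous_id (X := ℝ)) (continuous_const (y := t))
  have s2 := c2.comp (continuous_id (X := ℝ)) (continuous_const (y := t))
  have s3 := c3.comp (continuous_id (X := ℝ)) (continuous_const (y := t))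
  have s4 := c4.comp (continuous_id (X := ℝ)) (continuous_const (y := t))
  have s5 := c5.comp (continuous_id (X := ℝ)) (continuous_const (y := t))
  have s6 := hθ.comp (continuous_id (X := ℝ)) (continuous_const (y := t))
  have s7 := c6.comp (continuous_id (X := ℝ)) (continuous_const (y := t))
  have s8 := c6.comp (continuous_id (X := ℝ)) (continuous_const (y := t - τ))
  have s9 := c6.X.comp (continuous_id (X := ℝ)) (continuous_const (y := t))
  have s10 := c6.X.comp (continuous_id (X := ℝ)) (continuous_const (y := t - τ))
  have s11 := c2.X.X.comp (continuous_id (X := ℝ)) (continuous_const (y := t))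
  simp only [id] at s1 s2 s3 s4 s5 s6 s7 s8 s9 s10 s11
  have hB'c : Continuous B' := by
    simp only [B']
    fun_prop
  have hint : ∫ x in (0 : ℝ)..L, B' x = 0 := by
    rw [intervalIntegral.integral_eq_sub_of_hasDerivAt (fun x _ => hB x)
      (hB'c.intervalIntegrable _ _)]
    simp only [B, b0, bL, bc.2.2.1, bc.2.2.2, bθ.1, bθ.2]
    ring
  refine le_trans ?_ hint.le
  refine intervalIntegral.integral_mono_on_of_le_Ioo hL.le
    ?_ (hB'c.intervalIntegrable _ _) ?_
  · apply Continuous.intervalIntegrable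
    fun_prop
  intro x hx
  have p1 := hsol.pde_u x hx t ht
  have p2 := hsol.pde_θ x hx t ht
  have hq := quad_ineq τ a κ ξ hτ hκ hκa hξ₁ hξ₂ (pdX θ x t) (pdX θ x (t - τ))
  have e1 : pdT (pdT u) x t = - pdX (pdX (pdX (pdX u))) x t + pdX (pdX θ) x t := by linarith
  have e2 : pdT θ x t = κ * pdX (pdX θ) x (t - τ) + a * pdX (pdX θ) x t
      - pdX (pdX (pdT u)) x t := by linarith
  simp only [B']
  rw [e1, e2]
  linarith
end

section
/- Assume 0 < κ < a and that ξ lies in the open interval (τ(a − √(a²−κ²)), τ(a + √(a²−κ²))). Then there exist constants C > 0 and w > 0, depending only on L, a, κ, τ and ξ, such that every smooth solution (u,θ) of the thermoelastic beam with delayed heat conduction and coupling through θ_xx satisfies E(t) ≤ C·e^{−wt}·E(0) for all t ≥ 0. -/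
open MeasureTheory intervalIntegral

/-- Joint smoothness. -/
def SmoothXT (f : ℝ → ℝ → ℝ) : Prop := ContDiff ℝ (⊤ : ℕ∞) (fun p : ℝ × ℝ => f p.1 p.2)

namespace SmoothXT

variable {f : ℝ → ℝ → ℝ}

lemma hasFDerivAt (hf : SmoothXT f) (p : ℝ × ℝ) :
    HasFDerivAt (fun p : ℝ × ℝ => f p.1 p.2) (fderiv ℝ (fun p : ℝ × ℝ => f p.1 p.2) p) p :=
  ((ContDiff.differentiable hf (by simp)) p).hasFDerivAt

lemma hasDerivAt_x_aux (hf : SmoothXT f) (x t : ℝ) :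
    HasDerivAt (fun y => f y t) (fderiv ℝ (fun p : ℝ × ℝ => f p.1 p.2) (x, t) (1, 0)) x := by
  have h2 : HasDerivAt (fun y : ℝ => (y, t)) ((1 : ℝ), (0 : ℝ)) x :=
    (hasDerivAt_id x).prodMk (hasDerivAt_const x t)
  exact (hf.hasFDerivAt (x, t)).comp_hasDerivAt x h2

lemma hasDerivAt_t_aux (hf : SmoothXT f) (x t : ℝ) :
    HasDerivAt (fun s => f x s) (fderiv ℝ (fun p : ℝ × ℝ => f p.1 p.2) (x, t) (0, 1)) t := by
  have h2 : HasDerivAt (fun s : ℝ => (x, s)) ((0 : ℝ), (1 : ℝ)) t :=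
    (hasDerivAt_const t x).prodMk (hasDerivAt_id t)
  exact (hf.hasFDerivAt (x, t)).comp_hasDerivAt t h2

lemma pdX_eq (hf : SmoothXT f) (x t : ℝ) :
    pdX f x t = fderiv ℝ (fun p : ℝ × ℝ => f p.1 p.2) (x, t) (1, 0) :=
  (hf.hasDerivAt_x_aux x t).deriv

lemma pdT_eq (hf : SmoothXT f) (x t : ℝ) :
    pdT f x t = fderiv ℝ (fun p : ℝ × ℝ => f p.1 p.2) (x, t) (0, 1) :=
  (hf.hasDerivAt_t_aux x t).deriv

lemma dX (hf : SmoothXT f) (x t : ℝ) : HasDerivAt (fun y => f y t) (pdX f x t) x := by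
  rw [hf.pdX_eq]; exact hf.hasDerivAt_x_aux x t

lemma dT (hf : SmoothXT f) (x t : ℝ) : HasDerivAt (fun s => f x s) (pdT f x t) t := by
  rw [hf.pdT_eq]; exact hf.hasDerivAt_t_aux x t

lemma contDiff_fderiv (hf : SmoothXT f) :
    ContDiff ℝ (⊤ : ℕ∞) (fderiv ℝ (fun p : ℝ × ℝ => f p.1 p.2)) :=
  ContDiff.fderiv_right (m := ((⊤ : ℕ∞) : WithTop ℕ∞)) hf (by simp)

lemma sX (hf : SmoothXT f) : SmoothXT (pdX f) := by
  have : (fun p : ℝ × ℝ => pdX f p.1 p.2)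
      = fun p => fderiv ℝ (fun p : ℝ × ℝ => f p.1 p.2) p (1, 0) := by
    funext p; exact hf.pdX_eq p.1 p.2
  unfold SmoothXT
  rw [this]
  exact hf.contDiff_fderiv.clm_apply contDiff_const

lemma sT (hf : SmoothXT f) : SmoothXT (pdT f) := by
  have : (fun p : ℝ × ℝ => pdT f p.1 p.2)
      = fun p => fderiv ℝ (fun p : ℝ × ℝ => f p.1 p.2) p (0, 1) := by
    funext p; exact hf.pdT_eq p.1 p.2
  unfold SmoothXT
  rw [this]
  exact hf.contDiff_fderiv.clm_apply contDiff_const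

lemma comm (hf : SmoothXT f) (x t : ℝ) : pdX (pdT f) x t = pdT (pdX f) x t := by
  have hs : IsSymmSndFDerivAt ℝ (fun p : ℝ × ℝ => f p.1 p.2) (x, t) :=
    ContDiffAt.isSymmSndFDerivAt (n := ((⊤ : ℕ∞) : WithTop ℕ∞)) (ContDiff.contDiffAt hf)
      (by simp only [minSmoothness_of_isRCLikeNormedField]; exact WithTop.coe_le_coe.2 (le_top : (2 : ℕ∞) ≤ ⊤))
  have hd := (hf.contDiff_fderiv.differentiable (by simp) (x, t)).hasFDerivAt
  have e1 : (fun p : ℝ × ℝ => pdT f p.1 p.2)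
      = fun p => fderiv ℝ (fun p : ℝ × ℝ => f p.1 p.2) p (0, 1) := by
    funext p; exact hf.pdT_eq p.1 p.2
  have e2 : (fun p : ℝ × ℝ => pdX f p.1 p.2)
      = fun p => fderiv ℝ (fun p : ℝ × ℝ => f p.1 p.2) p (1, 0) := by
    funext p; exact hf.pdX_eq p.1 p.2
  rw [hf.sT.pdX_eq, hf.sX.pdT_eq, e1, e2]
  have h1 := (hd.clm_apply (hasFDerivAt_const ((0 : ℝ), (1 : ℝ)) (x, t))).fderiv
  have h2 := (hd.clm_apply (hasFDerivAt_const ((1 : ℝ), (0 : ℝ)) (x, t))).fderiv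
  rw [h1, h2]
  simpa using hs (1, 0) (0, 1)

lemma cont (hf : SmoothXT f) : Continuous (fun p : ℝ × ℝ => f p.1 p.2) := ContDiff.continuous hf

lemma cx (hf : SmoothXT f) (t : ℝ) : Continuous (fun x => f x t) :=
  hf.cont.comp (by fun_prop : Continuous fun x : ℝ => (x, t))

lemma ct (hf : SmoothXT f) (x : ℝ) : Continuous (fun t => f x t) :=
  hf.cont.comp (by fun_prop : Continuous fun t : ℝ => (x, t))

end SmoothXT

lemma hasDerivAt_int {F F' : ℝ → ℝ → ℝ} (hF : Continuous fun p : ℝ × ℝ => F p.1 p.2)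
    (hF' : Continuous fun p : ℝ × ℝ => F' p.1 p.2)
    (hd : ∀ x t, HasDerivAt (fun s => F x s) (F' x t) t) (a b t : ℝ) :
    HasDerivAt (fun s => ∫ x in a..b, F x s) (∫ x in a..b, F' x t) t := by
  obtain ⟨M, hM⟩ := (isCompact_uIcc (a := a) (b := b)).prod (isCompact_Icc (a := t - 1) (b := t + 1))
    |>.exists_bound_of_continuousOn hF'.continuousOn
  have hc : ∀ s, Continuous fun x => F x s := fun s =>
    hF.comp (by fun_prop : Continuous fun x : ℝ => (x, s))
  have hc' : ∀ s, Continuous fun x => F' x s := fun s =>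
    hF'.comp (by fun_prop : Continuous fun x : ℝ => (x, s))
  refine (intervalIntegral.hasDerivAt_integral_of_dominated_loc_of_deriv_le (μ := volume)
    (F := fun s x => F x s) (F' := fun s x => F' x s) (bound := fun _ => M)
    (s := Set.Icc (t - 1) (t + 1)) (Icc_mem_nhds (by linarith) (by linarith))
    (Filter.Eventually.of_forall fun s => (hc s).aestronglyMeasurable)
    ((hc t).intervalIntegrable _ _) (hc' t).aestronglyMeasurable
    (Filter.Eventually.of_forall fun x hx s hs => ?_)
    (continuous_const.intervalIntegrable _ _)
    (Filter.Eventually.of_forall fun x _ s _ => hd x s)).2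
  exact hM (x, s) ⟨Set.uIoc_subset_uIcc hx, hs⟩

/-- Integration by parts with one function vanishing at the ends. -/
lemma ibp1 {f f' g g' : ℝ → ℝ} {L : ℝ} (hf : ∀ x, HasDerivAt f (f' x) x)
    (hg : ∀ x, HasDerivAt g (g' x) x) (cf : Continuous f') (cg : Continuous g')
    (g0 : g 0 = 0) (gL : g L = 0) :
    ∫ x in (0 : ℝ)..L, f' x * g x = - ∫ x in (0 : ℝ)..L, f x * g' x := by
  have := intervalIntegral.integral_mul_deriv_eq_deriv_mul (a := 0) (b := L)
    (fun x _ => hf x) (fun x _ => hg x)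
    (cf.intervalIntegrable _ _) (cg.intervalIntegrable _ _)
  rw [this, g0, gL]; ring

lemma ibp2 {f f' f'' g g' g'' : ℝ → ℝ} {L : ℝ} (hf : ∀ x, HasDerivAt f (f' x) x)
    (hf' : ∀ x, HasDerivAt f' (f'' x) x)
    (hg : ∀ x, HasDerivAt g (g' x) x) (hg' : ∀ x, HasDerivAt g' (g'' x) x)
    (cf : Continuous f'') (cg : Continuous g'')
    (f0 : f 0 = 0) (fL : f L = 0) (g0 : g 0 = 0) (gL : g L = 0) :
    ∫ x in (0 : ℝ)..L, f'' x * g x = ∫ x in (0 : ℝ)..L, f x * g'' x := by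
  have cf1 : Continuous f' := continuous_iff_continuousAt.2 fun x => (hf' x).continuousAt
  have cg1 : Continuous g' := continuous_iff_continuousAt.2 fun x => (hg' x).continuousAt
  have h1 := ibp1 hf' hg cf cg1 g0 gL
  have h2 := ibp1 hg' hf cg cf1 f0 fL
  rw [h1]
  have e1 : ∫ x in (0 : ℝ)..L, f x * g'' x = ∫ x in (0 : ℝ)..L, g'' x * f x := by
    congr 1; funext x; ring
  have e2 : ∫ x in (0 : ℝ)..L, g' x * f' x = ∫ x in (0 : ℝ)..L, f' x * g' x := by
    congr 1; funext x; ring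
  rw [e1, h2, e2]

lemma poin1 {f f' : ℝ → ℝ} {L : ℝ} (hL : 0 < L) (hf : ∀ x, HasDerivAt f (f' x) x)
    (cf : Continuous f') (f0 : f 0 = 0) :
    ∫ x in (0 : ℝ)..L, f x ^ 2 ≤ L ^ 2 * ∫ x in (0 : ℝ)..L, f' x ^ 2 := by
  have cff : Continuous f := continuous_iff_continuousAt.2 fun x => (hf x).continuousAt
  set I := ∫ x in (0 : ℝ)..L, f' x ^ 2 with hI
  have key : ∀ x ∈ Set.Icc 0 L, f x ^ 2 ≤ L * I := by
    intro x hx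
    have h1 : ∫ y in (0 : ℝ)..x, f' y = f x := by
      rw [intervalIntegral.integral_eq_sub_of_hasDerivAt (fun y _ => hf y)
        (cf.intervalIntegrable _ _), f0, sub_zero]
    have h2 : ∫ y in (0 : ℝ)..x, f' y ^ 2 ≤ I := by
      refine intervalIntegral.integral_mono_interval le_rfl hx.1 hx.2
        (Filter.Eventually.of_forall fun y => sq_nonneg _) ((cf.pow 2).intervalIntegrable _ _)
    have h3 : 0 ≤ ∫ y in (0 : ℝ)..x, (f' y - f x / L) ^ 2 :=
      intervalIntegral.integral_nonneg hx.1 fun y _ => sq_nonneg _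
    have h4 : ∫ y in (0 : ℝ)..x, (f' y - f x / L) ^ 2
        = (∫ y in (0 : ℝ)..x, f' y ^ 2) - 2 * (f x / L) * f x + x * (f x / L) ^ 2 := by
      have : ∀ y, (f' y - f x / L) ^ 2
          = f' y ^ 2 - 2 * (f x / L) * f' y + (f x / L) ^ 2 := fun y => by ring
      simp only [this]
      rw [intervalIntegral.integral_add, intervalIntegral.integral_sub,
        intervalIntegral.integral_const_mul, h1, intervalIntegral.integral_const]
      · simp
      all_goals exact Continuous.intervalIntegrable (by fun_prop) _ _
    have h5 : x * (f x / L) ^ 2 ≤ L * (f x / L) ^ 2 :=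
      mul_le_mul_of_nonneg_right hx.2 (sq_nonneg _)
    have h6 : L * (f x / L) ^ 2 = f x ^ 2 / L := by field_simp
    have h7 : 2 * (f x / L) * f x = 2 * (f x ^ 2 / L) := by ring
    have h8 : f x ^ 2 / L ≤ I := by linarith
    rw [div_le_iff₀ hL] at h8
    linarith
  have : ∫ x in (0 : ℝ)..L, f x ^ 2 ≤ ∫ _ in (0 : ℝ)..L, L * I :=
    intervalIntegral.integral_mono_on hL.le ((cff.pow 2).intervalIntegrable _ _)
    ((continuous_const (y := L * I)).intervalIntegrable (μ := volume) 0 L) key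
  rw [intervalIntegral.integral_const] at this
  simp only [sub_zero, smul_eq_mul] at this
  linarith

lemma int_mul_le {f g : ℝ → ℝ} {L : ℝ} (hL : 0 < L) (cf : Continuous f) (cg : Continuous g)
    {c : ℝ} (hc : 0 < c) :
    |∫ x in (0 : ℝ)..L, f x * g x| ≤ c / 2 * (∫ x in (0 : ℝ)..L, f x ^ 2)
      + 1 / (2 * c) * ∫ x in (0 : ℝ)..L, g x ^ 2 := by
  have e : c / 2 * (∫ x in (0 : ℝ)..L, f x ^ 2) + 1 / (2 * c) * (∫ x in (0 : ℝ)..L, g x ^ 2)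
      = ∫ x in (0 : ℝ)..L, (c / 2 * f x ^ 2 + 1 / (2 * c) * g x ^ 2) := by
    rw [intervalIntegral.integral_add, intervalIntegral.integral_const_mul,
      intervalIntegral.integral_const_mul]
    all_goals exact Continuous.intervalIntegrable (by fun_prop) _ _
  rw [e]
  refine (intervalIntegral.abs_integral_le_integral_abs hL.le).trans ?_
  refine intervalIntegral.integral_mono_on hL.le
    (Continuous.intervalIntegrable (by fun_prop) _ _)
    (Continuous.intervalIntegrable (by fun_prop) _ _) fun x _ => ?_
  have h1 : c / 2 * f x ^ 2 + 1 / (2 * c) * g x ^ 2 - f x * g x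
      = (c * f x - g x) ^ 2 / (2 * c) := by field_simp; ring
  have h2 : c / 2 * f x ^ 2 + 1 / (2 * c) * g x ^ 2 + f x * g x
      = (c * f x + g x) ^ 2 / (2 * c) := by field_simp; ring
  have h3 : 0 ≤ (c * f x - g x) ^ 2 / (2 * c) := by positivity
  have h4 : 0 ≤ (c * f x + g x) ^ 2 / (2 * c) := by positivity
  rw [abs_le]; constructor <;> linarith

lemma poin2 {f f' f'' : ℝ → ℝ} {L : ℝ} (hL : 0 < L) (hf : ∀ x, HasDerivAt f (f' x) x)
    (hf' : ∀ x, HasDerivAt f' (f'' x) x)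
    (cf : Continuous f'') (f0 : f 0 = 0) (fL : f L = 0) :
    ∫ x in (0 : ℝ)..L, f x ^ 2 ≤ L ^ 4 * ∫ x in (0 : ℝ)..L, f'' x ^ 2 := by
  have cf1 : Continuous f' := continuous_iff_continuousAt.2 fun x => (hf' x).continuousAt
  have cff : Continuous f := continuous_iff_continuousAt.2 fun x => (hf x).continuousAt
  have h1 := poin1 hL hf cf1 f0
  have h2 := ibp1 hf' hf cf cf1 f0 fL
  have e : ∫ x in (0 : ℝ)..L, f' x * f' x = ∫ x in (0 : ℝ)..L, f' x ^ 2 := by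
    congr 1; funext x; ring
  rw [e] at h2
  have h3 := int_mul_le hL cf cff (c := L ^ 2) (by positivity)
  rw [h2, abs_neg] at h3
  have h4 := (le_abs_self _).trans h3
  have h5 : 1 / (2 * L ^ 2) * (∫ x in (0 : ℝ)..L, f x ^ 2)
      ≤ 1 / (2 * L ^ 2) * (L ^ 2 * ∫ x in (0 : ℝ)..L, f' x ^ 2) :=
    mul_le_mul_of_nonneg_left h1 (by positivity)
  have h6 : 1 / (2 * L ^ 2) * (L ^ 2 * ∫ x in (0 : ℝ)..L, f' x ^ 2)
      = 1 / 2 * ∫ x in (0 : ℝ)..L, f' x ^ 2 := by field_simp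
  have h7 : (∫ x in (0 : ℝ)..L, f' x ^ 2) ≤ L ^ 2 * ∫ x in (0 : ℝ)..L, f'' x ^ 2 := by linarith
  calc _ ≤ _ := h1
    _ ≤ L ^ 2 * (L ^ 2 * ∫ x in (0 : ℝ)..L, f'' x ^ 2) :=
        mul_le_mul_of_nonneg_left h7 (by positivity)
    _ = _ := by ring

/-- Dirichlet Green operator for `-d²/dx²` on `(0, L)`. -/
noncomputable def grn (L : ℝ) (f : ℝ → ℝ) (x : ℝ) : ℝ :=
  -(x * (∫ y in (0 : ℝ)..x, f y) - ∫ y in (0 : ℝ)..x, y * f y)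
    + x / L * (L * (∫ y in (0 : ℝ)..L, f y) - ∫ y in (0 : ℝ)..L, y * f y)

noncomputable def grn1 (L : ℝ) (f : ℝ → ℝ) (x : ℝ) : ℝ :=
  -(∫ y in (0 : ℝ)..x, f y)
    + 1 / L * (L * (∫ y in (0 : ℝ)..L, f y) - ∫ y in (0 : ℝ)..L, y * f y)

lemma grn_zero (L : ℝ) (f : ℝ → ℝ) : grn L f 0 = 0 := by simp [grn]

lemma grn_L {L : ℝ} (hL : 0 < L) (f : ℝ → ℝ) : grn L f L = 0 := by
  simp [grn, hL.ne']

lemma grn_deriv {L : ℝ} {f : ℝ → ℝ} (cf : Continuous f) (x : ℝ) :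
    HasDerivAt (grn L f) (grn1 L f x) x := by
  have h1 : HasDerivAt (fun x => ∫ y in (0 : ℝ)..x, f y) (f x) x :=
    intervalIntegral.integral_hasDerivAt_right (cf.intervalIntegrable _ _)
      (cf.stronglyMeasurableAtFilter _ _) cf.continuousAt
  have c2 : Continuous fun y => y * f y := by fun_prop
  have h2 : HasDerivAt (fun x => ∫ y in (0 : ℝ)..x, y * f y) (x * f x) x :=
    intervalIntegral.integral_hasDerivAt_right (c2.intervalIntegrable _ _)
      (c2.stronglyMeasurableAtFilter _ _) c2.continuousAt
  have := ((((hasDerivAt_id x).mul h1).sub h2).neg).add (((hasDerivAt_id x).div_const L).mul_const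
    (L * (∫ y in (0 : ℝ)..L, f y) - ∫ y in (0 : ℝ)..L, y * f y))
  refine this.congr_deriv ?_
  simp only [grn1, id]
  ring

lemma grn_deriv1 {L : ℝ} {f : ℝ → ℝ} (cf : Continuous f) (x : ℝ) :
    HasDerivAt (grn1 L f) (-f x) x := by
  have h1 : HasDerivAt (fun x => ∫ y in (0 : ℝ)..x, f y) (f x) x :=
    intervalIntegral.integral_hasDerivAt_right (cf.intervalIntegrable _ _)
      (cf.stronglyMeasurableAtFilter _ _) cf.continuousAt
  exact h1.neg.add_const _

lemma grn_unique {L : ℝ} (hL : 0 < L) {f f' f'' q : ℝ → ℝ} (hf : ∀ x, HasDerivAt f (f' x) x)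
    (hf' : ∀ x, HasDerivAt f' (f'' x) x) (cf : Continuous f'')
    (hq : ∀ x ∈ Set.Icc 0 L, q x = - f'' x)
    (f0 : f 0 = 0) (fL : f L = 0) {x : ℝ} (hx : x ∈ Set.Icc 0 L) : grn L q x = f x := by
  have A : ∀ z ∈ Set.Icc 0 L, ∫ y in (0 : ℝ)..z, q y = -(f' z - f' 0) := by
    intro z hz
    rw [← intervalIntegral.integral_eq_sub_of_hasDerivAt (fun y _ => hf' y)
      (cf.intervalIntegrable _ _), ← intervalIntegral.integral_neg]
    refine intervalIntegral.integral_congr fun y hy => ?_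
    rw [Set.uIcc_of_le hz.1] at hy
    exact hq y ⟨hy.1, hy.2.trans hz.2⟩
  have B : ∀ z ∈ Set.Icc 0 L, ∫ y in (0 : ℝ)..z, y * q y = -(z * f' z - f z) := by
    intro z hz
    have hd : ∀ y ∈ Set.uIcc 0 z, HasDerivAt (fun y => y * f' y - f y) (y * f'' y) y := by
      intro y _
      refine (((hasDerivAt_id y).mul (hf' y)).sub (hf y)).congr_deriv ?_
      simp
    have c2 : Continuous fun y => y * f'' y := by fun_prop
    have := intervalIntegral.integral_eq_sub_of_hasDerivAt hd (c2.intervalIntegrable _ _)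
    have e : -(z * f' z - f z) = -∫ y in (0 : ℝ)..z, y * f'' y := by rw [this, f0]; ring
    rw [e, ← intervalIntegral.integral_neg]
    refine intervalIntegral.integral_congr fun y hy => ?_
    rw [Set.uIcc_of_le hz.1] at hy
    simp only [hq y ⟨hy.1, hy.2.trans hz.2⟩]
    ring
  have hLL : L ∈ Set.Icc 0 L := ⟨hL.le, le_rfl⟩
  unfold grn
  rw [A x hx, B x hx, A L hLL, B L hLL, fL]
  field_simp
  ring

lemma cont_int {f : ℝ → ℝ → ℝ} (hf : Continuous fun p : ℝ × ℝ => f p.1 p.2) :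
    Continuous fun p : ℝ × ℝ => ∫ y in (0 : ℝ)..p.1, f y p.2 := by
  refine intervalIntegral.continuous_parametric_intervalIntegral_of_continuous
    (f := fun (p : ℝ × ℝ) y => f y p.2) ?_ continuous_fst
  exact hf.comp (by fun_prop : Continuous fun q : (ℝ × ℝ) × ℝ => (q.2, q.1.2))

lemma grn_cont {L : ℝ} {f : ℝ → ℝ → ℝ} (hf : Continuous fun p : ℝ × ℝ => f p.1 p.2) :
    Continuous fun p : ℝ × ℝ => grn L (fun y => f y p.2) p.1 := by
  have h2 : Continuous fun p : ℝ × ℝ => p.1 * f p.1 p.2 := continuous_fst.mul hf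
  have a1 := cont_int hf
  have a2 := cont_int (f := fun x t => x * f x t) h2
  have b1 : Continuous fun p : ℝ × ℝ => ∫ y in (0 : ℝ)..L, f y p.2 :=
    a1.comp (by fun_prop : Continuous fun p : ℝ × ℝ => (L, p.2))
  have b2 : Continuous fun p : ℝ × ℝ => ∫ y in (0 : ℝ)..L, y * f y p.2 :=
    a2.comp (by fun_prop : Continuous fun p : ℝ × ℝ => (L, p.2))
  unfold grn
  simp only [div_eq_mul_inv]
  exact ((continuous_fst.mul a1).sub a2).neg.add
    ((continuous_fst.mul continuous_const).mul ((continuous_const.mul b1).sub b2))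

lemma grn_dT {L : ℝ} {f : ℝ → ℝ → ℝ} (hf : SmoothXT f) (x t : ℝ) :
    HasDerivAt (fun s => grn L (fun y => f y s) x) (grn L (fun y => pdT f y t) x) t := by
  have a1 : ∀ z, HasDerivAt (fun s => ∫ y in (0 : ℝ)..z, f y s)
      (∫ y in (0 : ℝ)..z, pdT f y t) t := fun z =>
    hasDerivAt_int hf.cont hf.sT.cont hf.dT 0 z t
  have a2 : ∀ z, HasDerivAt (fun s => ∫ y in (0 : ℝ)..z, y * f y s)
      (∫ y in (0 : ℝ)..z, y * pdT f y t) t := fun z =>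
    hasDerivAt_int (F := fun y s => y * f y s) (F' := fun y s => y * pdT f y s)
      (continuous_fst.mul hf.cont) (continuous_fst.mul hf.sT.cont)
      (fun y s => (hf.dT y s).const_mul y) 0 z t
  exact (((a1 x).const_mul x).sub (a2 x)).neg.add
    ((((a1 L).const_mul L).sub (a2 L)).const_mul (x / L))

lemma int6 {f1 f2 f3 f4 f5 f6 : ℝ → ℝ} (h1 : Continuous f1) (h2 : Continuous f2)
    (h3 : Continuous f3) (h4 : Continuous f4) (h5 : Continuous f5) (h6 : Continuous f6)
    (c1 c2 c3 c4 c5 c6 L : ℝ) :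
    ∫ x in (0 : ℝ)..L, (c1 * f1 x + c2 * f2 x + c3 * f3 x + c4 * f4 x + c5 * f5 x + c6 * f6 x)
    = c1 * (∫ x in (0 : ℝ)..L, f1 x) + c2 * (∫ x in (0 : ℝ)..L, f2 x)
      + c3 * (∫ x in (0 : ℝ)..L, f3 x) + c4 * (∫ x in (0 : ℝ)..L, f4 x)
      + c5 * (∫ x in (0 : ℝ)..L, f5 x) + c6 * (∫ x in (0 : ℝ)..L, f6 x) := by
  rw [intervalIntegral.integral_add, intervalIntegral.integral_add, intervalIntegral.integral_add,
    intervalIntegral.integral_add, intervalIntegral.integral_add]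
  · simp only [intervalIntegral.integral_const_mul]
  all_goals exact Continuous.intervalIntegrable (by fun_prop) _ _

namespace IsSmoothSolDHBeamXX

variable {L τ a κ : ℝ} {u θ : ℝ → ℝ → ℝ}

lemma su (h : IsSmoothSolDHBeamXX L τ a κ u θ) : SmoothXT u := h.smooth_u
lemma sθ (h : IsSmoothSolDHBeamXX L τ a κ u θ) : SmoothXT θ := h.smooth_θ

lemma eq_of_Ioo {F : ℝ → ℝ} (hL : 0 < L) (hF : Continuous F) (h0 : ∀ x ∈ Set.Ioo 0 L, F x = 0)
    {x : ℝ} (hx : x ∈ Set.Icc 0 L) : F x = 0 := by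
  have hc : IsClosed {x | F x = 0} := isClosed_eq hF continuous_const
  have : closure (Set.Ioo 0 L) ⊆ {x | F x = 0} := hc.closure_subset_iff.2 h0
  rw [closure_Ioo hL.ne] at this
  exact this hx

lemma pu (h : IsSmoothSolDHBeamXX L τ a κ u θ) (hL : 0 < L) {x t : ℝ} (hx : x ∈ Set.Icc 0 L)
    (ht : 0 < t) :
    pdT (pdT u) x t = - pdX (pdX (pdX (pdX u))) x t + pdX (pdX θ) x t := by
  have c1 := h.su.sT.sT.cx t
  have c2 := h.su.sX.sX.sX.sX.cx t
  have c3 := h.sθ.sX.sX.cx t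
  have := eq_of_Ioo hL ((c1.add c2).sub c3) (fun x hx => h.pde_u x hx t ht) hx
  simp only [Pi.add_apply, Pi.sub_apply] at this
  linarith

lemma pθ (h : IsSmoothSolDHBeamXX L τ a κ u θ) (hL : 0 < L) {x t : ℝ} (hx : x ∈ Set.Icc 0 L)
    (ht : 0 < t) :
    pdT θ x t = κ * pdX (pdX θ) x (t - τ) + a * pdX (pdX θ) x t - pdX (pdX (pdT u)) x t := by
  have c1 := h.sθ.sT.cx t
  have c2 := h.sθ.sX.sX.cx (t - τ)
  have c3 := h.sθ.sX.sX.cx t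
  have c4 := h.su.sT.sX.sX.cx t
  have := eq_of_Ioo hL (((c1.sub (c2.const_mul κ)).sub (c3.const_mul a)).add c4)
    (fun x hx => h.pde_θ x hx t ht) hx
  simp only [Pi.add_apply, Pi.sub_apply] at this
  linarith

lemma ut_zero {f : ℝ → ℝ → ℝ} (x : ℝ) (h0 : ∀ t, 0 ≤ t → f x t = 0) {t : ℝ}
    (ht : 0 < t) : pdT f x t = 0 := by
  have : (fun s => f x s) =ᶠ[nhds t] fun _ => 0 := by
    filter_upwards [Ioi_mem_nhds ht] with s hs using h0 s (le_of_lt hs)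
  unfold pdT
  rw [this.deriv_eq]; simp

lemma energy_int (h : IsSmoothSolDHBeamXX L τ a κ u θ) (hL : 0 < L) (hτ : 0 < τ) {t : ℝ}
    (ht : 0 < t) :
    HasDerivAt (fun t => ∫ x in (0 : ℝ)..L, ((pdT u x t) ^ 2 + (pdX (pdX u) x t) ^ 2 + (θ x t) ^ 2))
      (-2 * a * (∫ x in (0 : ℝ)..L, (pdX θ x t) ^ 2)
        - 2 * κ * ∫ x in (0 : ℝ)..L, pdX θ x (t - τ) * pdX θ x t) t := by
  have s1 := h.su.sT
  have s2 := h.su.sX.sX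
  have s3 := h.sθ
  have hd := hasDerivAt_int
    (F := fun x t => (pdT u x t) ^ 2 + (pdX (pdX u) x t) ^ 2 + (θ x t) ^ 2)
    (F' := fun x t => 2 * pdT u x t * pdT (pdT u) x t
      + 2 * pdX (pdX u) x t * pdT (pdX (pdX u)) x t + 2 * θ x t * pdT θ x t)
    (((s1.cont.pow 2).add (s2.cont.pow 2)).add (s3.cont.pow 2))
    ((((s1.cont.const_mul 2).mul s1.sT.cont).add ((s2.cont.const_mul 2).mul s2.sT.cont)).add
      ((s3.cont.const_mul 2).mul s3.sT.cont))
    (fun x t => by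
      refine ((((s1.dT x t).pow 2).add ((s2.dT x t).pow 2)).add ((s3.dT x t).pow 2)).congr_deriv ?_
      simp) 0 L t
  refine hd.congr_deriv ?_
  have e : ∫ x in (0 : ℝ)..L, (2 * pdT u x t * pdT (pdT u) x t
      + 2 * pdX (pdX u) x t * pdT (pdX (pdX u)) x t + 2 * θ x t * pdT θ x t)
      = ∫ x in (0 : ℝ)..L, ((-2) * (pdX (pdX (pdX (pdX u))) x t * pdT u x t)
        + 2 * (pdX (pdX θ) x t * pdT u x t) + 2 * (pdX (pdX u) x t * pdX (pdX (pdT u)) x t)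
        + (2 * κ) * (pdX (pdX θ) x (t - τ) * θ x t) + (2 * a) * (pdX (pdX θ) x t * θ x t)
        + (-2) * (θ x t * pdX (pdX (pdT u)) x t)) := by
    refine intervalIntegral.integral_congr fun x hx => ?_
    rw [Set.uIcc_of_le hL.le] at hx
    have e2 : pdT (pdX (pdX u)) x t = pdX (pdX (pdT u)) x t := by
      rw [← h.su.sX.comm]
      have : pdX (pdT u) = pdT (pdX u) := by funext x t; exact h.su.comm x t
      rw [this]
    simp only [h.pu hL hx ht, h.pθ hL hx ht, e2]
    ring
  have k1 := s1.cx t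
  have k2 := s2.cx t
  have k3 := s3.cx t
  have k4 := s2.sX.sX.cx t
  have k5 := s3.sX.sX.cx t
  have k6 := s3.sX.sX.cx (t - τ)
  have k7 := s1.sX.sX.cx t
  have i0 := int6 (k4.mul k1) (k5.mul k1) (k2.mul k7) (k6.mul k3) (k5.mul k3) (k3.mul k7)
    (-2) 2 2 (2 * κ) (2 * a) (-2) L
  simp only [Pi.mul_apply, Pi.pow_apply] at i0
  rw [e, i0]
  obtain ⟨u0, uL, w0, wL⟩ := h.bc_u t ht.le
  obtain ⟨t0, tL⟩ := h.bc_θ t (by linarith)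
  have v0 : pdT u 0 t = 0 := ut_zero 0 (fun s hs => (h.bc_u s hs).1) ht
  have vL : pdT u L t = 0 := ut_zero L (fun s hs => (h.bc_u s hs).2.1) ht
  have i1 : ∫ x in (0 : ℝ)..L, pdX (pdX (pdX (pdX u))) x t * pdT u x t
      = ∫ x in (0 : ℝ)..L, pdX (pdX u) x t * pdX (pdX (pdT u)) x t :=
    ibp2 (fun x => s2.dX x t) (fun x => s2.sX.dX x t) (fun x => s1.dX x t)
      (fun x => s1.sX.dX x t) k4 k7 w0 wL v0 vL
  have i2 : ∫ x in (0 : ℝ)..L, pdX (pdX θ) x t * pdT u x t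
      = ∫ x in (0 : ℝ)..L, θ x t * pdX (pdX (pdT u)) x t :=
    ibp2 (fun x => s3.dX x t) (fun x => s3.sX.dX x t) (fun x => s1.dX x t)
      (fun x => s1.sX.dX x t) k5 k7 t0 tL v0 vL
  have i3 : ∫ x in (0 : ℝ)..L, pdX (pdX θ) x (t - τ) * θ x t
      = - ∫ x in (0 : ℝ)..L, pdX θ x (t - τ) * pdX θ x t :=
    ibp1 (fun x => s3.sX.dX x (t - τ)) (fun x => s3.dX x t) k6 (s3.sX.cx t) t0 tL
  have i4 : ∫ x in (0 : ℝ)..L, pdX (pdX θ) x t * θ x t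
      = - ∫ x in (0 : ℝ)..L, pdX θ x t * pdX θ x t :=
    ibp1 (fun x => s3.sX.dX x t) (fun x => s3.dX x t) k5 (s3.sX.cx t) t0 tL
  have i5 : ∫ x in (0 : ℝ)..L, pdX θ x t * pdX θ x t = ∫ x in (0 : ℝ)..L, (pdX θ x t) ^ 2 := by
    congr 1; funext x; ring
  rw [i1, i2, i3, i4, i5]
  ring

lemma J_int (h : IsSmoothSolDHBeamXX L τ a κ u θ) (hL : 0 < L) (hτ : 0 < τ) {t : ℝ}
    (ht : 0 < t) :
    HasDerivAt (fun t => ∫ x in (0 : ℝ)..L, pdT u x t * u x t)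
      ((∫ x in (0 : ℝ)..L, (pdT u x t) ^ 2) - (∫ x in (0 : ℝ)..L, (pdX (pdX u) x t) ^ 2)
        + ∫ x in (0 : ℝ)..L, θ x t * pdX (pdX u) x t) t := by
  have s0 := h.su
  have s1 := h.su.sT
  have s2 := h.su.sX.sX
  have s3 := h.sθ
  have hd := hasDerivAt_int
    (F := fun x t => pdT u x t * u x t)
    (F' := fun x t => pdT (pdT u) x t * u x t + pdT u x t * pdT u x t)
    (s1.cont.mul s0.cont)
    ((s1.sT.cont.mul s0.cont).add (s1.cont.mul s1.cont))
    (fun x t => (s1.dT x t).mul (s0.dT x t)) 0 L t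
  refine hd.congr_deriv ?_
  have e : ∫ x in (0 : ℝ)..L, (pdT (pdT u) x t * u x t + pdT u x t * pdT u x t)
      = ∫ x in (0 : ℝ)..L, ((-1) * (pdX (pdX (pdX (pdX u))) x t * u x t)
        + 1 * (pdX (pdX θ) x t * u x t) + 1 * (pdT u x t ^ 2)
        + 0 * u x t + 0 * u x t + 0 * u x t) := by
    refine intervalIntegral.integral_congr fun x hx => ?_
    rw [Set.uIcc_of_le hL.le] at hx
    simp only [h.pu hL hx ht]
    ring
  have k0 := s0.cx t
  have k1 := s1.cx t
  have k2 := s2.cx t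
  have k3 := s3.cx t
  have k4 := s2.sX.sX.cx t
  have k5 := s3.sX.sX.cx t
  have i0 := int6 (k4.mul k0) (k5.mul k0) (k1.pow 2) k0 k0 k0
    (-1) 1 1 0 0 0 L
  simp only [Pi.mul_apply, Pi.pow_apply] at i0
  rw [e, i0]
  obtain ⟨u0, uL, w0, wL⟩ := h.bc_u t ht.le
  obtain ⟨t0, tL⟩ := h.bc_θ t (by linarith)
  have i1 : ∫ x in (0 : ℝ)..L, pdX (pdX (pdX (pdX u))) x t * u x t
      = ∫ x in (0 : ℝ)..L, pdX (pdX u) x t * pdX (pdX u) x t :=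
    ibp2 (fun x => s2.dX x t) (fun x => s2.sX.dX x t) (fun x => s0.dX x t)
      (fun x => s0.sX.dX x t) k4 k2 w0 wL u0 uL
  have i2 : ∫ x in (0 : ℝ)..L, pdX (pdX θ) x t * u x t
      = ∫ x in (0 : ℝ)..L, θ x t * pdX (pdX u) x t :=
    ibp2 (fun x => s3.dX x t) (fun x => s3.sX.dX x t) (fun x => s0.dX x t)
      (fun x => s0.sX.dX x t) k5 k2 t0 tL u0 uL
  have i5 : ∫ x in (0 : ℝ)..L, pdX (pdX u) x t * pdX (pdX u) x t
      = ∫ x in (0 : ℝ)..L, (pdX (pdX u) x t) ^ 2 := by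
    congr 1; funext x; ring
  rw [i1, i2, i5]
  ring

lemma J_diff (h : IsSmoothSolDHBeamXX L τ a κ u θ) (t : ℝ) :
    DifferentiableAt ℝ (fun t => ∫ x in (0 : ℝ)..L, pdT u x t * u x t) t := by
  have s0 := h.su
  have s1 := h.su.sT
  exact (hasDerivAt_int
    (F := fun x t => pdT u x t * u x t)
    (F' := fun x t => pdT (pdT u) x t * u x t + pdT u x t * pdT u x t)
    (s1.cont.mul s0.cont)
    ((s1.sT.cont.mul s0.cont).add (s1.cont.mul s1.cont))
    (fun x t => (s1.dT x t).mul (s0.dT x t)) 0 L t).differentiableAt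

lemma energy_cont (h : IsSmoothSolDHBeamXX L τ a κ u θ) :
    Continuous (fun t => ∫ x in (0 : ℝ)..L,
      ((pdT u x t) ^ 2 + (pdX (pdX u) x t) ^ 2 + (θ x t) ^ 2)) := by
  have s1 := h.su.sT
  have s2 := h.su.sX.sX
  have s3 := h.sθ
  have := cont_int (f := fun x t => (pdT u x t) ^ 2 + (pdX (pdX u) x t) ^ 2 + (θ x t) ^ 2)
    (((s1.cont.pow 2).add (s2.cont.pow 2)).add (s3.cont.pow 2))
  exact this.comp (by fun_prop : Continuous fun t : ℝ => (L, t))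

lemma K_cont (h : IsSmoothSolDHBeamXX L τ a κ u θ) :
    Continuous (fun t => ∫ x in (0 : ℝ)..L, θ x t * grn L (fun y => pdT u y t) x) := by
  have := cont_int (f := fun x t => θ x t * grn L (fun y => pdT u y t) x)
    (h.sθ.cont.mul (grn_cont h.su.sT.cont))
  exact this.comp (by fun_prop : Continuous fun t : ℝ => (L, t))

lemma K_int (h : IsSmoothSolDHBeamXX L τ a κ u θ) (hL : 0 < L) (hτ : 0 < τ) {t : ℝ}
    (ht : 0 < t) :
    HasDerivAt (fun t => ∫ x in (0 : ℝ)..L, θ x t * grn L (fun y => pdT u y t) x)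
      ((∫ x in (0 : ℝ)..L, (pdT u x t) ^ 2) - κ * (∫ x in (0 : ℝ)..L, θ x (t - τ) * pdT u x t)
        - a * (∫ x in (0 : ℝ)..L, θ x t * pdT u x t)
        + (∫ x in (0 : ℝ)..L, θ x t * pdX (pdX u) x t) - ∫ x in (0 : ℝ)..L, θ x t ^ 2) t := by
  have s0 := h.su
  have s1 := h.su.sT
  have s2 := h.su.sX.sX
  have s3 := h.sθ
  have hd := hasDerivAt_int
    (F := fun x t => θ x t * grn L (fun y => pdT u y t) x)
    (F' := fun x t => pdT θ x t * grn L (fun y => pdT u y t) x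
      + θ x t * grn L (fun y => pdT (pdT u) y t) x)
    (s3.cont.mul (grn_cont s1.cont))
    ((s3.sT.cont.mul (grn_cont s1.cont)).add (s3.cont.mul (grn_cont s1.sT.cont)))
    (fun x t => (s3.dT x t).mul (grn_dT s1 x t)) 0 L t
  refine hd.congr_deriv ?_
  obtain ⟨u0, uL, w0, wL⟩ := h.bc_u t ht.le
  obtain ⟨t0, tL⟩ := h.bc_θ t (by linarith)
  obtain ⟨r0, rL⟩ := h.bc_θ (t - τ) (by linarith)
  have v0 : pdT u 0 t = 0 := ut_zero 0 (fun s hs => (h.bc_u s hs).1) ht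
  have vL : pdT u L t = 0 := ut_zero L (fun s hs => (h.bc_u s hs).2.1) ht
  have k0 := s0.cx t
  have k1 := s1.cx t
  have k2 := s2.cx t
  have k3 := s3.cx t
  have k4 := s2.sX.sX.cx t
  have k5 := s3.sX.sX.cx t
  have k6 := s3.sX.sX.cx (t - τ)
  have k7 := s1.sX.sX.cx t
  have hv : ∀ x ∈ Set.Icc 0 L, grn L (fun y => pdT (pdT u) y t) x = pdX (pdX u) x t - θ x t := by
    intro x hx
    refine grn_unique hL (f := fun x => pdX (pdX u) x t - θ x t)
      (fun x => (s2.dX x t).sub (s3.dX x t)) (fun x => (s2.sX.dX x t).sub (s3.sX.dX x t))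
      (k4.sub k5) (fun x hx => ?_) (by simp [w0, t0]) (by simp [wL, tL]) hx
    rw [h.pu hL hx ht]; ring
  set v : ℝ → ℝ := grn L (fun y => pdT u y t) with hvdef
  have dv : ∀ x, HasDerivAt v (grn1 L (fun y => pdT u y t) x) x := grn_deriv k1
  have dv1 : ∀ x, HasDerivAt (grn1 L (fun y => pdT u y t)) (-pdT u x t) x := grn_deriv1 k1
  have z0 : v 0 = 0 := grn_zero _ _
  have zL : v L = 0 := grn_L hL _
  have kv : Continuous v := continuous_iff_continuousAt.2 fun x => (dv x).continuousAt
  have e : ∫ x in (0 : ℝ)..L, (pdT θ x t * v x + θ x t * grn L (fun y => pdT (pdT u) y t) x)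
      = ∫ x in (0 : ℝ)..L, (κ * (pdX (pdX θ) x (t - τ) * v x)
        + a * (pdX (pdX θ) x t * v x) + (-1) * (pdX (pdX (pdT u)) x t * v x)
        + 1 * (θ x t * pdX (pdX u) x t) + (-1) * (θ x t ^ 2) + 0 * u x t) := by
    refine intervalIntegral.integral_congr fun x hx => ?_
    rw [Set.uIcc_of_le hL.le] at hx
    simp only [h.pθ hL hx ht, hv x hx]
    ring
  have i0 := int6 (k6.mul kv) (k5.mul kv) (k7.mul kv) (k3.mul k2) (k3.pow 2) k0
    κ a (-1) 1 (-1) 0 L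
  simp only [Pi.mul_apply, Pi.pow_apply] at i0
  rw [e, i0]
  have i1 : ∫ x in (0 : ℝ)..L, pdX (pdX θ) x (t - τ) * v x
      = ∫ x in (0 : ℝ)..L, θ x (t - τ) * -pdT u x t :=
    ibp2 (fun x => s3.dX x (t - τ)) (fun x => s3.sX.dX x (t - τ)) dv dv1 k6 k1.neg r0 rL z0 zL
  have i2 : ∫ x in (0 : ℝ)..L, pdX (pdX θ) x t * v x
      = ∫ x in (0 : ℝ)..L, θ x t * -pdT u x t :=
    ibp2 (fun x => s3.dX x t) (fun x => s3.sX.dX x t) dv dv1 k5 k1.neg t0 tL z0 zL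
  have i3 : ∫ x in (0 : ℝ)..L, pdX (pdX (pdT u)) x t * v x
      = ∫ x in (0 : ℝ)..L, pdT u x t * -pdT u x t :=
    ibp2 (fun x => s1.dX x t) (fun x => s1.sX.dX x t) dv dv1 k7 k1.neg v0 vL z0 zL
  have i5 : ∫ x in (0 : ℝ)..L, pdT u x t * pdT u x t
      = ∫ x in (0 : ℝ)..L, (pdT u x t) ^ 2 := by
    congr 1; funext x; ring
  simp only [mul_neg, intervalIntegral.integral_neg] at i1 i2 i3
  rw [i5] at i3
  rw [i1, i2, i3]
  ring

end IsSmoothSolDHBeamXX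

/-- `∫_{t-τ}^t F`. -/
lemma delay_deriv {F : ℝ → ℝ} (cF : Continuous F) (τ t : ℝ) :
    HasDerivAt (fun t => ∫ s in (t - τ)..t, F s) (F t - F (t - τ)) t := by
  have h1 : ∀ x, HasDerivAt (fun x => ∫ y in (0 : ℝ)..x, F y) (F x) x := fun x =>
    intervalIntegral.integral_hasDerivAt_right (cF.intervalIntegrable _ _)
      (cF.stronglyMeasurableAtFilter _ _) cF.continuousAt
  have h2 : HasDerivAt (fun x => ∫ y in (0 : ℝ)..(x - τ), F y) (F (t - τ)) t :=
    (h1 (t - τ)).comp_sub_const t τ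
  have e : (fun t => ∫ s in (t - τ)..t, F s)
      = fun t => (∫ y in (0 : ℝ)..t, F y) - ∫ y in (0 : ℝ)..(t - τ), F y := by
    funext t
    rw [intervalIntegral.integral_interval_sub_left (cF.intervalIntegrable _ _)
      (cF.intervalIntegrable _ _)]
  rw [e]
  exact (h1 t).sub h2

lemma delay_energy {L τ : ℝ} (hτ : 0 < τ) {f : ℝ → ℝ → ℝ}
    (hf : Continuous fun p : ℝ × ℝ => f p.1 p.2) (t : ℝ) :
    τ * (∫ x in (0 : ℝ)..L, ∫ ρ in (0 : ℝ)..(1 : ℝ), f x (t - τ * ρ))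
      = ∫ s in (t - τ)..t, ∫ x in (0 : ℝ)..L, f x s := by
  have c : Continuous (Function.uncurry fun x ρ => f x (t - τ * ρ)) :=
    hf.comp (by fun_prop : Continuous fun p : ℝ × ℝ => (p.1, t - τ * p.2))
  rw [intervalIntegral_intervalIntegral_swap (F := fun x ρ => f x (t - τ * ρ))]
  · have := intervalIntegral.mul_integral_comp_sub_mul (a := 0) (b := 1)
      (f := fun s => ∫ x in (0 : ℝ)..L, f x s) τ t
    simpa using this
  · exact (c.continuousOn.integrableOn_compact (isCompact_uIcc.prod isCompact_uIcc)).mono_set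
      (Set.prod_mono Set.uIoc_subset_uIcc Set.uIoc_subset_uIcc)

lemma coef_exists {a κ η : ℝ} (hκ : 0 < κ) (ha : 0 < a) (hη : 0 < η)
    (h : κ ^ 2 < η * (2 * a - η)) :
    ∃ c0 > (0 : ℝ), ∃ c > (0 : ℝ), κ * c / 2 + c0 ≤ η / 2 ∧ κ / (2 * c) + c0 ≤ a - η / 2 := by
  set α := a - η / 2 with hα
  set β := η / 2 with hβ
  have hβ0 : 0 < β := by positivity
  have hδ : κ ^ 2 / 4 < α * β := by rw [hα, hβ]; nlinarith
  have hα0 : 0 < α := by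
    by_contra hn
    push Not at hn
    have : α * β ≤ 0 := mul_nonpos_of_nonpos_of_nonneg hn hβ0.le
    have : 0 < κ ^ 2 := by positivity
    linarith
  have hab : α + β = a := by rw [hα, hβ]; ring
  set c0 := (α * β - κ ^ 2 / 4) / a with hc0
  have hc0a : c0 * a = α * β - κ ^ 2 / 4 := by rw [hc0]; field_simp
  have hc0p : 0 < c0 := div_pos (by linarith) ha
  have hκ2 : 0 < κ ^ 2 := by positivity
  have hβc : 0 < β - c0 := by
    have : c0 * a < β * a := by rw [hc0a, ← hab]; nlinarith
    linarith [lt_of_mul_lt_mul_right this ha.le]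
  have key : κ ^ 2 / 4 ≤ (α - c0) * (β - c0) := by
    have : (α - c0) * (β - c0) = α * β - c0 * (α + β) + c0 ^ 2 := by ring
    rw [this, hab, hc0a]; nlinarith [sq_nonneg c0]
  refine ⟨c0, hc0p, 2 * (β - c0) / κ, by positivity, ?_, ?_⟩
  · have : κ * (2 * (β - c0) / κ) / 2 = β - c0 := by field_simp
    rw [this]; linarith
  · have : κ / (2 * (2 * (β - c0) / κ)) = κ ^ 2 / 4 / (β - c0) := by field_simp; ring
    rw [this]
    have : κ ^ 2 / 4 / (β - c0) ≤ α - c0 := by rw [div_le_iff₀ hβc]; exact key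
    linarith

lemma exp_decay {F F' : ℝ → ℝ} {w : ℝ} (hF : Continuous F)
    (hd : ∀ t, 0 < t → HasDerivAt F (F' t) t) (hle : ∀ t, 0 < t → F' t ≤ -w * F t)
    {t : ℝ} (ht : 0 ≤ t) : F t ≤ Real.exp (-w * t) * F 0 := by
  have hG : ∀ t, 0 < t → HasDerivAt (fun t => Real.exp (w * t) * F t)
      (Real.exp (w * t) * (w * F t + F' t)) t := by
    intro t ht
    have h1 : HasDerivAt (fun t => Real.exp (w * t)) (Real.exp (w * t) * w) t := by
      have := ((hasDerivAt_id t).const_mul w).exp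
      simpa using this
    refine (h1.mul (hd t ht)).congr_deriv ?_
    ring
  have hanti : AntitoneOn (fun t => Real.exp (w * t) * F t) (Set.Ici 0) := by
    refine antitoneOn_of_deriv_nonpos (convex_Ici 0) (by fun_prop) ?_ ?_
    · intro t ht
      rw [interior_Ici] at ht
      exact (hG t ht).differentiableAt.differentiableWithinAt
    · intro t ht
      rw [interior_Ici] at ht
      rw [(hG t ht).deriv]
      exact mul_nonpos_of_nonneg_of_nonpos (Real.exp_pos _).le (by linarith [hle t ht])
  have := hanti (Set.self_mem_Ici) ht ht
  simp only [mul_zero, Real.exp_zero, one_mul] at this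
  calc F t = Real.exp (-w * t) * (Real.exp (w * t) * F t) := by
        rw [← mul_assoc, ← Real.exp_add]; simp
    _ ≤ _ := mul_le_mul_of_nonneg_left this (Real.exp_pos _).le

/-- Weighted delay term bounds. -/
lemma delay_bounds {g : ℝ → ℝ} (cg : Continuous g) (hg : ∀ s, 0 ≤ g s) {τ : ℝ} (hτ : 0 < τ)
    (t : ℝ) :
    Real.exp (-τ) * (∫ s in (t - τ)..t, g s)
      ≤ Real.exp (-t) * (∫ s in (t - τ)..t, Real.exp s * g s) ∧
    Real.exp (-t) * (∫ s in (t - τ)..t, Real.exp s * g s) ≤ ∫ s in (t - τ)..t, g s := by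
  rw [← intervalIntegral.integral_const_mul, ← intervalIntegral.integral_const_mul]
  constructor
  · refine intervalIntegral.integral_mono_on (by linarith)
      (Continuous.intervalIntegrable (by fun_prop) _ _)
      (Continuous.intervalIntegrable (by fun_prop) _ _) fun s hs => ?_
    rw [← mul_assoc, ← Real.exp_add]
    exact mul_le_mul_of_nonneg_right (Real.exp_le_exp.2 (by linarith [hs.1])) (hg s)
  · refine intervalIntegral.integral_mono_on (by linarith)
      (Continuous.intervalIntegrable (by fun_prop) _ _)
      (Continuous.intervalIntegrable (by fun_prop) _ _) fun s hs => ?_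
    rw [← mul_assoc, ← Real.exp_add]
    have : Real.exp (-t + s) ≤ 1 := Real.exp_le_one_iff.2 (by linarith [hs.2])
    exact mul_le_of_le_one_left (hg s) this

/-- The purely algebraic dissipation estimate. -/
lemma lyap_alg {a κ η c0 c N L A B T T1 g g1 X Y1 Y Z D : ℝ}
    (hκ : 0 < κ) (ha : 0 < a)
    (hc1 : κ * c / 2 + c0 ≤ η / 2) (hc2 : κ / (2 * c) + c0 ≤ a - η / 2)
    (hA : 0 ≤ A) (hg : 0 ≤ g) (hg1 : 0 ≤ g1)
    (hT : T ≤ L ^ 2 * g) (hT1 : T1 ≤ L ^ 2 * g1)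
    (hX : |X| ≤ c / 2 * g1 + 1 / (2 * c) * g)
    (hY1 : |Y1| ≤ (3 * κ) / 2 * T1 + 1 / (2 * (3 * κ)) * A)
    (hY : |Y| ≤ (3 * a) / 2 * T + 1 / (2 * (3 * a)) * A)
    (hZ : |Z| ≤ 2 / 2 * T + 1 / (2 * 2) * B) {e : ℝ} (he : 0 ≤ e)
    (hN0 : 0 ≤ N) (hN : (11 / 2 + 9 / 2 * a ^ 2) * L ^ 2 + 9 / 2 * κ ^ 2 * L ^ 2 + 1 ≤ N * c0) :
    N * (-(a - η / 2) * g - κ * X - η / 2 * g1)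
      - 3 * (A - κ * Y1 - a * Y + Z - T) + (A - B + Z) + (-D + g - e * g1)
      ≤ - (1 / 2 * (A + B + T) + D) := by
  have x1 : -κ * X ≤ κ * c / 2 * g1 + κ / (2 * c) * g := by
    have := mul_le_mul_of_nonneg_left hX hκ.le
    have h2 := mul_le_mul_of_nonneg_left (neg_abs_le X) hκ.le
    have e1 : κ * (c / 2 * g1 + 1 / (2 * c) * g) = κ * c / 2 * g1 + κ / (2 * c) * g := by ring
    linarith
  have x2 : -(a - η / 2) * g - κ * X - η / 2 * g1 ≤ -c0 * (g + g1) := by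
    have := mul_le_mul_of_nonneg_right hc1 hg1
    have := mul_le_mul_of_nonneg_right hc2 hg
    linarith
  have x3 := mul_le_mul_of_nonneg_left x2 hN0
  have y1 : 3 * κ * Y1 ≤ 9 / 2 * κ ^ 2 * T1 + 1 / 2 * A := by
    have := mul_le_mul_of_nonneg_left ((le_abs_self _).trans hY1) (by positivity : 0 ≤ 3 * κ)
    have e1 : 3 * κ * ((3 * κ) / 2 * T1 + 1 / (2 * (3 * κ)) * A)
        = 9 / 2 * κ ^ 2 * T1 + 1 / 2 * A := by field_simp; ring
    linarith
  have y2 : 3 * a * Y ≤ 9 / 2 * a ^ 2 * T + 1 / 2 * A := by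
    have := mul_le_mul_of_nonneg_left ((le_abs_self _).trans hY) (by positivity : 0 ≤ 3 * a)
    have e1 : 3 * a * ((3 * a) / 2 * T + 1 / (2 * (3 * a)) * A)
        = 9 / 2 * a ^ 2 * T + 1 / 2 * A := by field_simp; ring
    linarith
  have z : -2 * Z ≤ 2 * T + 1 / 2 * B := by
    have := (neg_abs_le Z); linarith
  have q1 := mul_le_mul_of_nonneg_right hN (add_nonneg hg hg1)
  have q2 : (11 / 2 + 9 / 2 * a ^ 2) * T ≤ (11 / 2 + 9 / 2 * a ^ 2) * (L ^ 2 * g) :=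
    mul_le_mul_of_nonneg_left hT (by positivity)
  have q3 : 9 / 2 * κ ^ 2 * T1 ≤ 9 / 2 * κ ^ 2 * (L ^ 2 * g1) :=
    mul_le_mul_of_nonneg_left hT1 (by positivity)
  have r1 : 0 ≤ (11 / 2 + 9 / 2 * a ^ 2) * L ^ 2 * g1 := by positivity
  have r2 : 0 ≤ 9 / 2 * κ ^ 2 * L ^ 2 * g := by positivity
  have r3 : 0 ≤ e * g1 := by positivity
  linarith

/-- Exponential stability of the thermoelastic beam with delayed heat conduction and
coupling through `θ_xx`, for `0 < κ < a` and `ξ` in the interior of `J_{a,κ,τ}`. -/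
theorem exponential_stability_DHbeamXX
    (L τ a κ ξ : ℝ) (hL : 0 < L) (hτ : 0 < τ) (hκ : 0 < κ) (hκa : κ < a)
    (hξ₁ : τ * (a - Real.sqrt (a ^ 2 - κ ^ 2)) < ξ)
    (hξ₂ : ξ < τ * (a + Real.sqrt (a ^ 2 - κ ^ 2))) :
    ∃ C > (0 : ℝ), ∃ w > (0 : ℝ), ∀ u θ : ℝ → ℝ → ℝ,
      IsSmoothSolDHBeamXX L τ a κ u θ →
      ∀ t ≥ (0 : ℝ),
        energyDHBeam L τ ξ u θ t ≤ C * Real.exp (-w * t) * energyDHBeam L τ ξ u θ 0 := by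
  have ha : 0 < a := hκ.trans hκa
  set r := Real.sqrt (a ^ 2 - κ ^ 2) with hr
  have hr2 : r ^ 2 = a ^ 2 - κ ^ 2 := Real.sq_sqrt (by nlinarith)
  have hr0 : 0 ≤ r := Real.sqrt_nonneg _
  have hra : r < a := by nlinarith
  have hξ : 0 < ξ := lt_trans (mul_pos hτ (by linarith)) hξ₁
  obtain ⟨η, hη⟩ : ∃ η, η = ξ / τ := ⟨_, rfl⟩
  have hξη : ξ = η * τ := by rw [hη]; field_simp
  have hη0 : 0 < η := by rw [hη]; positivity
  have hη1 : a - r < η := by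
    rw [hξη, mul_comm η τ] at hξ₁; exact lt_of_mul_lt_mul_left hξ₁ hτ.le
  have hη2 : η < a + r := by
    rw [hξη, mul_comm η τ] at hξ₂; exact lt_of_mul_lt_mul_left hξ₂ hτ.le
  have hdisc : κ ^ 2 < η * (2 * a - η) := by nlinarith
  obtain ⟨c0, hc0, c, hc, hc1, hc2⟩ := coef_exists hκ ha hη0 hdisc
  obtain ⟨W, hW⟩ : ∃ W, W = (11 / 2 + 9 / 2 * a ^ 2) * L ^ 2 + 9 / 2 * κ ^ 2 * L ^ 2 + 1 :=
    ⟨_, rfl⟩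
  have hW0 : 0 < W := by rw [hW]; positivity
  obtain ⟨M, hM⟩ : ∃ M, M = 4 + 4 * L ^ 4 := ⟨_, rfl⟩
  have hM0 : 0 < M := by rw [hM]; positivity
  obtain ⟨N, hN⟩ : ∃ N, N = M + 1 + W / c0 := ⟨_, rfl⟩
  have hWc : 0 < W / c0 := by positivity
  have hN0 : 0 ≤ N := by rw [hN]; positivity
  have hNM : M + 1 ≤ N := by rw [hN]; linarith
  have hNc : W ≤ N * c0 := by
    have : W / c0 ≤ N := by rw [hN]; linarith
    rwa [div_le_iff₀ hc0] at this
  obtain ⟨c1, hc1d⟩ : ∃ c1, c1 = min 1 (2 * Real.exp (-τ) / η) := ⟨_, rfl⟩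
  have hc1p : 0 < c1 := by rw [hc1d]; exact lt_min one_pos (by positivity)
  have hc11 : c1 ≤ 1 := by rw [hc1d]; exact min_le_left _ _
  have hc12 : c1 * η ≤ 2 * Real.exp (-τ) := by
    have : c1 ≤ 2 * Real.exp (-τ) / η := by rw [hc1d]; exact min_le_right _ _
    rwa [le_div_iff₀ hη0] at this
  obtain ⟨C, hC⟩ : ∃ C, C = N + M + 2 / η := ⟨_, rfl⟩
  have hC0 : 0 < C := by rw [hC]; positivity
  refine ⟨C, hC0, c1 / C, by positivity, ?_⟩
  intro u θ h t ht
  -- scalar quantities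
  have s0 := h.su
  have s1 := h.su.sT
  have s2 := h.su.sX.sX
  have s3 := h.sθ
  obtain ⟨g, hg⟩ : ∃ g : ℝ → ℝ, g = fun t => ∫ x in (0 : ℝ)..L, (pdX θ x t) ^ 2 := ⟨_, rfl⟩
  have cg : Continuous g := by
    have := (cont_int (f := fun x t => (pdX θ x t) ^ 2) (s3.sX.cont.pow 2)).comp
      (by fun_prop : Continuous fun t : ℝ => (L, t))
    rw [hg]; exact this
  have g0 : ∀ s, 0 ≤ g s := fun s => by
    rw [hg]; exact intervalIntegral.integral_nonneg hL.le fun x _ => sq_nonneg _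
  obtain ⟨S, hS⟩ : ∃ S : ℝ → ℝ, S = fun t => ∫ x in (0 : ℝ)..L,
    ((pdT u x t) ^ 2 + (pdX (pdX u) x t) ^ 2 + (θ x t) ^ 2) := ⟨_, rfl⟩
  obtain ⟨K, hK⟩ : ∃ K : ℝ → ℝ, K = fun t => ∫ x in (0 : ℝ)..L,
    θ x t * grn L (fun y => pdT u y t) x := ⟨_, rfl⟩
  obtain ⟨J, hJ⟩ : ∃ J : ℝ → ℝ, J = fun t => ∫ x in (0 : ℝ)..L, pdT u x t * u x t := ⟨_, rfl⟩
  obtain ⟨Q, hQ⟩ : ∃ Q : ℝ → ℝ, Q = fun t => ∫ s in (t - τ)..t, g s := ⟨_, rfl⟩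
  obtain ⟨R, hR⟩ : ∃ R : ℝ → ℝ, R = fun t => ∫ s in (t - τ)..t, Real.exp s * g s := ⟨_, rfl⟩
  have hE : ∀ t, energyDHBeam L τ ξ u θ t = 1 / 2 * S t + η / 2 * Q t := by
    intro t
    have := delay_energy (L := L) hτ (f := fun x t => (pdX θ x t) ^ 2) (s3.sX.cont.pow 2) t
    have e2 : Q t = τ * (∫ x in (0 : ℝ)..L, ∫ ρ in (0 : ℝ)..(1 : ℝ), (pdX θ x (t - τ * ρ)) ^ 2) := by
      rw [hQ, hg]; exact this.symm
    rw [e2, hS]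
    unfold energyDHBeam
    rw [hξη]; ring
  have hSs : ∀ t, S t = (∫ x in (0 : ℝ)..L, (pdT u x t) ^ 2)
      + (∫ x in (0 : ℝ)..L, (pdX (pdX u) x t) ^ 2) + ∫ x in (0 : ℝ)..L, (θ x t) ^ 2 := by
    intro t
    have k1 := s1.cx t
    have k2 := s2.cx t
    have k3 := s3.cx t
    rw [hS]
    simp only
    rw [intervalIntegral.integral_add, intervalIntegral.integral_add]
    all_goals exact Continuous.intervalIntegrable (by fun_prop) _ _
  have nn : ∀ f : ℝ → ℝ, 0 ≤ ∫ x in (0 : ℝ)..L, (f x) ^ 2 := fun f =>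
    intervalIntegral.integral_nonneg hL.le fun x _ => sq_nonneg _
  have S0 : ∀ t, 0 ≤ S t := fun t => by
    rw [hSs]
    exact add_nonneg (add_nonneg (nn _) (nn _)) (nn _)
  have Q0 : ∀ t, 0 ≤ Q t := fun t => by
    rw [hQ]; exact intervalIntegral.integral_nonneg (by linarith) fun x _ => g0 x
  have hD1 : ∀ t, Real.exp (-τ) * Q t ≤ Real.exp (-t) * R t := fun t => by
    rw [hQ, hR]; exact (delay_bounds cg g0 hτ t).1
  have hD2 : ∀ t, Real.exp (-t) * R t ≤ Q t := fun t => by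
    rw [hQ, hR]; exact (delay_bounds cg g0 hτ t).2
  have dQ : ∀ t, HasDerivAt Q (g t - g (t - τ)) t := fun t => by
    rw [hQ]; exact delay_deriv cg τ t
  have dR : ∀ t, HasDerivAt R (Real.exp t * g t - Real.exp (t - τ) * g (t - τ)) t := fun t => by
    rw [hR]; exact delay_deriv (F := fun s => Real.exp s * g s) (by fun_prop) τ t
  have dD : ∀ t, HasDerivAt (fun t => Real.exp (-t) * R t)
      (-(Real.exp (-t) * R t) + g t - Real.exp (-τ) * g (t - τ)) t := by
    intro t
    have h1 : HasDerivAt (fun t : ℝ => Real.exp (-t)) (-Real.exp (-t)) t := by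
      have := (hasDerivAt_id t).neg.exp
      simpa using this
    refine (h1.mul (dR t)).congr_deriv ?_
    have e1 : Real.exp (-t) * Real.exp t = 1 := by rw [← Real.exp_add]; simp
    have e2 : Real.exp (-t) * Real.exp (t - τ) = Real.exp (-τ) := by
      rw [← Real.exp_add]; congr 1; ring
    rw [mul_sub, ← mul_assoc, ← mul_assoc, e1, e2]; ring
  -- size of the auxiliary functionals
  have hKb : ∀ t, |K t| ≤ 1 / 2 * (∫ x in (0 : ℝ)..L, (θ x t) ^ 2)
      + 1 / 2 * (L ^ 4 * ∫ x in (0 : ℝ)..L, (pdT u x t) ^ 2) := by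
    intro t
    have k1 := s1.cx t
    have k3 := s3.cx t
    have dv := grn_deriv (L := L) k1
    have kv : Continuous (grn L (fun y => pdT u y t)) :=
      continuous_iff_continuousAt.2 fun x => (dv x).continuousAt
    have b1 := int_mul_le hL k3 kv one_pos
    have b2 := poin2 hL dv (grn_deriv1 (L := L) k1) k1.neg (grn_zero _ _) (grn_L hL _)
    simp only [neg_sq] at b2
    rw [hK]
    simp only
    linarith
  have hJb : ∀ t, 0 ≤ t → |J t| ≤ 1 / 2 * (∫ x in (0 : ℝ)..L, (pdT u x t) ^ 2)
      + 1 / 2 * (L ^ 4 * ∫ x in (0 : ℝ)..L, (pdX (pdX u) x t) ^ 2) := by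
    intro t ht
    obtain ⟨u0, uL, w0, wL⟩ := h.bc_u t ht
    have b1 := int_mul_le hL (s1.cx t) (s0.cx t) one_pos
    have b2 := poin2 hL (fun x => s0.dX x t) (fun x => s0.sX.dX x t) (s2.cx t) u0 uL
    rw [hJ]
    simp only
    linarith
  have hKJ : ∀ t, 0 ≤ t → |3 * K t| + |J t| ≤ M * (1 / 2 * S t) := by
    intro t ht
    have b1 := hKb t
    have b2 := hJb t ht
    rw [abs_mul, abs_of_pos (by norm_num : (0 : ℝ) < 3), hSs, hM]
    have n1 := nn (fun x => pdT u x t)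
    have n2 := nn (fun x => pdX (pdX u) x t)
    have n3 := nn (fun x => θ x t)
    have hL4 : 0 ≤ L ^ 4 := by positivity
    have m1 := mul_nonneg hL4 n1
    have m2 := mul_nonneg hL4 n2
    have m3 := mul_nonneg hL4 n3
    linarith
  obtain ⟨F, hF⟩ : ∃ F : ℝ → ℝ, F = fun t => N * (1 / 2 * S t + η / 2 * Q t) - 3 * K t + J t
    + Real.exp (-t) * R t := ⟨_, rfl⟩
  have cQ : Continuous Q := continuous_iff_continuousAt.2 fun x => (dQ x).continuousAt
  have cR : Continuous R := continuous_iff_continuousAt.2 fun x => (dR x).continuousAt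
  have cS : Continuous S := by rw [hS]; exact h.energy_cont
  have cK : Continuous K := by rw [hK]; exact h.K_cont
  have cJ : Continuous J := by
    rw [hJ]; exact continuous_iff_continuousAt.2 fun x => (h.J_diff x).continuousAt
  have cF : Continuous F := by rw [hF]; fun_prop
  have E0 : ∀ t, 0 ≤ 1 / 2 * S t + η / 2 * Q t := fun t => by
    have := S0 t; have := Q0 t; positivity
  have Flow : ∀ t, 0 ≤ t → 1 / 2 * S t + η / 2 * Q t ≤ F t := by
    intro t ht
    have b := hKJ t ht
    have b1 := le_abs_self (3 * K t)
    have b2 := neg_abs_le (J t)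
    have b3 : 0 ≤ Real.exp (-t) * R t :=
      le_trans (mul_nonneg (Real.exp_pos _).le (Q0 t)) (hD1 t)
    have b4 : 0 ≤ M * (η / 2 * Q t) := by have := Q0 t; positivity
    have b5 := mul_le_mul_of_nonneg_right hNM (E0 t)
    rw [hF]
    simp only
    linarith
  have Fup : ∀ t, 0 ≤ t → F t ≤ C * (1 / 2 * S t + η / 2 * Q t) := by
    intro t ht
    have b := hKJ t ht
    have b1 := neg_abs_le (3 * K t)
    have b2 := le_abs_self (J t)
    have b3 := hD2 t
    have b4 : 0 ≤ M * (η / 2 * Q t) := by have := Q0 t; positivity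
    have b5 : 0 ≤ 2 / η * (1 / 2 * S t) := by have := S0 t; positivity
    have b6 : 2 / η * (η / 2 * Q t) = Q t := by field_simp
    rw [hF, hC]
    simp only
    linarith
  have key : ∀ t, 0 < t → ∃ F', HasDerivAt F F' t ∧ F' ≤ -(c1 / C) * F t := by
    intro t ht
    have dS := h.energy_int hL hτ ht
    have dK := h.K_int hL hτ ht
    have dJ := h.J_int hL hτ ht
    rw [← hS] at dS
    rw [← hK] at dK
    rw [← hJ] at dJ
    have dF := (((((dS.const_mul (1 / 2)).add ((dQ t).const_mul (η / 2))).const_mul N).sub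
      (dK.const_mul 3)).add dJ).add (dD t)
    have hgt : ∫ x in (0 : ℝ)..L, (pdX θ x t) ^ 2 = g t := by rw [hg]
    have hgt1 : ∫ x in (0 : ℝ)..L, (pdX θ x (t - τ)) ^ 2 = g (t - τ) := by rw [hg]
    rw [hgt] at dF
    obtain ⟨t0, tL⟩ := h.bc_θ t (by linarith)
    obtain ⟨r0, rL⟩ := h.bc_θ (t - τ) (by linarith)
    have pT := poin1 hL (fun x => s3.dX x t) (s3.sX.cx t) t0
    have pT1 := poin1 hL (fun x => s3.dX x (t - τ)) (s3.sX.cx (t - τ)) r0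
    rw [hgt] at pT
    rw [hgt1] at pT1
    have hX := int_mul_le hL (s3.sX.cx (t - τ)) (s3.sX.cx t) hc
    rw [hgt, hgt1] at hX
    have hY1 := int_mul_le hL (s3.cx (t - τ)) (s1.cx t) (c := 3 * κ) (by positivity)
    have hY := int_mul_le hL (s3.cx t) (s1.cx t) (c := 3 * a) (by positivity)
    have hZ := int_mul_le hL (s3.cx t) (s2.cx t) (c := 2) (by positivity)
    have alg := lyap_alg (N := N) (D := Real.exp (-t) * R t) hκ ha hc1 hc2
      (nn (fun x => pdT u x t)) (g0 t) (g0 (t - τ))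
      pT pT1 hX hY1 hY hZ (Real.exp_pos (-τ)).le hN0 (by rw [← hW]; exact hNc)
    refine ⟨_, by rw [hF]; exact dF, ?_⟩
    rw [← hSs] at alg
    have f1 : c1 * (1 / 2 * S t + η / 2 * Q t) ≤ 1 / 2 * S t + Real.exp (-t) * R t := by
      have a1 := mul_le_mul_of_nonneg_right hc11 (S0 t)
      have a2 := mul_le_mul_of_nonneg_right hc12 (Q0 t)
      have a3 := hD1 t
      linarith
    have f2 : c1 / C * F t ≤ c1 * (1 / 2 * S t + η / 2 * Q t) := by
      have := mul_le_mul_of_nonneg_left (Fup t ht.le) (by positivity : 0 ≤ c1 / C)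
      have e : c1 / C * (C * (1 / 2 * S t + η / 2 * Q t)) = c1 * (1 / 2 * S t + η / 2 * Q t) := by
        field_simp
      linarith
    refine le_trans (le_of_eq ?_) (alg.trans (by linarith))
    ring
  choose! F' hF' hle using key
  have fin := exp_decay cF hF' hle ht
  rw [hE, hE]
  calc _ ≤ F t := Flow t ht
    _ ≤ _ := fin
    _ ≤ Real.exp (-(c1 / C) * t) * (C * (1 / 2 * S 0 + η / 2 * Q 0)) :=
        mul_le_mul_of_nonneg_left (Fup 0 le_rfl) (Real.exp_pos _).le
    _ = _ := by ring
end
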